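/- arXiv:math/0503443 — 2 statements merged into one kernel-verified Lean document; each statement's English description precedes it below -/
import Mathlib

section
/- For every integer d ≥ 2 and every constant b > 0 there exists a constant c > 0 (depending only on d and b) such that the following holds: for every b-homogeneous set P of n ≥ 3 points in ℝ^d there is a point p ∈ P such that the number of distinct distances from p to the other points of P is at least c · n^{2d/(d²+1)} · (log n)^{(1−d²)/(d²+1)}. -/
open scoped Classical

noncomputable section

/-- Points of `d`-dimensional Euclidean space. -/
abbrev Pt (d : ℕ) : Type := EuclideanSpace ℝ (Fin d)

/-- Closed axis-aligned cube with lower corner `a` and side length `ℓ`. -/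
def closedCube {d : ℕ} (a : Fin d → ℝ) (ℓ : ℝ) : Set (Pt d) :=
  {x | ∀ i, a i ≤ x i ∧ x i ≤ a i + ℓ}

/-- Interior of the axis-aligned cube with lower corner `a` and side length `ℓ`. -/
def openCube {d : ℕ} (a : Fin d → ℝ) (ℓ : ℝ) : Set (Pt d) :=
  {x | ∀ i, a i < x i ∧ x i < a i + ℓ}

/-- `P` is `b`-well-separated: every axis-aligned unit cube contains at most `b` points of `P`. -/
def WellSeparated {d : ℕ} (b : ℝ) (P : Finset (Pt d)) : Prop :=
  ∀ a : Fin d → ℝ, (((↑P : Set (Pt d)) ∩ closedCube a 1).ncard : ℝ) ≤ b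

/-- `P` is `b`-homogeneous: it lies in the interior of an axis-aligned cube of volume `|P|`
and every axis-aligned unit cube contains at most `b` of its points. -/
def IsHomogeneous {d : ℕ} (b : ℝ) (P : Finset (Pt d)) : Prop :=
  (∃ a : Fin d → ℝ, (↑P : Set (Pt d)) ⊆ openCube a ((P.card : ℝ) ^ (1 / (d : ℝ)))) ∧
    WellSeparated b P

/-- `F` is a `k`-flat: a `k`-dimensional affine subspace. -/
def IsKFlat {d : ℕ} (k : ℕ) (F : AffineSubspace ℝ (Pt d)) : Prop :=
  (F : Set (Pt d)).Nonempty ∧ Module.finrank ℝ F.direction = k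

/-- `F` is `m`-rich with respect to `P`: it contains at least `m` points of `P`. -/
def IsRich {d : ℕ} (m : ℕ) (P : Finset (Pt d)) (F : AffineSubspace ℝ (Pt d)) : Prop :=
  m ≤ ((↑P : Set (Pt d)) ∩ (F : Set (Pt d))).ncard

/-- The number of distinct distances measured from `p` to the other points of `P`. -/
def distinctDists {d : ℕ} (P : Finset (Pt d)) (p : Pt d) : ℕ :=
  {r : ℝ | ∃ q ∈ P, q ≠ p ∧ dist p q = r}.ncard

/-- The (closed) subcube indexed by `ι` in the subdivision of the cube with corner `a`
and side `ℓ` into `s^d` congruent subcubes. -/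
def subcube {d : ℕ} (a : Fin d → ℝ) (ℓ : ℝ) (s : ℕ) (ι : Fin d → Fin s) : Set (Pt d) :=
  closedCube (fun i => a i + (ι i : ℝ) * (ℓ / s)) (ℓ / s)

/-- The interior of the subcube indexed by `ι`. -/
def openSubcube {d : ℕ} (a : Fin d → ℝ) (ℓ : ℝ) (s : ℕ) (ι : Fin d → Fin s) : Set (Pt d) :=
  openCube (fun i => a i + (ι i : ℝ) * (ℓ / s)) (ℓ / s)

open MeasureTheory Metric Module in
theorem volume_orthonormal_box {d : ℕ} (e : OrthonormalBasis (Fin d) ℝ (Pt d)) (p : Pt d)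
    (ρ : Fin d → ℝ) :
    volume {x : Pt d | ∀ j, |inner ℝ (e j) (x - p)| ≤ ρ j} = ∏ j, ENNReal.ofReal (2 * ρ j) := by
  have h1 : MeasurePreserving (fun x : Pt d => WithLp.ofLp (e.repr x)) volume volume :=
    (PiLp.volume_preserving_ofLp (Fin d)).comp e.measurePreserving_repr
  have h2 : {x : Pt d | ∀ j, |inner ℝ (e j) (x - p)| ≤ ρ j} =
      (fun x : Pt d => WithLp.ofLp (e.repr x)) ⁻¹'
        Set.Icc (fun j => inner ℝ (e j) p - ρ j) (fun j => inner ℝ (e j) p + ρ j) := by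
    ext x
    simp only [Set.mem_ofPred_eq, Set.mem_preimage, Set.mem_Icc, Pi.le_def, inner_sub_right,
      e.repr_apply_apply, abs_le]
    constructor
    · intro h
      exact ⟨fun j => by linarith [(h j).1], fun j => by linarith [(h j).2]⟩
    · rintro ⟨h, h'⟩ j
      exact ⟨by linarith [h j], by linarith [h' j]⟩
  rw [h2, h1.measure_preimage measurableSet_Icc.nullMeasurableSet, Real.volume_Icc_pi]
  exact Finset.prod_congr rfl fun j _ => by congr 1; ring

open MeasureTheory Metric in
theorem measurableSet_orthonormal_box {d : ℕ} (e : OrthonormalBasis (Fin d) ℝ (Pt d)) (p : Pt d)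
    (ρ : Fin d → ℝ) : MeasurableSet {x : Pt d | ∀ j, |inner ℝ (e j) (x - p)| ≤ ρ j} := by
  rw [Set.ofPred_forall]
  refine MeasurableSet.iInter fun j => (isClosed_le ?_ continuous_const).measurableSet
  fun_prop

open MeasureTheory Metric in
theorem volume_real_orthonormal_box {d : ℕ} (e : OrthonormalBasis (Fin d) ℝ (Pt d)) (p : Pt d)
    {ρ : Fin d → ℝ} (hρ : ∀ j, 0 ≤ ρ j) :
    volume.real {x : Pt d | ∀ j, |inner ℝ (e j) (x - p)| ≤ ρ j} = ∏ j, (2 * ρ j) := by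
  rw [Measure.real, volume_orthonormal_box, ENNReal.toReal_prod]
  exact Finset.prod_congr rfl fun j _ => ENNReal.toReal_ofReal (by linarith [hρ j])

open MeasureTheory Metric in
theorem volume_orthonormal_box_ne_top {d : ℕ} (e : OrthonormalBasis (Fin d) ℝ (Pt d)) (p : Pt d)
    (ρ : Fin d → ℝ) : volume {x : Pt d | ∀ j, |inner ℝ (e j) (x - p)| ≤ ρ j} ≠ ⊤ := by
  rw [volume_orthonormal_box]
  exact ENNReal.prod_ne_top fun j _ => ENNReal.ofReal_ne_top

open MeasureTheory Metric in
theorem volume_real_ball_pos_radius {d : ℕ} (x : Pt d) {r : ℝ} (hr : 0 < r) :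
    volume.real (ball x r) = r ^ d * volume.real (ball (0 : Pt d) 1) := by
  rw [Measure.real, Measure.addHaar_ball_of_pos _ _ hr, ENNReal.toReal_mul,
    ENNReal.toReal_ofReal (by positivity), finrank_euclideanSpace_fin]
  rfl

open MeasureTheory Metric in
theorem volume_real_unit_ball_pos (d : ℕ) : 0 < volume.real (ball (0 : Pt d) 1) :=
  ENNReal.toReal_pos (measure_ball_pos _ _ one_pos).ne' measure_ball_lt_top.ne

open MeasureTheory Metric in
/-- Packing bound for a `δ`-separated set. -/
theorem card_mul_le_volume {d : ℕ} {Z : Finset (Pt d)} {δ : ℝ} (hδ : 0 < δ)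
    (hsep : ∀ x ∈ Z, ∀ y ∈ Z, x ≠ y → δ ≤ dist x y) {A : Set (Pt d)} (hA : volume A ≠ ⊤)
    (hZ : ∀ z ∈ Z, ball z (δ / 2) ⊆ A) :
    (Z.card : ℝ) * ((δ / 2) ^ d * volume.real (ball (0 : Pt d) 1)) ≤ volume.real A := by
  have h1 : volume.real (⋃ z ∈ Z, ball z (δ / 2)) =
      (Z.card : ℝ) * ((δ / 2) ^ d * volume.real (ball (0 : Pt d) 1)) := by
    rw [measureReal_biUnion_finset]
    · rw [Finset.sum_congr rfl fun z _ => volume_real_ball_pos_radius z (half_pos hδ)]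
      simp
    · intro x hx y hy hxy
      exact ball_disjoint_ball (by linarith [hsep x hx y hy hxy])
    · exact fun _ _ => measurableSet_ball
  rw [← h1]
  exact measureReal_mono (Set.iUnion₂_subset hZ) hA

open MeasureTheory Metric in
theorem card_le_of_subset_closedBall {d : ℕ} {Z : Finset (Pt d)} {δ : ℝ} (hδ : 0 < δ)
    (hsep : ∀ x ∈ Z, ∀ y ∈ Z, x ≠ y → δ ≤ dist x y) {p : Pt d} {r : ℝ} (hr : 0 ≤ r)
    (hZ : ∀ z ∈ Z, dist z p ≤ r) : (Z.card : ℝ) ≤ (2 * r / δ + 1) ^ d := by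
  have hω := volume_real_unit_ball_pos d
  have h := card_mul_le_volume hδ hsep (A := ball p (r + δ / 2)) measure_ball_lt_top.ne
    fun z hz => ball_subset_ball' (by linarith [hZ z hz])
  rw [volume_real_ball_pos_radius p (by positivity), ← mul_assoc,
    mul_le_mul_iff_left₀ hω] at h
  have h2 : (2 * r / δ + 1) ^ d = (r + δ / 2) ^ d / (δ / 2) ^ d := by
    rw [← div_pow]; congr 1; field_simp
  rw [h2, le_div_iff₀ (by positivity)]
  exact h

theorem pow_succ_sub_pow_succ_le {x y : ℝ} (hy : 0 ≤ y) (hyx : y ≤ x) (k : ℕ) :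
    x ^ (k + 1) - y ^ (k + 1) ≤ (k + 1) * (x - y) * x ^ k := by
  have h := abs_pow_sub_pow_le x y (k + 1)
  rw [abs_of_nonneg (sub_nonneg.2 (pow_le_pow_left₀ hy hyx _)), abs_of_nonneg (sub_nonneg.2 hyx),
    abs_of_nonneg hy, abs_of_nonneg (hy.trans hyx), max_eq_left hyx] at h
  push_cast at h
  simpa [mul_comm, mul_assoc, mul_left_comm] using h

open MeasureTheory Metric in
/-- A `w`-separated set in the `w`-neighbourhood of a sphere of radius at most `D`. -/
theorem card_le_of_near_sphere {k : ℕ} {Z : Finset (Pt (k + 1))} {w D r : ℝ} (hw : 0 < w)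
    (hwD : w ≤ D) (hr : 0 ≤ r) (hrD : r ≤ D)
    (hsep : ∀ x ∈ Z, ∀ y ∈ Z, x ≠ y → w ≤ dist x y) {p : Pt (k + 1)}
    (hZ : ∀ z ∈ Z, |dist z p - r| ≤ w) :
    (Z.card : ℝ) ≤ 8 * (k + 1) * 6 ^ k * (D / w) ^ k := by
  have hω := volume_real_unit_ball_pos (k + 1)
  set ω := volume.real (ball (0 : Pt (k + 1)) 1)
  set s := max 0 (r - 2 * w) with hs
  have hs0 : 0 ≤ s := le_max_left _ _
  have hsr : s ≤ r + 2 * w := max_le (by linarith) (by linarith)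
  have hsub : ball p s ⊆ ball p (r + 2 * w) := ball_subset_ball hsr
  have hvs : volume.real (ball p s) = s ^ (k + 1) * ω := by
    rcases hs0.eq_or_lt with h | h
    · rw [← h]; simp
    · exact volume_real_ball_pos_radius p h
  have h := card_mul_le_volume hw hsep (A := ball p (r + 2 * w) \ ball p s)
    (measure_ne_top_of_subset Set.sdiff_subset measure_ball_lt_top.ne) (by
      intro z hz x hx
      have h1 := abs_le.1 (hZ z hz)
      rw [mem_ball] at hx
      refine ⟨?_, ?_⟩
      · rw [mem_ball]
        linarith [dist_triangle x z p]
      · rw [mem_ball, not_lt]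
        refine max_le dist_nonneg ?_
        linarith [dist_triangle z x p, dist_comm x z])
  rw [measureReal_sdiff hsub measurableSet_ball, hvs,
    volume_real_ball_pos_radius p (by linarith), ← mul_assoc, ← sub_mul,
    mul_le_mul_iff_left₀ hω] at h
  have h2 := pow_succ_sub_pow_succ_le hs0 hsr k
  have h3 : r + 2 * w - s ≤ 4 * w := by linarith [le_max_right 0 (r - 2 * w)]
  have h4 : (r + 2 * w) ^ k ≤ (3 * D) ^ k := pow_le_pow_left₀ (by linarith) (by linarith) k
  have h5 : (Z.card : ℝ) * (w / 2) ^ (k + 1) ≤ (k + 1) * (4 * w) * (3 * D) ^ k :=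
    h.trans (h2.trans (by gcongr))
  rw [← le_div_iff₀ (by positivity)] at h5
  refine h5.trans (le_of_eq ?_)
  rw [div_pow, mul_pow, div_pow, show (6 : ℝ) = 3 * 2 by norm_num, mul_pow]
  field_simp
  ring

open MeasureTheory Metric Module in
/-- A `1`-separated set in a slab. -/
theorem card_le_of_slab {k : ℕ} {Z : Finset (Pt (k + 1))} {w D : ℝ} (hw : 1 ≤ w) (hD : 1 ≤ D)
    (hsep : ∀ x ∈ Z, ∀ y ∈ Z, x ≠ y → 1 ≤ dist x y) {p u : Pt (k + 1)} (hu : ‖u‖ = 1)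
    (hZp : ∀ z ∈ Z, dist z p ≤ 2 * D) (hZ : ∀ z ∈ Z, |inner ℝ u (z - p)| ≤ w) :
    (Z.card : ℝ) * (volume.real (ball (0 : Pt (k + 1)) 1)) ≤ 8 * 12 ^ k * (w * D ^ k) := by
  set f : Fin (k + 1) → Pt (k + 1) := fun _ => u with hf
  obtain ⟨e, he⟩ : ∃ e : OrthonormalBasis (Fin (k + 1)) ℝ (Pt (k + 1)), e 0 = u := by
    obtain ⟨e, he⟩ := Orthonormal.exists_orthonormalBasis_extension_of_card_eq
      (𝕜 := ℝ) (E := Pt (k + 1)) (ι := Fin (k + 1)) (by simp) (v := f) (s := {0}) (by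
        constructor
        · rintro ⟨i, rfl⟩; simpa [hf] using hu
        · rintro ⟨i, rfl⟩ ⟨j, rfl⟩ h; exact absurd rfl h)
    exact ⟨e, he 0 rfl⟩
  set ρ : Fin (k + 1) → ℝ := Fin.cons (2 * w) fun _ => 3 * D with hρ
  have h := card_mul_le_volume one_pos hsep
    (A := {x | ∀ j, |inner ℝ (e j) (x - p)| ≤ ρ j}) (volume_orthonormal_box_ne_top e p ρ) (by
      intro z hz x hx j
      rw [mem_ball, dist_eq_norm] at hx
      have key : |inner ℝ (e j) (x - p)| ≤ |inner ℝ (e j) (z - p)| + 1 / 2 := by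
        have : x - p = (z - p) + (x - z) := by abel
        rw [this, inner_add_right]
        refine (abs_add_le _ _).trans (add_le_add le_rfl ?_)
        refine (abs_real_inner_le_norm _ _).trans ?_
        simp [e.norm_eq_one]; linarith
      refine key.trans ?_
      refine Fin.cases ?_ (fun i => ?_) j
      · simp only [hρ, Fin.cons_zero, he]; linarith [hZ z hz]
      · simp only [hρ, Fin.cons_succ]
        have := abs_real_inner_le_norm (e i.succ) (z - p)
        rw [e.norm_eq_one, one_mul, ← dist_eq_norm] at this
        linarith [hZp z hz])
  rw [volume_real_orthonormal_box] at h
  · rw [Fin.prod_univ_succ] at h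
    simp only [hρ, Fin.cons_zero, Fin.cons_succ, Finset.prod_const, Finset.card_univ,
      Fintype.card_fin] at h
    rw [div_pow, one_pow, ← mul_assoc, mul_right_comm, mul_one_div,
      div_le_iff₀ (by positivity)] at h
    refine h.trans (le_of_eq ?_)
    rw [show (12 : ℝ) = 2 * 3 * 2 by norm_num]
    simp only [mul_pow]
    ring
  · refine fun j => Fin.cases ?_ (fun i => ?_) j <;> simp [hρ] <;> linarith

theorem exists_maximal_separated {d : ℕ} (Q : Finset (Pt d)) (w : ℝ) (hw : 0 < w) :
    ∃ Z ⊆ Q, (∀ x ∈ Z, ∀ y ∈ Z, x ≠ y → w ≤ dist x y) ∧ ∀ q ∈ Q, ∃ z ∈ Z, dist q z < w := by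
  obtain ⟨Z, hZ, hmax⟩ := (Q.powerset.filter
    fun Z => ∀ x ∈ Z, ∀ y ∈ Z, x ≠ y → w ≤ dist x y).exists_max_image Finset.card
    ⟨∅, by simp⟩
  simp only [Finset.mem_filter, Finset.mem_powerset] at hZ hmax
  refine ⟨Z, hZ.1, hZ.2, fun q hq => ?_⟩
  by_contra! hcon
  have hqZ : q ∉ Z := fun h => by
    have := hcon q h
    rw [dist_self] at this
    linarith
  have := hmax (insert q Z) ⟨Finset.insert_subset hq hZ.1, ?_⟩
  · rw [Finset.card_insert_of_notMem hqZ] at this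
    omega
  · intro x hx y hy hxy
    rw [Finset.mem_insert] at hx hy
    rcases hx with rfl | hx <;> rcases hy with rfl | hy
    · exact absurd rfl hxy
    · exact hcon y hy
    · rw [dist_comm]; exact hcon x hx
    · exact hZ.2 x hx y hy hxy

/-- A minimal basis chosen from a finite spanning set, sorted by norm: every vector of the set is
spanned by the basis vectors that are not longer than it. -/
theorem exists_minimal_basis {d : ℕ} (C : Finset (Pt d))
    (hC : Submodule.span ℝ (C : Set (Pt d)) = ⊤) :
    ∃ v : Fin d → Pt d, (∀ j, v j ∈ C) ∧ LinearIndependent ℝ v ∧ Monotone (fun j => ‖v j‖) ∧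
      ∀ c ∈ C, c ∈ Submodule.span ℝ (v '' {j | ‖v j‖ ≤ ‖c‖}) := by
  obtain ⟨b, hbC, hbs, hbi⟩ := exists_linearIndependent ℝ (C : Set (Pt d))
  have hbfin : b.Finite := C.finite_toSet.subset hbC
  have := hbfin.fintype
  have hcard : Fintype.card b = d := by
    have B := Module.Basis.mk hbi (by rw [Subtype.range_coe, hbs, hC])
    rw [← Module.finrank_eq_card_basis B, finrank_euclideanSpace_fin]
  have eq : Fin d ≃ b := (Fintype.equivFinOfCardEq hcard).symm
  set X := (Fintype.piFinset fun _ : Fin d => C).filter fun v => LinearIndependent ℝ v with hX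
  have hne : X.Nonempty := by
    refine ⟨fun j => (eq j : Pt d), ?_⟩
    rw [hX, Finset.mem_filter, Fintype.mem_piFinset]
    exact ⟨fun j => hbC (eq j).2, hbi.comp eq eq.injective⟩
  obtain ⟨v₀, hv₀, hmin⟩ := X.exists_min_image (fun v => ∑ j, ‖v j‖) hne
  rw [hX, Finset.mem_filter, Fintype.mem_piFinset] at hv₀
  obtain ⟨hv₀C, hv₀i⟩ := hv₀
  set σ := Tuple.sort fun j => ‖v₀ j‖
  set v := v₀ ∘ σ with hv
  have hvi : LinearIndependent ℝ v := hv₀i.comp σ σ.injective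
  have hsum : ∑ j, ‖v j‖ = ∑ j, ‖v₀ j‖ := Equiv.sum_comp σ fun j => ‖v₀ j‖
  refine ⟨v, fun j => hv₀C _, hvi, Tuple.monotone_sort fun j => ‖v₀ j‖, fun c hc => ?_⟩
  let B := basisOfLinearIndependentOfCardEqFinrank' v hvi (by simp)
  have hB : ∀ j, B j = v j := fun j => by simp [B]
  have hexp : c = ∑ j, B.repr c j • v j := by
    conv_lhs => rw [← B.sum_repr c]
    simp only [hB]
  rw [hexp]
  refine Submodule.sum_mem _ fun j _ => ?_
  by_cases h0 : B.repr c j = 0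
  · rw [h0, zero_smul]; exact Submodule.zero_mem _
  refine Submodule.smul_mem _ _ (Submodule.subset_span ⟨j, ?_, rfl⟩)
  rw [Set.mem_ofPred_eq, ← hexp]
  by_contra! hlt
  have hui : LinearIndependent ℝ (Function.update v j c) := by
    refine hvi.update j c ⟨1, one_mem _, B.repr c, mem_nonZeroDivisors_of_ne_zero h0, ?_⟩
    rw [one_smul, Finsupp.linearCombination_apply, Finsupp.sum_fintype _ _ (by simp)]
    exact hexp
  have hle := hmin (Function.update v j c) (by
    rw [hX, Finset.mem_filter, Fintype.mem_piFinset]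
    refine ⟨fun i => ?_, hui⟩
    by_cases hij : i = j
    · subst hij; simpa using hc
    · rw [Function.update_of_ne hij]; exact hv₀C _)
  rw [← hsum] at hle
  refine absurd hle (not_le.2 (Finset.sum_lt_sum (fun i _ => ?_) ⟨j, Finset.mem_univ _, ?_⟩))
  · by_cases hij : i = j
    · subst hij; simpa using hlt.le
    · rw [Function.update_of_ne hij]
  · simpa using hlt

open Module InnerProductSpace in
theorem norm_sq_le_of_mem_box {d : ℕ} {v : Fin d → Pt d}
    (hmono : Monotone fun j => ‖v j‖) {e : OrthonormalBasis (Fin d) ℝ (Pt d)}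
    (he : ∀ i j, i < j → inner ℝ (e j) (v i) = (0 : ℝ)) {u : Pt d} {c : ℝ} (hc : 0 ≤ c)
    (hu : u ∈ Submodule.span ℝ (v '' {j | ‖v j‖ ≤ ‖u‖})) {y : Pt d}
    (hy : ∀ j, |inner ℝ (e j) y| ≤ c * ‖v j‖) :
    |inner ℝ u y| ≤ d * c * ‖u‖ ^ 2 := by
  have hzero : ∀ j, ‖u‖ < ‖v j‖ → inner ℝ u (e j) = (0 : ℝ) := by
    intro j hj
    have : Submodule.span ℝ (v '' {j | ‖v j‖ ≤ ‖u‖}) ≤ (ℝ ∙ e j)ᗮ := by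
      rw [Submodule.span_le]
      rintro _ ⟨i, hi, rfl⟩
      rw [SetLike.mem_coe, Submodule.mem_orthogonal_singleton_iff_inner_right]
      refine he i j ?_
      by_contra! hji
      exact absurd (hmono hji) (not_le.2 (lt_of_le_of_lt hi hj))
    have h := this hu
    rwa [Submodule.mem_orthogonal_singleton_iff_inner_left] at h
  rw [← e.sum_inner_mul_inner u y]
  refine (Finset.abs_sum_le_sum_abs _ _).trans ?_
  have hterm : ∀ j ∈ Finset.univ, |inner ℝ u (e j) * inner ℝ (e j) y| ≤ c * ‖u‖ ^ 2 := by
    intro j _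
    rcases lt_or_ge ‖u‖ ‖v j‖ with h | h
    · rw [hzero j h, zero_mul, abs_zero]; positivity
    · rw [abs_mul]
      have h1 := abs_real_inner_le_norm u (e j)
      rw [e.norm_eq_one, mul_one] at h1
      calc |inner ℝ u (e j)| * |inner ℝ (e j) y| ≤ ‖u‖ * (c * ‖u‖) :=
            mul_le_mul h1 ((hy j).trans (by gcongr)) (abs_nonneg _) (norm_nonneg _)
        _ = c * ‖u‖ ^ 2 := by ring
  refine (Finset.sum_le_sum hterm).trans (le_of_eq ?_)
  simp [mul_assoc]

open MeasureTheory Metric Module InnerProductSpace in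
/-- Minkowski-type bound: for a finite set of diameter less than `L`, the boxes whose sides are the
successive minima (capped at `L`) at the points of the set are disjoint. -/
theorem exists_successive_minima {d : ℕ} (S : Finset (Pt d)) {L : ℝ} (hL : 0 < L)
    (hS : ∀ x ∈ S, ∀ y ∈ S, dist x y < L) :
    ∃ v : Pt d → Fin d → Pt d,
      (∀ p ∈ S, LinearIndependent ℝ (v p) ∧ Monotone (fun j => ‖v p j‖) ∧
        ∀ j, (v p j + p ∈ S ∧ v p j ≠ 0) ∨ ‖v p j‖ = L) ∧
      ∑ p ∈ S, ∏ j, ‖v p j‖ ≤ volume.real (ball (0 : Pt d) 1) * (2 * (d + 1) * (3 * L)) ^ d := by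
  let axes : Finset (Pt d) := Finset.univ.image fun i => EuclideanSpace.single i L
  let C : Pt d → Finset (Pt d) := fun p => (S.erase p).image (fun q => q - p) ∪ axes
  have hCspan : ∀ p, Submodule.span ℝ (C p : Set (Pt d)) = ⊤ := by
    intro p
    rw [eq_top_iff, ← (EuclideanSpace.basisFun (Fin d) ℝ).toBasis.span_eq, Submodule.span_le]
    rintro _ ⟨i, rfl⟩
    have hmem : EuclideanSpace.single i L ∈ Submodule.span ℝ (C p : Set (Pt d)) :=
      Submodule.subset_span (Finset.mem_coe.2 (Finset.mem_union_right _
        (Finset.mem_image_of_mem _ (Finset.mem_univ i))))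
    have := Submodule.smul_mem _ L⁻¹ hmem
    have hi : (EuclideanSpace.basisFun (Fin d) ℝ).toBasis i =
        L⁻¹ • EuclideanSpace.single i L := by
      ext j
      simp [hL.ne']
    rwa [hi]
  choose v hvC hvi hvm hvs using fun p => exists_minimal_basis (C p) (hCspan p)
  have hvcase : ∀ p j, (v p j + p ∈ S ∧ v p j ≠ 0) ∨ ‖v p j‖ = L := by
    intro p j
    rcases Finset.mem_union.1 (hvC p j) with h | h
    · obtain ⟨q, hq, hqe⟩ := Finset.mem_image.1 h
      rw [Finset.mem_erase] at hq
      left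
      rw [← hqe, sub_add_cancel]
      exact ⟨hq.2, sub_ne_zero.2 hq.1⟩
    · obtain ⟨i, -, hi⟩ := Finset.mem_image.1 h
      right
      rw [← hi]
      simp [abs_of_pos hL]
  refine ⟨v, fun p _ => ⟨hvi p, hvm p, hvcase p⟩, ?_⟩
  have hvL : ∀ p ∈ S, ∀ j, ‖v p j‖ ≤ L := by
    intro p hp j
    rcases hvcase p j with h | h
    · have := hS _ h.1 p hp
      rw [dist_eq_norm, add_sub_cancel_right] at this
      exact this.le
    · exact h.le
  let e : Pt d → OrthonormalBasis (Fin d) ℝ (Pt d) := fun p =>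
    gramSchmidtOrthonormalBasis (by simp) (v p)
  have he : ∀ p i j, i < j → inner ℝ (e p j) (v p i) = (0 : ℝ) := fun p i j hij =>
    gramSchmidtOrthonormalBasis_inv_triangular _ _ hij
  set c : ℝ := 1 / (4 * (d + 1)) with hc
  have hcpos : 0 < c := by positivity
  have hdc : d * c < 1 / 4 := by
    rw [hc, mul_one_div, div_lt_div_iff₀ (by positivity) (by norm_num)]; linarith
  let A : Pt d → Set (Pt d) := fun p => {x | ∀ j, |inner ℝ (e p j) (x - p)| ≤ c * ‖v p j‖}
  have hdisj : (S : Set (Pt d)).PairwiseDisjoint A := by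
    intro p hp q hq hpq
    rw [Function.onFun, Set.disjoint_left]
    intro x hxp hxq
    have h1 : |inner ℝ (q - p) (x - p)| ≤ d * c * ‖q - p‖ ^ 2 :=
      norm_sq_le_of_mem_box (hvm p) (he p) hcpos.le
        (hvs p _ (Finset.mem_union_left _ (Finset.mem_image.2
          ⟨q, Finset.mem_erase.2 ⟨hpq.symm, hq⟩, rfl⟩))) hxp
    have h2 : |inner ℝ (p - q) (x - q)| ≤ d * c * ‖p - q‖ ^ 2 :=
      norm_sq_le_of_mem_box (hvm q) (he q) hcpos.le
        (hvs q _ (Finset.mem_union_left _ (Finset.mem_image.2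
          ⟨p, Finset.mem_erase.2 ⟨hpq, hp⟩, rfl⟩))) hxq
    have h3 : inner ℝ (q - p) (x - p) + inner ℝ (p - q) (x - q) = ‖q - p‖ ^ 2 := by
      rw [← real_inner_self_eq_norm_sq, ← neg_sub q p, inner_neg_left, ← sub_eq_add_neg,
        ← inner_sub_right]
      congr 1; abel
    rw [norm_sub_rev p q] at h2
    have h4 : 0 < ‖q - p‖ ^ 2 := by
      have := norm_pos_iff.2 (sub_ne_zero.2 hpq.symm); positivity
    have h5 : d * c * ‖q - p‖ ^ 2 ≤ 1 / 4 * ‖q - p‖ ^ 2 := by gcongr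
    linarith [le_abs_self (inner ℝ (q - p) (x - p)), le_abs_self (inner ℝ (p - q) (x - q))]
  rcases S.eq_empty_or_nonempty with rfl | ⟨p₀, hp₀⟩
  · simp only [Finset.sum_empty]; positivity
  have hsub : ⋃ p ∈ S, A p ⊆ ball p₀ (3 * L) := by
    refine Set.iUnion₂_subset fun p hp x hx => ?_
    rw [mem_ball]
    have h1 : |inner ℝ (x - p) (x - p)| ≤ L * ‖x - p‖ := by
      rw [← (e p).sum_inner_mul_inner]
      refine (Finset.abs_sum_le_sum_abs _ _).trans ?_
      have hterm : ∀ j ∈ Finset.univ,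
          |inner ℝ (x - p) (e p j) * inner ℝ (e p j) (x - p)| ≤ c * L * ‖x - p‖ := by
        intro j _
        have h1 := abs_real_inner_le_norm (x - p) (e p j)
        rw [(e p).norm_eq_one, mul_one] at h1
        rw [abs_mul, mul_comm]
        exact mul_le_mul ((hx j).trans (by gcongr; exact hvL p hp j)) h1 (abs_nonneg _)
          (by positivity)
      refine (Finset.sum_le_sum hterm).trans ?_
      simp only [Finset.sum_const, Finset.card_univ, Fintype.card_fin, nsmul_eq_mul, ← mul_assoc]
      gcongr
      have : d * c * L ≤ 1 / 4 * L := by gcongr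
      linarith
    rw [real_inner_self_eq_norm_sq, abs_of_nonneg (by positivity)] at h1
    have h2 : ‖x - p‖ ≤ L := by
      by_contra! h
      nlinarith
    rw [← dist_eq_norm] at h2
    linarith [dist_triangle x p p₀, hS p hp p₀ hp₀]
  have h := measureReal_mono (μ := volume) hsub measure_ball_lt_top.ne
  rw [measureReal_biUnion_finset hdisj (fun p _ => measurableSet_orthonormal_box _ _ _)
    (fun p _ => volume_orthonormal_box_ne_top _ _ _),
    volume_real_ball_pos_radius p₀ (by positivity)] at h
  have h2 : ∀ p ∈ S, volume.real (A p) = (2 * c) ^ d * ∏ j, ‖v p j‖ := by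
    intro p _
    rw [volume_real_orthonormal_box _ _ fun j => by positivity]
    simp only [← mul_assoc, Finset.prod_mul_distrib, Finset.prod_const, Finset.card_univ,
      Fintype.card_fin]
    rw [← mul_pow]
  rw [Finset.sum_congr rfl h2, ← Finset.mul_sum] at h
  have hcc : (2 * (d + 1) * (3 * L)) ^ d * (2 * c) ^ d = (3 * L) ^ d := by
    rw [← mul_pow]; congr 1; rw [hc]; field_simp; norm_num
  rw [← mul_le_mul_iff_right₀ (show 0 < (2 * c) ^ d by positivity)]
  refine h.trans (le_of_eq ?_)
  rw [← hcc]
  ring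

open MeasureTheory Metric in
/-- The constant in the volume bound for successive minima in dimension `k + 1`. -/
def minimaConst (k : ℕ) : ℝ :=
  volume.real (ball (0 : Pt (k + 1)) 1) * (6 * (k + 2)) ^ (k + 1)

theorem minimaConst_pos (k : ℕ) : 0 < minimaConst k :=
  mul_pos (volume_real_unit_ball_pos _) (by positivity)

open Module in
/-- In a rich hyperplane, at least half of the points see an independent `k`-tuple of points of
the hyperplane with small product of distances. -/
theorem exists_good_points {k : ℕ} {Q : Finset (Pt (k + 1))} {D : ℝ} (hD1 : 1 ≤ D)
    (hQD : ∀ x ∈ Q, ∀ y ∈ Q, dist x y < D) (hsep : ∀ x ∈ Q, ∀ y ∈ Q, x ≠ y → 1 ≤ dist x y)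
    {H : AffineSubspace ℝ (Pt (k + 1))} (hH : finrank ℝ H.direction = k) {R : ℝ} (hR : 0 < R)
    (hRD : R ≤ D) (hrich : 2 * minimaConst k * D ^ k ≤ R * (Q.filter (· ∈ H)).card) :
    ∃ G ⊆ Q.filter (· ∈ H), (Q.filter (· ∈ H)).card ≤ 2 * G.card ∧
      ∀ p ∈ G, ∃ q : Fin k → Pt (k + 1), (∀ i, q i ∈ Q ∧ q i ∈ H ∧ q i ≠ p) ∧
        LinearIndependent ℝ (fun i => q i - p) ∧ ∏ i, dist p (q i) ≤ R := by
  have hD : 0 < D := by linarith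
  set S := Q.filter (· ∈ H) with hS
  have hSQ : ∀ {x}, x ∈ S → x ∈ Q := fun hx => (Finset.mem_filter.1 hx).1
  have hSH : ∀ {x}, x ∈ S → x ∈ H := fun hx => (Finset.mem_filter.1 hx).2
  obtain ⟨v, hv, hsum⟩ := exists_successive_minima S hD
    fun x hx y hy => hQD x (hSQ hx) y (hSQ hy)
  have hlast : ∀ p ∈ S, ‖v p (Fin.last k)‖ = D := by
    intro p hp
    obtain ⟨hi, hm, hc⟩ := hv p hp
    by_contra hne
    have hlt : ∀ j, v p j ∈ H.direction := by
      intro j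
      have hle : ‖v p j‖ < D := by
        refine lt_of_le_of_lt (hm (Fin.le_last j)) ?_
        rcases hc (Fin.last k) with h | h
        · have := hQD _ (hSQ h.1) p (hSQ hp)
          rwa [dist_eq_norm, add_sub_cancel_right] at this
        · exact absurd h hne
      rcases hc j with h | h
      · have := AffineSubspace.vsub_mem_direction (hSH h.1) (hSH hp)
        rwa [vsub_eq_sub, add_sub_cancel_right] at this
      · exact absurd h hle.ne
    have hspan : Submodule.span ℝ (Set.range (v p)) ≤ H.direction :=
      Submodule.span_le.2 (Set.range_subset_iff.2 hlt)
    have := Submodule.finrank_mono hspan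
    rw [finrank_span_eq_card hi, hH, Fintype.card_fin] at this
    omega
  have hone : ∀ p ∈ S, ∀ j : Fin k, 1 ≤ ‖v p j.castSucc‖ := by
    intro p hp j
    rcases (hv p hp).2.2 j.castSucc with h | h
    · have := hsep _ (hSQ h.1) p (hSQ hp) (by simpa using h.2)
      rwa [dist_eq_norm, add_sub_cancel_right] at this
    · rwa [h]
  refine ⟨S.filter fun p => ∏ i : Fin k, ‖v p i.castSucc‖ < R, Finset.filter_subset _ _, ?_, ?_⟩
  · have hbad : ((S.filter fun p => ¬ ∏ i : Fin k, ‖v p i.castSucc‖ < R).card : ℝ) * (R * D) ≤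
        minimaConst k * D ^ (k + 1) := by
      have h1 : ∑ p ∈ S, ∏ j, ‖v p j‖ ≤ minimaConst k * D ^ (k + 1) := by
        refine hsum.trans (le_of_eq ?_)
        rw [minimaConst, mul_assoc (MeasureTheory.volume.real _), ← mul_pow]
        push_cast
        congr 2
        ring
      refine le_trans ?_ h1
      rw [← nsmul_eq_mul]
      refine (Finset.card_nsmul_le_sum _ _ _ fun p hp => ?_).trans
        (Finset.sum_le_sum_of_subset_of_nonneg (Finset.filter_subset _ _)
          fun p _ _ => Finset.prod_nonneg fun j _ => norm_nonneg _)
      rw [Finset.mem_filter, not_lt] at hp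
      rw [Fin.prod_univ_castSucc, hlast p hp.1]
      exact mul_le_mul_of_nonneg_right hp.2 hD.le
    have hcard : ((S.filter fun p => ∏ i : Fin k, ‖v p i.castSucc‖ < R).card : ℝ) +
        (S.filter fun p => ¬ ∏ i : Fin k, ‖v p i.castSucc‖ < R).card = S.card := by
      exact_mod_cast Finset.card_filter_add_card_filter_not _
    have h2 : ((S.filter fun p => ¬ ∏ i : Fin k, ‖v p i.castSucc‖ < R).card : ℝ) * 2 ≤ S.card := by
      have h3 : ((S.filter fun p => ¬ ∏ i : Fin k, ‖v p i.castSucc‖ < R).card : ℝ) * 2 * (R * D) ≤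
          S.card * (R * D) := by
        calc _ = 2 * (((S.filter fun p => ¬ ∏ i : Fin k, ‖v p i.castSucc‖ < R).card : ℝ)
                * (R * D)) := by ring
          _ ≤ 2 * (minimaConst k * D ^ (k + 1)) := by gcongr
          _ = (2 * minimaConst k * D ^ k) * D := by ring
          _ ≤ (R * S.card) * D := by gcongr
          _ = _ := by ring
      exact le_of_mul_le_mul_right h3 (by positivity)
    have h4 : (S.card : ℝ) ≤
        2 * (S.filter fun p => ∏ i : Fin k, ‖v p i.castSucc‖ < R).card := by linarith
    exact_mod_cast h4
  · intro p hp
    rw [Finset.mem_filter] at hp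
    obtain ⟨hpS, hpR⟩ := hp
    obtain ⟨hi, hm, hc⟩ := hv p hpS
    have hmem : ∀ i : Fin k, v p i.castSucc + p ∈ S ∧ v p i.castSucc ≠ 0 := by
      intro i
      rcases hc i.castSucc with h | h
      · exact h
      · exfalso
        have h1 : ‖v p i.castSucc‖ ≤ ∏ i : Fin k, ‖v p i.castSucc‖ := by
          rw [← Finset.mul_prod_erase _ _ (Finset.mem_univ i)]
          refine le_mul_of_one_le_right (norm_nonneg _) ?_
          rw [← Finset.prod_const_one (s := Finset.univ.erase i)]
          exact Finset.prod_le_prod (fun _ _ => zero_le_one) fun j _ => hone p hpS j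
        linarith
    refine ⟨fun i => v p i.castSucc + p, fun i => ⟨hSQ (hmem i).1, hSH (hmem i).1, ?_⟩, ?_, ?_⟩
    · simpa using (hmem i).2
    · simp only [add_sub_cancel_right]
      exact hi.comp _ (Fin.castSucc_injective k)
    · simp only [dist_comm p, dist_eq_norm, add_sub_cancel_right]
      exact hpR.le

open Module in
theorem affineSubspace_eq_of_independent {k : ℕ} {H H' : AffineSubspace ℝ (Pt (k + 1))}
    (hH : finrank ℝ H.direction = k) (hH' : finrank ℝ H'.direction = k) {p : Pt (k + 1)}
    {q : Fin k → Pt (k + 1)} (hq : LinearIndependent ℝ fun i => q i - p) (hp : p ∈ H)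
    (hp' : p ∈ H') (hqH : ∀ i, q i ∈ H) (hqH' : ∀ i, q i ∈ H') : H = H' := by
  have key : ∀ {K : AffineSubspace ℝ (Pt (k + 1))}, finrank ℝ K.direction = k → p ∈ K →
      (∀ i, q i ∈ K) → Submodule.span ℝ (Set.range fun i => q i - p) = K.direction := by
    intro K hK hpK hqK
    refine Submodule.eq_of_le_of_finrank_eq (Submodule.span_le.2 ?_) ?_
    · rintro _ ⟨i, rfl⟩
      exact AffineSubspace.vsub_mem_direction (hqK i) hpK
    · rw [finrank_span_eq_card hq, hK, Fintype.card_fin]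
  exact AffineSubspace.ext_of_direction_eq ((key hH hp hqH).symm.trans (key hH' hp' hqH'))
    ⟨p, hp, hp'⟩

/-- Dyadic summation: `∑ |p - q|^{-d}` over a separated set is logarithmic in the diameter. -/
theorem sum_inv_dist_pow_le {d : ℕ} {Q : Finset (Pt d)} {D : ℝ} (hD : 1 ≤ D)
    (hQD : ∀ x ∈ Q, ∀ y ∈ Q, dist x y < D) (hsep : ∀ x ∈ Q, ∀ y ∈ Q, x ≠ y → 1 ≤ dist x y)
    {p : Pt d} (hp : p ∈ Q) :
    ∑ q ∈ Q.erase p, (dist p q ^ d)⁻¹ ≤ 6 ^ d * (1 + 2 * Real.log D) := by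
  set g : Pt d → ℕ := fun q => Nat.log 2 ⌊dist p q⌋₊ with hg
  have hmem : ∀ q ∈ Q.erase p, 1 ≤ dist p q ∧ dist p q < D := fun q hq =>
    ⟨hsep p hp q (Finset.mem_of_mem_erase hq) (Finset.ne_of_mem_erase hq).symm,
      hQD p hp q (Finset.mem_of_mem_erase hq)⟩
  have hgl : ∀ q ∈ Q.erase p, (2 : ℝ) ^ g q ≤ dist p q := by
    intro q hq
    have h1 : ⌊dist p q⌋₊ ≠ 0 := (Nat.floor_pos.2 (hmem q hq).1).ne'
    have h2 := Nat.pow_log_le_self 2 h1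
    exact le_trans (by exact_mod_cast h2) (Nat.floor_le dist_nonneg)
  have hgu : ∀ q, dist p q ≤ (2 : ℝ) ^ (g q + 1) := by
    intro q
    have h2 := Nat.lt_pow_succ_log_self (b := 2) one_lt_two ⌊dist p q⌋₊
    refine (Nat.lt_floor_add_one _).le.trans ?_
    exact_mod_cast h2
  set n := Nat.log 2 ⌊D⌋₊ + 1 with hn
  have hmaps : ∀ q ∈ Q.erase p, g q ∈ Finset.range n := by
    intro q hq
    rw [Finset.mem_range, hn, Nat.lt_succ_iff]
    exact Nat.log_mono_right (Nat.floor_le_floor (hmem q hq).2.le)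
  rw [← Finset.sum_fiberwise_of_maps_to hmaps]
  have hfib : ∀ j ∈ Finset.range n,
      ∑ q ∈ (Q.erase p).filter (fun q => g q = j), (dist p q ^ d)⁻¹ ≤ (6 : ℝ) ^ d := by
    intro j _
    have hc : (((Q.erase p).filter (fun q => g q = j)).card : ℝ) ≤
        (2 * 2 ^ (j + 1) / 1 + 1) ^ d := by
      refine card_le_of_subset_closedBall one_pos (fun x hx y hy => hsep x ?_ y ?_)
        (p := p) (by positivity) fun z hz => ?_
      · exact Finset.mem_of_mem_erase (Finset.mem_filter.1 hx).1
      · exact Finset.mem_of_mem_erase (Finset.mem_filter.1 hy).1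
      · rw [dist_comm, ← (Finset.mem_filter.1 hz).2]
        exact hgu z
    have hterm : ∀ q ∈ (Q.erase p).filter (fun q => g q = j),
        (dist p q ^ d)⁻¹ ≤ (((2 : ℝ) ^ j) ^ d)⁻¹ := by
      intro q hq
      have := hgl q (Finset.mem_filter.1 hq).1
      rw [(Finset.mem_filter.1 hq).2] at this
      gcongr
    refine (Finset.sum_le_card_nsmul _ _ _ hterm).trans ?_
    rw [nsmul_eq_mul, ← div_eq_mul_inv, div_le_iff₀ (by positivity), ← mul_pow]
    refine hc.trans (pow_le_pow_left₀ (by positivity) ?_ d)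
    have : (1 : ℝ) ≤ 2 ^ j := one_le_pow₀ one_le_two
    rw [pow_succ]; linarith
  refine (Finset.sum_le_sum hfib).trans ?_
  rw [Finset.sum_const, Finset.card_range, nsmul_eq_mul, mul_comm]
  gcongr
  have h1 : (Nat.log 2 ⌊D⌋₊ : ℝ) * Real.log 2 ≤ Real.log D := by
    rw [← Real.log_pow]
    refine Real.log_le_log (by positivity) ?_
    have h2 := Nat.pow_log_le_self 2 (Nat.floor_pos.2 hD).ne'
    exact le_trans (by exact_mod_cast h2) (Nat.floor_le (by linarith))
  have h2 := Real.log_two_gt_d9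
  have h3 : (0 : ℝ) ≤ Nat.log 2 ⌊D⌋₊ := Nat.cast_nonneg _
  rw [hn]
  push_cast
  nlinarith

/-- Number of tuples of other points with bounded product of distances to `p`. -/
theorem card_tuples_le {d k : ℕ} {Q : Finset (Pt d)} {D : ℝ} (hD : 1 ≤ D)
    (hQD : ∀ x ∈ Q, ∀ y ∈ Q, dist x y < D) (hsep : ∀ x ∈ Q, ∀ y ∈ Q, x ≠ y → 1 ≤ dist x y)
    {p : Pt d} (hp : p ∈ Q) {R : ℝ} (hR : 0 ≤ R) :
    (((Fintype.piFinset fun _ : Fin k => Q.erase p).filter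
      fun q => ∏ i, dist p (q i) ≤ R).card : ℝ) ≤ R ^ d * (6 ^ d * (1 + 2 * Real.log D)) ^ k := by
  have h1 : ∀ q ∈ (Fintype.piFinset fun _ : Fin k => Q.erase p).filter
      (fun q => ∏ i, dist p (q i) ≤ R), 1 ≤ R ^ d * ∏ i, (dist p (q i) ^ d)⁻¹ := by
    intro q hq
    rw [Finset.mem_filter, Fintype.mem_piFinset] at hq
    have hpos : 0 < ∏ i, dist p (q i) :=
      Finset.prod_pos fun i _ => dist_pos.2 (Finset.ne_of_mem_erase (hq.1 i)).symm
    rw [Finset.prod_inv_distrib, Finset.prod_pow, ← div_eq_mul_inv, ← div_pow]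
    exact one_le_pow₀ ((one_le_div hpos).2 hq.2)
  have h2 := Finset.card_nsmul_le_sum _ _ _ h1
  rw [nsmul_eq_mul, mul_one, ← Finset.mul_sum] at h2
  refine h2.trans ?_
  gcongr
  refine (Finset.sum_le_sum_of_subset_of_nonneg (Finset.filter_subset _ _)
    fun q _ _ => by positivity).trans ?_
  rw [Finset.sum_prod_piFinset (Q.erase p) fun _ q => (dist p q ^ d)⁻¹, Finset.prod_const,
    Finset.card_univ, Fintype.card_fin]
  gcongr
  exact sum_inv_dist_pow_le hD hQD hsep hp

open Module in
/-- Incidence bound for rich hyperplanes in a separated point set. -/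
theorem sum_card_rich_hyperplanes_le {k : ℕ} {Q : Finset (Pt (k + 1))} {D : ℝ} (hD : 1 ≤ D)
    (hQD : ∀ x ∈ Q, ∀ y ∈ Q, dist x y < D) (hsep : ∀ x ∈ Q, ∀ y ∈ Q, x ≠ y → 1 ≤ dist x y)
    {R : ℝ} (hR : 0 < R) (hRD : R ≤ D) (𝓗 : Finset (AffineSubspace ℝ (Pt (k + 1))))
    (hdim : ∀ H ∈ 𝓗, finrank ℝ H.direction = k)
    (hrich : ∀ H ∈ 𝓗, 2 * minimaConst k * D ^ k ≤ R * (Q.filter (· ∈ H)).card) :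
    ∑ H ∈ 𝓗, ((Q.filter (· ∈ H)).card : ℝ) ≤
      2 * (Q.card * (R ^ (k + 1) * (6 ^ (k + 1) * (1 + 2 * Real.log D)) ^ k)) := by
  have hgood : ∀ H, ∃ G ⊆ Q.filter (· ∈ H), H ∈ 𝓗 → (Q.filter (· ∈ H)).card ≤ 2 * G.card ∧
      ∀ p ∈ G, ∃ q : Fin k → Pt (k + 1), (∀ i, q i ∈ Q ∧ q i ∈ H ∧ q i ≠ p) ∧
        LinearIndependent ℝ (fun i => q i - p) ∧ ∏ i, dist p (q i) ≤ R := by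
    intro H
    by_cases hH : H ∈ 𝓗
    · obtain ⟨G, hG, hG'⟩ := exists_good_points hD hQD hsep (hdim H hH) hR hRD (hrich H hH)
      exact ⟨G, hG, fun _ => hG'⟩
    · exact ⟨∅, Finset.empty_subset _, fun h => absurd h hH⟩
  choose G hGQ hG using hgood
  have h1 : ∑ H ∈ 𝓗, ((Q.filter (· ∈ H)).card : ℝ) ≤ 2 * ∑ H ∈ 𝓗, ((G H).card : ℝ) := by
    rw [Finset.mul_sum]
    exact Finset.sum_le_sum fun H hH => by exact_mod_cast (hG H hH).1
  refine h1.trans ?_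
  gcongr
  have hswap : ∑ H ∈ 𝓗, (G H).card = ∑ p ∈ Q, (𝓗.filter fun H => p ∈ G H).card := by
    have := Finset.sum_card_bipartiteAbove_eq_sum_card_bipartiteBelow (s := 𝓗) (t := Q)
      fun H p => p ∈ G H
    rw [← Finset.sum_congr rfl fun p _ => rfl] at this
    refine Eq.trans (Finset.sum_congr rfl fun H _ => ?_) this
    congr 1
    ext p
    simp only [Finset.bipartiteAbove, Finset.mem_filter]
    exact ⟨fun h => ⟨(Finset.mem_filter.1 (hGQ H h)).1, h⟩, fun h => h.2⟩
  have hswap' : ∑ H ∈ 𝓗, ((G H).card : ℝ) = ∑ p ∈ Q, ((𝓗.filter fun H => p ∈ G H).card : ℝ) := by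
    exact_mod_cast hswap
  rw [hswap', ← nsmul_eq_mul]
  refine Finset.sum_le_card_nsmul _ _ _ fun p hp => ?_
  refine le_trans ?_ (card_tuples_le (k := k) hD hQD hsep hp hR.le)
  rw [Nat.cast_le]
  have hq : ∀ H, ∃ q : Fin k → Pt (k + 1), H ∈ 𝓗 → p ∈ G H →
      (∀ i, q i ∈ Q ∧ q i ∈ H ∧ q i ≠ p) ∧
        LinearIndependent ℝ (fun i => q i - p) ∧ ∏ i, dist p (q i) ≤ R := by
    intro H
    by_cases h : H ∈ 𝓗 ∧ p ∈ G H
    · obtain ⟨q, hq⟩ := (hG H h.1).2 p h.2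
      exact ⟨q, fun _ _ => hq⟩
    · exact ⟨fun _ => 0, fun h1 h2 => absurd ⟨h1, h2⟩ h⟩
  choose q hq using hq
  refine Finset.card_le_card_of_injOn q (fun H hH => ?_) fun H hH H' hH' heq => ?_
  · rw [Finset.mem_coe, Finset.mem_filter] at hH ⊢
    obtain ⟨h1, h2, h3⟩ := hq H hH.1 hH.2
    refine ⟨Fintype.mem_piFinset.2 fun i => Finset.mem_erase.2 ⟨(h1 i).2.2, (h1 i).1⟩, h3⟩
  · rw [Finset.mem_coe, Finset.mem_filter] at hH hH'
    obtain ⟨h1, h2, h3⟩ := hq H hH.1 hH.2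
    obtain ⟨h1', h2', h3'⟩ := hq H' hH'.1 hH'.2
    exact affineSubspace_eq_of_independent (hdim H hH.1) (hdim H' hH'.1) h2
      (Finset.mem_filter.1 (hGQ H hH.2)).2 (Finset.mem_filter.1 (hGQ H' hH'.2)).2
      (fun i => (h1 i).2.1) (fun i => heq ▸ (h1' i).2.1)

theorem card_le_card_image_add_card_collisions {α β : Type*} [DecidableEq β] (Q : Finset α)
    (f : α → β) : Q.card ≤ (Q.image f).card +
      ((Q ×ˢ Q).filter fun x => x.1 ≠ x.2 ∧ f x.1 = f x.2).card := by
  rcases Q.eq_empty_or_nonempty with rfl | ⟨x₀, -⟩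
  · simp
  have hg : ∀ y, ∃ x, y ∈ Q.image f → x ∈ Q ∧ f x = y := by
    intro y
    by_cases hy : y ∈ Q.image f
    · obtain ⟨x, hx⟩ := Finset.mem_image.1 hy
      exact ⟨x, fun _ => hx⟩
    · exact ⟨x₀, fun h => absurd h hy⟩
  choose g hg using hg
  have hsub : Q ⊆ (Q.image f).image g ∪
      ((Q ×ˢ Q).filter fun x => x.1 ≠ x.2 ∧ f x.1 = f x.2).image Prod.fst := by
    intro x hx
    have h := hg (f x) (Finset.mem_image_of_mem f hx)
    rw [Finset.mem_union]
    by_cases hxg : x = g (f x)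
    · exact Or.inl (Finset.mem_image.2 ⟨f x, Finset.mem_image_of_mem f hx, hxg.symm⟩)
    · exact Or.inr (Finset.mem_image.2 ⟨(x, g (f x)), Finset.mem_filter.2
        ⟨Finset.mem_product.2 ⟨hx, h.1⟩, hxg, h.2.symm⟩, rfl⟩)
  exact (Finset.card_le_card hsub).trans ((Finset.card_union_le _ _).trans
    (add_le_add Finset.card_image_le Finset.card_image_le))

open AffineSubspace in
theorem eq_of_perpBisector_eq {d : ℕ} {q a b : Pt d} (h : perpBisector q a = perpBisector q b) :
    a = b := by
  have h1 : midpoint ℝ q b ∈ perpBisector q a := h ▸ midpoint_mem_perpBisector q b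
  have h2 : midpoint ℝ q a ∈ perpBisector q b := h ▸ midpoint_mem_perpBisector q a
  rw [mem_perpBisector_iff_inner_eq_zero, midpoint_eq_smul_add, midpoint_eq_smul_add,
    vsub_eq_sub, vsub_eq_sub, ← smul_sub, inner_smul_left, add_sub_add_left_eq_sub] at h1 h2
  have h1' : inner ℝ (b - a) (a - q) = (0 : ℝ) := by simpa using h1
  have h2' : inner ℝ (a - b) (b - q) = (0 : ℝ) := by simpa using h2
  rw [← neg_sub b a, inner_neg_left, neg_eq_zero] at h2'
  have h3 : inner ℝ (b - a) (b - a) = (0 : ℝ) := by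
    calc inner ℝ (b - a) (b - a) = inner ℝ (b - a) ((b - q) - (a - q)) := by congr 1; abel
      _ = 0 := by rw [inner_sub_right, h1', h2', sub_zero]
  exact (sub_eq_zero.1 (inner_self_eq_zero.1 h3)).symm

open AffineSubspace MeasureTheory Metric Module in
/-- Few pairs of close points have a given bisector. -/
theorem card_pairs_with_bisector_le {k : ℕ} {Q : Finset (Pt (k + 1))} {D w : ℝ} (hD : 1 ≤ D)
    (hw : 1 ≤ w)
    (hQD : ∀ x ∈ Q, ∀ y ∈ Q, dist x y < D) (hsep : ∀ x ∈ Q, ∀ y ∈ Q, x ≠ y → 1 ≤ dist x y)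
    {X : Finset (Pt (k + 1) × Pt (k + 1))} (hX : ∀ x ∈ X, x.1 ∈ Q ∧ x.2 ∈ Q ∧ x.1 ≠ x.2 ∧
      dist x.1 x.2 < 2 * w) {H : AffineSubspace ℝ (Pt (k + 1))}
    (hXH : ∀ x ∈ X, perpBisector x.1 x.2 = H) :
    (X.card : ℝ) * volume.real (ball (0 : Pt (k + 1)) 1) ≤ 8 * 12 ^ k * (w * D ^ k) := by
  rcases X.eq_empty_or_nonempty with rfl | ⟨⟨q₀, q₁⟩, hq⟩
  · simp only [Finset.card_empty, Nat.cast_zero, zero_mul]; positivity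
  have hinj : Set.InjOn Prod.fst (X : Set (Pt (k + 1) × Pt (k + 1))) := by
    rintro ⟨a, b⟩ h ⟨a', b'⟩ h' heq
    obtain rfl : a = a' := heq
    have hbb : b = b' := eq_of_perpBisector_eq ((hXH _ h).trans (hXH _ h').symm)
    rw [hbb]
  rw [← Finset.card_image_of_injOn hinj]
  obtain ⟨hq₀, hq₁, hne, hdist⟩ := hX _ hq
  have hne' : ‖q₁ - q₀‖ ≠ 0 := norm_ne_zero_iff.2 (sub_ne_zero.2 hne.symm)
  have hmem : ∀ z ∈ X.image Prod.fst, ∃ z', (z, z') ∈ X := by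
    intro z hz
    obtain ⟨⟨z₁, z'⟩, h, rfl⟩ := Finset.mem_image.1 hz
    exact ⟨z', h⟩
  refine card_le_of_slab (p := midpoint ℝ q₀ q₁) (u := ‖q₁ - q₀‖⁻¹ • (q₁ - q₀)) hw hD
    (fun x hx y hy => ?_) ?_ (fun z hz => ?_) fun z hz => ?_
  · obtain ⟨x', hx'⟩ := hmem x hx
    obtain ⟨y', hy'⟩ := hmem y hy
    exact hsep x (hX _ hx').1 y (hX _ hy').1
  · rw [norm_smul, norm_inv, norm_norm, inv_mul_cancel₀ hne']
  · obtain ⟨z', hz'⟩ := hmem z hz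
    have h1 := hQD z (hX _ hz').1 q₀ hq₀
    have h2 : dist q₀ (midpoint ℝ q₀ q₁) = 2⁻¹ * dist q₀ q₁ := by
      rw [dist_left_midpoint]; simp
    have h3 := hQD q₀ hq₀ q₁ hq₁
    linarith [dist_triangle z q₀ (midpoint ℝ q₀ q₁)]
  · obtain ⟨z', hz'⟩ := hmem z hz
    have h1 : midpoint ℝ z z' ∈ perpBisector q₀ q₁ := by
      rw [hXH _ hq, ← hXH _ hz']
      exact midpoint_mem_perpBisector z z'
    rw [mem_perpBisector_iff_inner_eq_zero', vsub_eq_sub, vsub_eq_sub] at h1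
    have h2 : z - midpoint ℝ q₀ q₁ =
        (z - midpoint ℝ z z') + (midpoint ℝ z z' - midpoint ℝ q₀ q₁) := by abel
    rw [h2, inner_add_right, inner_smul_left, inner_smul_left, h1, mul_zero, add_zero,
      ← inner_smul_left]
    refine (abs_real_inner_le_norm _ _).trans ?_
    have h3 : ‖z - midpoint ℝ z z'‖ = 2⁻¹ * dist z z' := by
      rw [← dist_eq_norm, dist_left_midpoint]; simp
    have h4 := (hX _ hz').2.2.2
    simp only at h4
    rw [h3, norm_smul]
    simp only [norm_inv, norm_norm]
    rw [inv_mul_cancel₀ hne', one_mul]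
    linarith

open AffineSubspace in
theorem finrank_direction_perpBisector {k : ℕ} {a b : Pt (k + 1)} (h : a ≠ b) :
    Module.finrank ℝ (perpBisector a b).direction = k := by
  have : Fact (Module.finrank ℝ (Pt (k + 1)) = k + 1) := ⟨by simp⟩
  rw [direction_perpBisector]
  exact Submodule.finrank_orthogonal_span_singleton (sub_ne_zero.2 h.symm)

/-- If few distances from `p` occur, then many pairs of close points are equidistant from `p`. -/
theorem card_le_card_image_dist_add_collisions {k : ℕ} {Q : Finset (Pt (k + 1))} {D w : ℝ}
    (hw : 0 < w) (hwD : w ≤ D) {p : Pt (k + 1)} (hQD : ∀ x ∈ Q, dist p x ≤ D) :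
    (Q.card : ℝ) ≤ (Q.image (dist p)).card * (8 * (k + 1) * 6 ^ k * (D / w) ^ k) +
      ((Q ×ˢ Q).filter fun x => (x.1 ≠ x.2 ∧ dist x.1 x.2 < 2 * w) ∧
        dist p x.1 = dist p x.2).card := by
  obtain ⟨Z, hZQ, hZsep, hZ⟩ := exists_maximal_separated Q w hw
  choose! z hzZ hz using hZ
  have h1 := card_le_card_image_add_card_collisions Q fun q => (dist p q, z q)
  have h2 : ((Q.image fun q => (dist p q, z q)).card : ℝ) ≤
      (Q.image (dist p)).card * (8 * (k + 1) * 6 ^ k * (D / w) ^ k) := by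
    have hsub : (Q.image fun q => (dist p q, z q)) ⊆
        (Q.image (dist p)).biUnion fun r =>
          (Z.filter fun y => |dist y p - r| ≤ w).image fun y => (r, y) := by
      intro x hx
      obtain ⟨q, hq, rfl⟩ := Finset.mem_image.1 hx
      refine Finset.mem_biUnion.2 ⟨dist p q, Finset.mem_image_of_mem _ hq,
        Finset.mem_image.2 ⟨z q, Finset.mem_filter.2 ⟨hzZ q hq, ?_⟩, rfl⟩⟩
      have h := abs_dist_sub_le (z q) q p
      rw [dist_comm q p, dist_comm (z q) q] at h
      exact h.trans (hz q hq).le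
    have h := (Finset.card_le_card hsub).trans Finset.card_biUnion_le
    have h' : ((Q.image fun q => (dist p q, z q)).card : ℝ) ≤
      ∑ r ∈ Q.image (dist p), (8 * (k + 1) * 6 ^ k * (D / w) ^ k) := by
      refine (Nat.cast_le.2 h).trans ?_
      push_cast
      refine Finset.sum_le_sum fun r hr => ?_
      obtain ⟨q, hq, rfl⟩ := Finset.mem_image.1 hr
      refine (Nat.cast_le.2 Finset.card_image_le).trans ?_
      refine card_le_of_near_sphere (p := p) (r := dist p q) hw hwD dist_nonneg (hQD q hq)
        (fun x hx y hy => hZsep x (Finset.mem_filter.1 hx).1 y (Finset.mem_filter.1 hy).1)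
        fun y hy => (Finset.mem_filter.1 hy).2
    rwa [Finset.sum_const, nsmul_eq_mul] at h'
  have h3 : ((Q ×ˢ Q).filter fun x => x.1 ≠ x.2 ∧
      (dist p x.1, z x.1) = (dist p x.2, z x.2)).card ≤
      ((Q ×ˢ Q).filter fun x => (x.1 ≠ x.2 ∧ dist x.1 x.2 < 2 * w) ∧
        dist p x.1 = dist p x.2).card := by
    refine Finset.card_le_card fun x hx => ?_
    rw [Finset.mem_filter, Finset.mem_product] at hx ⊢
    obtain ⟨⟨hx1, hx2⟩, hne, he⟩ := hx
    obtain ⟨he1, he2⟩ := Prod.mk.inj he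
    refine ⟨⟨hx1, hx2⟩, ⟨hne, ?_⟩, he1⟩
    have ha := hz x.1 hx1
    have hb := hz x.2 hx2
    rw [← he2, dist_comm] at hb
    linarith [dist_triangle x.1 (z x.1) x.2]
  have h1' : (Q.card : ℝ) ≤ ((Q.image fun q => (dist p q, z q)).card : ℝ) +
      ((Q ×ˢ Q).filter fun x => x.1 ≠ x.2 ∧
      (dist p x.1, z x.1) = (dist p x.2, z x.2)).card := by exact_mod_cast h1
  have h3' := (Nat.cast_le (α := ℝ)).2 h3
  linarith

open AffineSubspace in
/-- Double counting of the incidences between points and bisectors of close pairs. -/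
theorem sum_collisions_eq {d : ℕ} (Q : Finset (Pt d)) (w : ℝ) :
    ∑ p ∈ Q, ((Q ×ˢ Q).filter fun x => (x.1 ≠ x.2 ∧ dist x.1 x.2 < 2 * w) ∧
        dist p x.1 = dist p x.2).card =
      ∑ x ∈ (Q ×ˢ Q).filter (fun x => x.1 ≠ x.2 ∧ dist x.1 x.2 < 2 * w),
        (Q.filter (· ∈ perpBisector x.1 x.2)).card := by
  simp_rw [← Finset.filter_filter, mem_perpBisector_iff_dist_eq, Finset.card_filter]
  exact Finset.sum_comm

/-- The number of ordered close pairs. -/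
theorem card_close_pairs_le {d : ℕ} {Q : Finset (Pt d)} {w : ℝ} (hw : 1 ≤ w)
    (hsep : ∀ x ∈ Q, ∀ y ∈ Q, x ≠ y → 1 ≤ dist x y) :
    (((Q ×ˢ Q).filter fun x => x.1 ≠ x.2 ∧ dist x.1 x.2 < 2 * w).card : ℝ) ≤
      Q.card * (5 * w) ^ d := by
  have hsub : ((Q ×ˢ Q).filter fun x => x.1 ≠ x.2 ∧ dist x.1 x.2 < 2 * w) ⊆
      Q.biUnion fun p => (Q.filter fun y => dist y p ≤ 2 * w).image fun y => (p, y) := by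
    rintro ⟨x, y⟩ hx
    rw [Finset.mem_filter, Finset.mem_product] at hx
    refine Finset.mem_biUnion.2 ⟨x, hx.1.1, Finset.mem_image.2 ⟨y, Finset.mem_filter.2
      ⟨hx.1.2, ?_⟩, rfl⟩⟩
    rw [dist_comm]
    exact hx.2.2.le
  have h := (Finset.card_le_card hsub).trans Finset.card_biUnion_le
  refine (Nat.cast_le.2 h).trans ?_
  push_cast
  rw [← nsmul_eq_mul, ← Finset.sum_const]
  refine Finset.sum_le_sum fun p hp => ?_
  refine (Nat.cast_le.2 Finset.card_image_le).trans ?_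
  refine (card_le_of_subset_closedBall (p := p) (r := 2 * w) one_pos
    (fun x hx y hy => hsep x (Finset.mem_filter.1 hx).1 y (Finset.mem_filter.1 hy).1)
    (by linarith) fun y hy => (Finset.mem_filter.1 hy).2).trans ?_
  gcongr
  linarith

/-- Splitting a sum of fibre weights into light and heavy fibres. -/
theorem sum_weight_le {α β : Type*} [DecidableEq β] (X : Finset α) (f : α → β) (m : β → ℝ)
    (hm : ∀ H, 0 ≤ m H) {m₀ M : ℝ} (hm₀ : 0 ≤ m₀)
    (hM : ∀ H, ((X.filter fun x => f x = H).card : ℝ) ≤ M) :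
    ∑ x ∈ X, m (f x) ≤ X.card * m₀ + M * ∑ H ∈ (X.image f).filter (m₀ ≤ m ·), m H := by
  rw [← Finset.sum_filter_add_sum_filter_not X fun x => m (f x) < m₀]
  have hlight : ∑ x ∈ X.filter (fun x => m (f x) < m₀), m (f x) ≤ X.card * m₀ := by
    refine (Finset.sum_le_sum fun x hx => (Finset.mem_filter.1 hx).2.le).trans ?_
    rw [Finset.sum_const, nsmul_eq_mul]
    exact mul_le_mul_of_nonneg_right (Nat.cast_le.2 (Finset.card_filter_le _ _)) hm₀
  refine add_le_add hlight ?_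
  rw [Finset.mul_sum, ← Finset.sum_fiberwise_of_maps_to (g := f)
    (t := (X.image f).filter (m₀ ≤ m ·)) fun x hx => ?_]
  · refine Finset.sum_le_sum fun H hH => ?_
    rw [Finset.sum_congr rfl (g := fun _ => m H) fun x hx => by rw [(Finset.mem_filter.1 hx).2],
      Finset.sum_const, nsmul_eq_mul]
    refine mul_le_mul_of_nonneg_right ((Nat.cast_le.2 (Finset.card_le_card ?_)).trans (hM H)) (hm H)
    exact Finset.filter_subset_filter _ (Finset.filter_subset _ _)
  · rw [Finset.mem_filter, not_lt] at hx
    exact Finset.mem_filter.2 ⟨Finset.mem_image_of_mem f hx.1, hx.2⟩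

open AffineSubspace MeasureTheory Metric Module in
/-- If few distances occur from every point, then the point set is small. -/
theorem exists_card_pow_le_of_few_distances (k : ℕ) : ∃ C : ℝ, 0 < C ∧
    ∀ (Q : Finset (Pt (k + 1))) (D w : ℝ), Q.Nonempty → 1 ≤ w → w ≤ D →
      (∀ x ∈ Q, ∀ y ∈ Q, dist x y < D) → (∀ x ∈ Q, ∀ y ∈ Q, x ≠ y → 1 ≤ dist x y) →
      C * (D ^ k * w ^ (k + 1)) ≤ D * Q.card →
      (∀ p ∈ Q, ((Q.image (dist p)).card : ℝ) * (8 * (k + 1) * 6 ^ k * (D / w) ^ k) ≤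
        Q.card / 2) →
      (Q.card : ℝ) ^ (k + 2) ≤
        C * (w ^ ((k + 1) ^ 2 + 1) * D ^ (k * (k + 2)) * (1 + 2 * Real.log D) ^ k) := by
  have hω := volume_real_unit_ball_pos (k + 1)
  have hμ := minimaConst_pos k
  set ω := volume.real (ball (0 : Pt (k + 1)) 1)
  set μ := minimaConst k
  set A : ℝ := 8 * μ * 5 ^ (k + 1) with hA
  set B : ℝ := 8 * 12 ^ k / ω with hB
  have hA0 : 0 < A := by positivity
  have hB0 : 0 < B := by positivity
  set C' : ℝ := 8 * B * A ^ (k + 1) * 6 ^ ((k + 1) * k) with hC'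
  have hC'0 : 0 < C' := by positivity
  refine ⟨A + C', by positivity, fun Q D w hQ hw hwD hQD hsep hcond hfew => ?_⟩
  have hw0 : 0 < w := by linarith
  have hD1 : 1 ≤ D := hw.trans hwD
  have hD0 : 0 < D := by linarith
  have hlog : 0 ≤ Real.log D := Real.log_nonneg hD1
  have hn : 0 < (Q.card : ℝ) := Nat.cast_pos.2 hQ.card_pos
  set n : ℝ := (Q.card : ℝ) with hn_def
  set L : ℝ := 1 + 2 * Real.log D with hL
  have hL0 : 0 < L := by positivity
  set X := (Q ×ˢ Q).filter fun x => x.1 ≠ x.2 ∧ dist x.1 x.2 < 2 * w with hX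
  set f : Pt (k + 1) × Pt (k + 1) → AffineSubspace ℝ (Pt (k + 1)) :=
    fun x => perpBisector x.1 x.2 with hf
  set m : AffineSubspace ℝ (Pt (k + 1)) → ℝ := fun H => (Q.filter (· ∈ H)).card with hm
  set m₀ : ℝ := n / (4 * (5 * w) ^ (k + 1)) with hm₀
  have hm₀0 : 0 < m₀ := by positivity
  have hXmem : ∀ x ∈ X, x.1 ∈ Q ∧ x.2 ∈ Q ∧ x.1 ≠ x.2 ∧ dist x.1 x.2 < 2 * w := by
    intro x hx
    rw [hX, Finset.mem_filter, Finset.mem_product] at hx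
    exact ⟨hx.1.1, hx.1.2, hx.2⟩
  have hlower : n * (n / 2) ≤ ∑ x ∈ X, m (f x) := by
    have h1 : ∑ x ∈ X, m (f x) = ∑ p ∈ Q, (((Q ×ˢ Q).filter fun x =>
        (x.1 ≠ x.2 ∧ dist x.1 x.2 < 2 * w) ∧ dist p x.1 = dist p x.2).card : ℝ) := by
      have h := congrArg (Nat.cast (R := ℝ)) (sum_collisions_eq Q w)
      push_cast at h
      exact h.symm
    rw [h1, hn_def, ← nsmul_eq_mul, ← Finset.sum_const]
    refine Finset.sum_le_sum fun p hp => ?_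
    have h2 := card_le_card_image_dist_add_collisions hw0 hwD (p := p)
      fun x hx => (hQD p hp x hx).le
    linarith [hfew p hp]
  have hmult : ∀ H, ((X.filter fun x => f x = H).card : ℝ) ≤ B * (w * D ^ k) := by
    intro H
    have h := card_pairs_with_bisector_le hD1 hw hQD hsep (X := X.filter fun x => f x = H)
      (fun x hx => hXmem x (Finset.mem_filter.1 hx).1) (H := H)
      fun x hx => (Finset.mem_filter.1 hx).2
    rw [hB, div_mul_eq_mul_div, le_div_iff₀ hω]
    exact h
  have hsplit := sum_weight_le X f m (fun H => Nat.cast_nonneg _) hm₀0.le hmult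
  have hXcard : (X.card : ℝ) ≤ n * (5 * w) ^ (k + 1) := card_close_pairs_le hw hsep
  set R : ℝ := A * (D ^ k * w ^ (k + 1)) / n with hR
  have hR0 : 0 < R := by positivity
  have hRD : R ≤ D := by
    rw [hR, div_le_iff₀ hn]
    refine le_trans ?_ hcond
    gcongr
    linarith
  have hrich := sum_card_rich_hyperplanes_le hD1 hQD hsep hR0 hRD
    ((X.image f).filter (m₀ ≤ m ·)) (fun H hH => by
      obtain ⟨x, hx, rfl⟩ := Finset.mem_image.1 (Finset.mem_filter.1 hH).1
      exact finrank_direction_perpBisector (hXmem x hx).2.2.1)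
    (fun H hH => by
      have h := (Finset.mem_filter.1 hH).2
      refine le_trans (le_of_eq ?_) (mul_le_mul_of_nonneg_left h hR0.le)
      rw [hR, hm₀, hA, mul_pow]
      field_simp
      ring)
  have hpoor : (X.card : ℝ) * m₀ ≤ n * (n / 4) := by
    refine (mul_le_mul_of_nonneg_right hXcard hm₀0.le).trans (le_of_eq ?_)
    rw [hm₀]
    field_simp
  have hmain : n * (n / 4) ≤
      B * (w * D ^ k) * (2 * (n * (R ^ (k + 1) * (6 ^ (k + 1) * L) ^ k))) := by
    have := mul_le_mul_of_nonneg_left hrich (by positivity : 0 ≤ B * (w * D ^ k))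
    linarith
  have hmain2 : n ≤ 8 * B * (w * D ^ k) * (R ^ (k + 1) * (6 ^ (k + 1) * L) ^ k) := by
    refine le_of_mul_le_mul_left ?_ hn
    linarith
  have hRn : R ^ (k + 1) * n ^ (k + 1) = (A * (D ^ k * w ^ (k + 1))) ^ (k + 1) := by
    rw [← mul_pow, hR, div_mul_cancel₀ _ hn.ne']
  calc n ^ (k + 2) = n * n ^ (k + 1) := by ring
    _ ≤ 8 * B * (w * D ^ k) * (R ^ (k + 1) * (6 ^ (k + 1) * L) ^ k) * n ^ (k + 1) := by gcongr
    _ = 8 * B * (w * D ^ k) * (6 ^ (k + 1) * L) ^ k * (R ^ (k + 1) * n ^ (k + 1)) := by ring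
    _ = C' * (w ^ ((k + 1) ^ 2 + 1) * D ^ (k * (k + 2)) * L ^ k) := by
      rw [hRn, hC']
      simp only [mul_pow, ← pow_mul]
      ring
    _ ≤ _ := by
      gcongr
      linarith

/-- A maximal separated subset of a well-separated set contains a positive proportion of it. -/
theorem card_le_of_dense_subset {d : ℕ} {b : ℝ} {P Q : Finset (Pt d)} (hP : WellSeparated b P)
    (hQ : ∀ p ∈ P, ∃ q ∈ Q, dist p q < 1) : (P.card : ℝ) ≤ 2 ^ d * b * Q.card := by
  set a : Pt d → (Fin d → Bool) → Fin d → ℝ := fun q ε i => if ε i then q i else q i - 1 with ha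
  have hsub : P ⊆ Q.biUnion fun q => Finset.univ.biUnion fun ε : Fin d → Bool =>
      P.filter (· ∈ closedCube (a q ε) 1) := by
    intro p hp
    obtain ⟨q, hq, hpq⟩ := hQ p hp
    refine Finset.mem_biUnion.2 ⟨q, hq, Finset.mem_biUnion.2 ⟨fun i => decide (q i ≤ p i),
      Finset.mem_univ _, Finset.mem_filter.2 ⟨hp, fun i => ?_⟩⟩⟩
    have h : |p i - q i| < 1 := by
      refine lt_of_le_of_lt ?_ hpq
      rw [dist_eq_norm, ← Real.norm_eq_abs]
      exact PiLp.norm_apply_le (p - q) i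
    obtain ⟨h1, h2⟩ := abs_lt.1 h
    by_cases hi : q i ≤ p i
    · simp only [ha, decide_eq_true hi, if_true]
      exact ⟨hi, by linarith⟩
    · simp only [ha, decide_eq_false hi, Bool.false_eq_true, if_false]
      exact ⟨by linarith, by linarith⟩
  have h1 : P.card ≤ ∑ q ∈ Q, ∑ ε : Fin d → Bool, (P.filter (· ∈ closedCube (a q ε) 1)).card :=
    (Finset.card_le_card hsub).trans (Finset.card_biUnion_le.trans
      (Finset.sum_le_sum fun q _ => Finset.card_biUnion_le))
  have h2 : ∀ c : Fin d → ℝ, ((P.filter (· ∈ closedCube c 1)).card : ℝ) ≤ b := by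
    intro c
    refine le_trans (le_of_eq ?_) (hP c)
    rw [← Set.ncard_coe_finset, Finset.coe_filter]
    rfl
  calc (P.card : ℝ)
      ≤ ∑ q ∈ Q, ∑ ε : Fin d → Bool, ((P.filter (· ∈ closedCube (a q ε) 1)).card : ℝ) := by
        exact_mod_cast h1
    _ ≤ ∑ q ∈ Q, ∑ ε : Fin d → Bool, b :=
        Finset.sum_le_sum fun q _ => Finset.sum_le_sum fun ε _ => h2 _
    _ = 2 ^ d * b * Q.card := by
        simp only [Finset.sum_const, Finset.card_univ, Fintype.card_fun, Fintype.card_bool,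
          Fintype.card_fin, nsmul_eq_mul]
        push_cast
        ring

theorem dist_lt_of_mem_openCube {k : ℕ} {a : Fin (k + 1) → ℝ} {ℓ : ℝ} (hℓ : 0 < ℓ)
    {x y : Pt (k + 1)} (hx : x ∈ openCube a ℓ) (hy : y ∈ openCube a ℓ) :
    dist x y < (k + 1) * ℓ := by
  rw [EuclideanSpace.dist_eq, Real.sqrt_lt' (by positivity)]
  have h : ∀ i ∈ Finset.univ, dist (x i) (y i) ^ 2 < ℓ ^ 2 := by
    intro i _
    have h1 : dist (x i) (y i) < ℓ := by
      rw [Real.dist_eq, abs_lt]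
      constructor <;> linarith [(hx i).1, (hx i).2, (hy i).1, (hy i).2]
    gcongr
  refine (Finset.sum_lt_sum_of_nonempty Finset.univ_nonempty h).trans_le ?_
  rw [Finset.sum_const, Finset.card_univ, Fintype.card_fin, nsmul_eq_mul, mul_pow]
  push_cast
  gcongr
  nlinarith [(Nat.cast_nonneg k : (0 : ℝ) ≤ k)]

theorem distinctDists_eq_card_image {d : ℕ} (P : Finset (Pt d)) (p : Pt d) :
    distinctDists P p = ((P.erase p).image (dist p)).card := by
  rw [distinctDists, ← Set.ncard_coe_finset]
  congr 1
  ext r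
  simp only [Set.mem_ofPred_eq, Finset.coe_image, Finset.coe_erase, Set.mem_image, Set.mem_sdiff,
    Finset.mem_coe, Set.mem_singleton_iff]
  exact ⟨fun ⟨q, h1, h2, h3⟩ => ⟨q, ⟨h1, h2⟩, h3⟩, fun ⟨q, ⟨h1, h2⟩, h3⟩ => ⟨q, h1, h2, h3⟩⟩

theorem card_image_dist_le {d : ℕ} {P Q : Finset (Pt d)} (hQP : Q ⊆ P) (hP : 2 ≤ P.card)
    (p : Pt d) : (Q.image (dist p)).card ≤ 2 * distinctDists P p := by
  have hpos : 0 < distinctDists P p := by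
    rw [distinctDists_eq_card_image, Finset.card_pos, Finset.image_nonempty, ← Finset.card_pos]
    have := Finset.pred_card_le_card_erase (s := P) (a := p)
    omega
  have hsub : Q.image (dist p) ⊆ insert 0 ((P.erase p).image (dist p)) := by
    intro r hr
    obtain ⟨q, hq, rfl⟩ := Finset.mem_image.1 hr
    by_cases h : q = p
    · rw [h, dist_self]; exact Finset.mem_insert_self _ _
    · exact Finset.mem_insert_of_mem (Finset.mem_image_of_mem _ (Finset.mem_erase.2 ⟨h, hQP hq⟩))
  have h := (Finset.card_le_card hsub).trans (Finset.card_insert_le _ _)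
  rw [← distinctDists_eq_card_image] at h
  omega

/-- The scale at which the point set is coarsened. -/
theorem exists_scale (k : ℕ) {n L K : ℝ} (hn : 1 ≤ n) (hL : 1 ≤ L) (hK : 1 ≤ K) :
    ∃ s : ℝ, 1 ≤ s ∧ s ^ ((k + 1) ^ 2 + 1) = K ^ ((k + 1) ^ 2 + 1) * n ^ k * L ^ (k + 2) ∧
      n ^ (2 * ((k : ℝ) + 1) / (((k : ℝ) + 1) ^ 2 + 1)) *
        L ^ ((1 - ((k : ℝ) + 1) ^ 2) / (((k : ℝ) + 1) ^ 2 + 1)) * s ^ k = K ^ k * n ∧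
      K * (n ^ (1 / ((k : ℝ) + 1))) ^ k ≤ n ^ (1 / ((k : ℝ) + 1)) * s ^ (k + 1) := by
  have hn0 : 0 < n := by linarith
  have hL0 : 0 < L := by linarith
  have hk : (0 : ℝ) ≤ k := Nat.cast_nonneg k
  set e : ℝ := ((k : ℝ) + 1) ^ 2 + 1 with he
  have he0 : 0 < e := by positivity
  have he' : (((k + 1) ^ 2 + 1 : ℕ) : ℝ) = e := by push_cast; rfl
  have hn1 : 1 ≤ n ^ ((k : ℝ) / e) := Real.one_le_rpow hn (by positivity)
  have hL1 : 1 ≤ L ^ (((k : ℝ) + 2) / e) := Real.one_le_rpow hL (by positivity)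
  refine ⟨K * n ^ ((k : ℝ) / e) * L ^ (((k : ℝ) + 2) / e), ?_, ?_, ?_, ?_⟩
  · exact one_le_mul_of_one_le_of_one_le (one_le_mul_of_one_le_of_one_le hK hn1) hL1
  · rw [mul_pow, mul_pow, ← Real.rpow_mul_natCast hn0.le, ← Real.rpow_mul_natCast hL0.le, he',
      div_mul_cancel₀ _ he0.ne', div_mul_cancel₀ _ he0.ne', Real.rpow_natCast]
    norm_cast
  · rw [mul_pow, mul_pow, ← Real.rpow_mul_natCast hn0.le, ← Real.rpow_mul_natCast hL0.le]
    have h1 : n ^ (2 * ((k : ℝ) + 1) / e) * n ^ ((k : ℝ) / e * k) = n := by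
      rw [← Real.rpow_add hn0]
      have : 2 * ((k : ℝ) + 1) / e + (k : ℝ) / e * k = 1 := by
        rw [he]; field_simp; ring
      rw [this, Real.rpow_one]
    have h2 : L ^ ((1 - ((k : ℝ) + 1) ^ 2) / e) * L ^ (((k : ℝ) + 2) / e * k) = 1 := by
      rw [← Real.rpow_add hL0]
      have : (1 - ((k : ℝ) + 1) ^ 2) / e + ((k : ℝ) + 2) / e * k = 0 := by
        rw [he]; field_simp; ring
      rw [this, Real.rpow_zero]
    linear_combination (K ^ k * (L ^ ((1 - ((k : ℝ) + 1) ^ 2) / e) *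
      L ^ (((k : ℝ) + 2) / e * k))) * h1 + K ^ k * n * h2
  · have h1 : K * n ^ ((k : ℝ) / e * (k + 1 : ℕ)) ≤
        (K * n ^ ((k : ℝ) / e) * L ^ (((k : ℝ) + 2) / e)) ^ (k + 1) := by
      rw [mul_pow, mul_pow, ← Real.rpow_mul_natCast hn0.le]
      have hK1 : K ≤ K ^ (k + 1) := le_self_pow₀ hK (by omega)
      calc _ ≤ K ^ (k + 1) * n ^ ((k : ℝ) / e * (k + 1 : ℕ)) := by gcongr
        _ ≤ _ := le_mul_of_one_le_right (by positivity) (one_le_pow₀ hL1)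
    refine le_trans ?_ (mul_le_mul_of_nonneg_left h1 (by positivity))
    rw [← Real.rpow_mul_natCast hn0.le, mul_left_comm, ← Real.rpow_add hn0]
    refine mul_le_mul_of_nonneg_left (Real.rpow_le_rpow_of_exponent_le hn ?_) (by linarith)
    push_cast
    rw [he]
    rw [div_mul_eq_mul_div, div_mul_eq_mul_div, div_add_div _ _ (by positivity) (by positivity),
      div_le_div_iff₀ (by positivity) (by positivity)]
    have h2 : 0 ≤ (k : ℝ) ^ 2 + k + 2 := by positivity
    have h3 : (k : ℝ) * (((k : ℝ) + 1) ^ 2 + 1) ≤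
        (((k : ℝ) + 1) ^ 2 + 1) + ((k : ℝ) + 1) * (k * (k + 1)) := by nlinarith
    have h4 := mul_le_mul_of_nonneg_left h3 (by positivity : 0 ≤ (k : ℝ) + 1)
    nlinarith

theorem scale_bound_lt {k : ℕ} {C δ a K E n N L s : ℝ} (ha : 0 < a) (hK : 1 ≤ K)
    (hn : 0 < n) (hL : 1 ≤ L) (hs : 0 < s) (hN : N ^ (k + 1) = n)
    (hse : s ^ ((k + 1) ^ 2 + 1) = K ^ ((k + 1) ^ 2 + 1) * n ^ k * L ^ (k + 2))
    (hKb : C * δ ^ (k * (k + 2)) * E ^ k < a ^ (k + 2) * K) :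
    C * ((N / s) ^ ((k + 1) ^ 2 + 1) * (δ * N) ^ (k * (k + 2)) * (E * L) ^ k) <
      (a * n) ^ (k + 2) := by
  have hL0 : 0 < L := by linarith
  refine lt_of_mul_lt_mul_right ?_ (by positivity : 0 ≤ s ^ ((k + 1) ^ 2 + 1))
  calc C * ((N / s) ^ ((k + 1) ^ 2 + 1) * (δ * N) ^ (k * (k + 2)) * (E * L) ^ k) *
        s ^ ((k + 1) ^ 2 + 1)
      = C * ((N / s * s) ^ ((k + 1) ^ 2 + 1) * (δ * N) ^ (k * (k + 2)) * (E * L) ^ k) := by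
        rw [mul_pow (N / s) s]
        ring
    _ = C * δ ^ (k * (k + 2)) * E ^ k * ((N ^ (k + 1)) ^ (2 * (k + 1)) * L ^ k) := by
        rw [div_mul_cancel₀ _ hs.ne', mul_pow, mul_pow, ← pow_mul]
        ring
    _ = C * δ ^ (k * (k + 2)) * E ^ k * (n ^ (2 * (k + 1)) * L ^ k) := by rw [hN]
    _ < a ^ (k + 2) * K * (n ^ (2 * (k + 1)) * L ^ k) :=
        mul_lt_mul_of_pos_right hKb (by positivity)
    _ ≤ a ^ (k + 2) * K ^ ((k + 1) ^ 2 + 1) * (n ^ (2 * (k + 1)) * L ^ (k + 2)) := by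
        have h1 : K ≤ K ^ ((k + 1) ^ 2 + 1) := le_self_pow₀ hK (by omega)
        have h2 : L ^ k ≤ L ^ (k + 2) := pow_le_pow_right₀ hL (by omega)
        gcongr
    _ = (a * n) ^ (k + 2) * s ^ ((k + 1) ^ 2 + 1) := by
        rw [hse, mul_pow]
        ring

theorem scale_condition {k : ℕ} {C δ a K n N s : ℝ} (ha : 0 < a) (hδ : 1 ≤ δ) (hN0 : 0 < N)
    (hn : 0 < n) (hs : 0 < s) (hN : N ^ (k + 1) = n) (hsN : K * N ^ k ≤ N * s ^ (k + 1))
    (hKa : C * δ ^ k ≤ a * K) :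
    C * ((δ * N) ^ k * (N / s) ^ (k + 1)) ≤ δ * N * (a * n) := by
  rw [div_pow, hN, mul_pow, ← mul_assoc, ← mul_div_assoc, div_le_iff₀ (by positivity)]
  calc C * (δ ^ k * N ^ k) * n = C * δ ^ k * N ^ k * n := by ring
    _ ≤ a * K * N ^ k * n := by gcongr
    _ = a * (K * N ^ k) * n := by ring
    _ ≤ a * (N * s ^ (k + 1)) * n := by gcongr
    _ ≤ δ * (a * (N * s ^ (k + 1)) * n) := le_mul_of_one_le_left (by positivity) hδ
    _ = δ * N * (a * n) * s ^ (k + 1) := by ring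

/-- Every `b`-homogeneous set of `n ≥ 3` points in `ℝ^d` has a point from which
there are at least `c · n^(2d/(d²+1)) · (log n)^((1−d²)/(d²+1))` distinct distances. -/
theorem distinct_distances_homogeneous (d : ℕ) (hd : 2 ≤ d) (b : ℝ) (hb : 0 < b) :
    ∃ c : ℝ, 0 < c ∧
      ∀ P : Finset (Pt d), IsHomogeneous b P → 3 ≤ P.card →
        ∃ p ∈ P,
          c * (P.card : ℝ) ^ (2 * (d : ℝ) / ((d : ℝ) ^ 2 + 1)) *
              Real.log (P.card : ℝ) ^ ((1 - (d : ℝ) ^ 2) / ((d : ℝ) ^ 2 + 1)) ≤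
            (distinctDists P p : ℝ) := by
  obtain ⟨k, rfl⟩ : ∃ k, d = k + 1 := ⟨d - 1, by omega⟩
  obtain ⟨C, hC, hcore⟩ := exists_card_pow_le_of_few_distances k
  have hk : (0 : ℝ) ≤ k := Nat.cast_nonneg k
  set δ : ℝ := (k : ℝ) + 1 with hδ
  have hδ1 : 1 ≤ δ := by linarith
  set a : ℝ := 1 / (2 ^ (k + 1) * b) with ha
  have ha0 : 0 < a := by positivity
  set E : ℝ := 3 + 2 * δ with hE
  set K : ℝ := 1 + C * δ ^ k / a + C * δ ^ (k * (k + 2)) * E ^ k / a ^ (k + 2) with hK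
  have hK1 : 1 ≤ K := by
    rw [hK, add_assoc]
    exact le_add_of_nonneg_right (by positivity)
  have hK0 : 0 < K := by linarith
  have hKa : C * δ ^ k ≤ a * K := by
    rw [← div_le_iff₀' ha0, hK]
    have : 0 ≤ C * δ ^ (k * (k + 2)) * E ^ k / a ^ (k + 2) := by positivity
    linarith
  have hKb : C * δ ^ (k * (k + 2)) * E ^ k < a ^ (k + 2) * K := by
    rw [← div_lt_iff₀' (by positivity), hK]
    have : 0 ≤ C * δ ^ k / a := by positivity
    linarith
  set S : ℝ := 8 * δ * 6 ^ k with hS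
  have hS0 : 0 < S := by positivity
  refine ⟨a / (4 * S * (2 * δ) ^ k * K ^ k), by positivity, fun P hP hcard => ?_⟩
  obtain ⟨⟨corner, hcube⟩, hsepP⟩ := hP
  push_cast at hcube ⊢
  rw [← hδ] at hcube ⊢
  set n : ℝ := (P.card : ℝ) with hn
  have hn3 : 3 ≤ n := by
    rw [hn]
    exact_mod_cast hcard
  have hn0 : 0 < n := by linarith
  have hL1 : 1 ≤ Real.log n := by
    rw [Real.le_log_iff_exp_le hn0]
    exact Real.exp_one_lt_three.le.trans hn3
  obtain ⟨s, hs1, hse, hsT, hsN⟩ := exists_scale k (by linarith : 1 ≤ n) hL1 hK1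
  rw [← hδ] at hsT hsN
  set N : ℝ := n ^ (1 / δ) with hN
  have hN1 : 1 ≤ N := Real.one_le_rpow (by linarith) (by positivity)
  have hNn : N ^ (k + 1) = n := by
    rw [hN, ← Real.rpow_mul_natCast hn0.le]
    push_cast
    rw [← hδ, one_div_mul_cancel (by linarith), Real.rpow_one]
  set X : ℝ := n ^ (2 * δ / (δ ^ 2 + 1)) * Real.log n ^ ((1 - δ ^ 2) / (δ ^ 2 + 1)) with hX
  set D : ℝ := δ * N with hD
  have hND : N ≤ D := le_mul_of_one_le_left (by linarith) hδ1
  have hD1 : 1 ≤ D := hN1.trans hND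
  obtain ⟨Q, hQP, hQsep, hQ⟩ := exists_maximal_separated P 1 one_pos
  have hQD : ∀ x ∈ Q, ∀ y ∈ Q, dist x y < D := fun x hx y hy =>
    dist_lt_of_mem_openCube (by linarith) (hcube (hQP hx)) (hcube (hQP hy))
  have haQ : a * n ≤ Q.card := by
    rw [ha, one_div_mul_eq_div, div_le_iff₀' (by positivity)]
    exact card_le_of_dense_subset hsepP hQ
  have hQ0 : 0 < (Q.card : ℝ) := lt_of_lt_of_le (by positivity) haQ
  by_contra! hcon
  have hfew : ∀ p ∈ Q, ((Q.image (dist p)).card : ℝ) * (S * (2 * δ * s) ^ k) ≤ Q.card / 2 := by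
    intro p hp
    have h1 : ((Q.image (dist p)).card : ℝ) ≤ 2 * distinctDists P p := by
      exact_mod_cast card_image_dist_le hQP (by omega) p
    have h2 := hcon p (hQP hp)
    rw [mul_assoc, ← hX] at h2
    calc ((Q.image (dist p)).card : ℝ) * (S * (2 * δ * s) ^ k)
        ≤ (2 * (a / (4 * S * (2 * δ) ^ k * K ^ k) * X)) * (S * (2 * δ * s) ^ k) := by
          gcongr
          linarith
      _ = a / (2 * K ^ k) * (X * s ^ k) := by
          rw [mul_pow (2 * δ) s]
          field_simp
          ring
      _ = a * n / 2 := by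
          rw [hsT]
          field_simp
      _ ≤ _ := by linarith
  set w : ℝ := N / s with hw
  have hs0 : 0 < s := by linarith
  have hw0 : 0 < w := by positivity
  have hDw : D / w = δ * s := by
    rw [hD, hw]
    field_simp
  have hw1 : 1 ≤ w := by
    by_contra! hlt
    obtain ⟨p, hp⟩ : Q.Nonempty := Finset.card_pos.1 (Nat.cast_pos.1 hQ0)
    have h1 := card_le_card_image_dist_add_collisions (w := w / 2) (by positivity)
      (by linarith) fun x hx => (hQD p hp x hx).le
    rw [Finset.filter_eq_empty_iff.2, Finset.card_empty, Nat.cast_zero, add_zero] at h1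
    · have h2 : D / (w / 2) = 2 * δ * s := by
        rw [div_div_eq_mul_div, mul_div_right_comm, hDw]
        ring
      rw [h2] at h1
      linarith [hfew p hp]
    · rintro x hx ⟨⟨hne, hlt'⟩, -⟩
      obtain ⟨hx1, hx2⟩ := Finset.mem_product.1 hx
      linarith [hQsep _ hx1 _ hx2 hne]
  have hwD : w ≤ D := (div_le_self (by linarith) hs1).trans hND
  have hmain := hcore Q D w (Finset.card_pos.1 (Nat.cast_pos.1 hQ0)) hw1 hwD hQD hQsep ?_ ?_
  · have hlog : 1 + 2 * Real.log D ≤ E * Real.log n := by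
      have h1 : Real.log D ≤ δ + Real.log n := by
        rw [hD, Real.log_mul (by positivity) (by positivity)]
        refine add_le_add (Real.log_le_self (by linarith)) (Real.log_le_log (by linarith) ?_)
        rw [← hNn]
        exact le_self_pow₀ hN1 (by omega)
      have h2 : δ ≤ δ * Real.log n := le_mul_of_one_le_right (by linarith) hL1
      rw [hE]
      linarith
    have hlog0 : 0 ≤ Real.log D := Real.log_nonneg hD1
    have h1 : (a * n) ^ (k + 2) ≤ C * (w ^ ((k + 1) ^ 2 + 1) * D ^ (k * (k + 2)) *
        (E * Real.log n) ^ k) := by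
      calc (a * n) ^ (k + 2) ≤ (Q.card : ℝ) ^ (k + 2) := by gcongr
        _ ≤ _ := hmain
        _ ≤ _ := by gcongr
    exact absurd h1 (not_le.2 (scale_bound_lt ha0 hK1 hn0 hL1
      hs0 hNn hse hKb))
  · refine le_trans ?_ (mul_le_mul_of_nonneg_left haQ (by linarith))
    exact scale_condition ha0 hδ1 (by linarith) hn0 hs0 hNn hsN hKa
  · intro p hp
    refine le_trans ?_ (hfew p hp)
    rw [hDw]
    gcongr
    linarith
end
end

section
/- For every constant b > 0 there exists a constant c > 0 (depending only on b) such that the following holds: for every b-homogeneous set P of n ≥ 2 points in ℝ³ there is a point p ∈ P such that the number of distinct distances from p to the other points of P is at least c · n^{53/87}. -/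
open scoped Classical

noncomputable section

section HomogeneousDistances

open Finset AffineSubspace

/-- All coordinate differences of points of `S` are at most `ℓ`. -/
def CoordSpread (S : Finset (Pt 3)) (ℓ : ℝ) : Prop :=
  ∀ x ∈ S, ∀ y ∈ S, ∀ i, x i - y i ≤ ℓ

/-- The index of the cell of the grid `σ ℤ³` containing a point. -/
def cellIdx (σ : ℝ) (x : Pt 3) : Fin 3 → ℤ := fun i => ⌊x i / σ⌋

lemma CoordSpread.mono {S T : Finset (Pt 3)} {ℓ : ℝ} (h : CoordSpread T ℓ) (hST : S ⊆ T) :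
    CoordSpread S ℓ := fun x hx y hy i => h x (hST hx) y (hST hy) i

lemma sub_lt_of_floor_div_eq {σ u v : ℝ} (hσ : 0 < σ) (h : ⌊u / σ⌋ = ⌊v / σ⌋) : u - v < σ := by
  have h1 := Int.lt_floor_add_one (u / σ)
  have h2 := Int.floor_le (v / σ)
  rw [h] at h1
  have h3 : u / σ - v / σ < 1 := by linarith
  rw [← sub_div, div_lt_one hσ] at h3
  exact h3

lemma sub_lt_of_cellIdx_eq {σ : ℝ} (hσ : 0 < σ) {x y : Pt 3} (h : cellIdx σ x = cellIdx σ y)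
    (i : Fin 3) : x i - y i < σ :=
  sub_lt_of_floor_div_eq hσ (congrFun h i)

lemma coordSpread_of_cellIdx_eq {σ : ℝ} (hσ : 0 < σ) {S : Finset (Pt 3)} {c : Fin 3 → ℤ}
    (h : ∀ x ∈ S, cellIdx σ x = c) : CoordSpread S σ := fun x hx y hy i =>
  (sub_lt_of_cellIdx_eq hσ ((h x hx).trans (h y hy).symm) i).le

lemma card_le_card_image_mul {α β : Type*} [DecidableEq β] (S : Finset α) (f : α → β) (B : ℝ)
    (h : ∀ x ∈ S, (#{y ∈ S | f y = f x} : ℝ) ≤ B) : (#S : ℝ) ≤ #(S.image f) * B := by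
  rw [card_eq_sum_card_image f S]
  push_cast
  rw [← nsmul_eq_mul]
  apply Finset.sum_le_card_nsmul
  intro y hy
  obtain ⟨x, hx, rfl⟩ := mem_image.1 hy
  exact h x hx

lemma card_image_floor_le {α : Type*} (S : Finset α) (f : α → ℝ) {σ ℓ : ℝ} (hσ : 0 < σ)
    (hℓ : 0 ≤ ℓ) (h : ∀ x ∈ S, ∀ y ∈ S, f x - f y ≤ ℓ) :
    (#(S.image fun x => ⌊f x / σ⌋) : ℝ) ≤ ℓ / σ + 2 := by
  rcases S.eq_empty_or_nonempty with rfl | hne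
  · simp; positivity
  obtain ⟨y, hy, hmin⟩ := S.exists_min_image f hne
  have hsub : (S.image fun x => ⌊f x / σ⌋) ⊆ Icc ⌊f y / σ⌋ (⌊f y / σ⌋ + ⌊ℓ / σ⌋ + 1) := by
    intro z hz
    obtain ⟨x, hx, rfl⟩ := mem_image.1 hz
    rw [mem_Icc]
    refine ⟨Int.floor_mono (div_le_div_of_nonneg_right (hmin x hx) hσ.le), ?_⟩
    have h1 : f x / σ ≤ f y / σ + ℓ / σ := by
      rw [← add_div]
      exact div_le_div_of_nonneg_right (by linarith [h x hx y hy]) hσ.le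
    have h2 := Int.lt_floor_add_one (f y / σ)
    have h3 := Int.lt_floor_add_one (ℓ / σ)
    have h4 := Int.floor_le (f x / σ)
    have : (⌊f x / σ⌋ : ℝ) < ((⌊f y / σ⌋ + ⌊ℓ / σ⌋ + 2 : ℤ) : ℝ) := by push_cast; linarith
    have := Int.cast_lt.1 this
    omega
  have h0 : 0 ≤ ⌊ℓ / σ⌋ := Int.floor_nonneg.2 (by positivity)
  have hc := card_le_card hsub
  rw [Int.card_Icc] at hc
  have h5 : ((⌊f y / σ⌋ + ⌊ℓ / σ⌋ + 1 + 1 - ⌊f y / σ⌋).toNat : ℤ) = ⌊ℓ / σ⌋ + 2 := by omega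
  have h6 : ((#(S.image fun x => ⌊f x / σ⌋) : ℤ)) ≤ ⌊ℓ / σ⌋ + 2 := by omega
  have h7 : (#(S.image fun x => ⌊f x / σ⌋) : ℝ) ≤ ((⌊ℓ / σ⌋ + 2 : ℤ) : ℝ) := by
    exact_mod_cast h6
  push_cast at h7
  linarith [Int.floor_le (ℓ / σ)]

variable {b : ℝ} {P : Finset (Pt 3)}

lemma WellSeparated.card_le (h : WellSeparated b P) {S : Finset (Pt 3)} (hS : S ⊆ P)
    (hsp : CoordSpread S 1) : (#S : ℝ) ≤ b := by
  rcases S.eq_empty_or_nonempty with rfl | hne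
  · simpa using (Nat.cast_nonneg _).trans (h 0)
  choose y hy hmin using fun i : Fin 3 => S.exists_min_image (fun x : Pt 3 => x i) hne
  refine le_trans ?_ (h fun i => y i i)
  rw [← Set.ncard_coe_finset]
  refine Nat.cast_le.2 (Set.ncard_le_ncard (fun x hx => ?_) (P.finite_toSet.inter_of_left _))
  refine ⟨hS hx, fun i => ⟨hmin i x hx, ?_⟩⟩
  linarith [hsp x hx (y i) (hy i) i]

lemma card_image_cellIdx_le {S : Finset (Pt 3)} {σ ℓ : ℝ} (hσ : 0 < σ) (hℓ : 0 ≤ ℓ)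
    (hsp : CoordSpread S ℓ) : (#(S.image (cellIdx σ)) : ℝ) ≤ (ℓ / σ + 2) ^ 3 := by
  have hsub : S.image (cellIdx σ) ⊆
      Fintype.piFinset fun i => S.image fun x : Pt 3 => ⌊x i / σ⌋ := by
    intro z hz
    obtain ⟨x, hx, rfl⟩ := mem_image.1 hz
    exact Fintype.mem_piFinset.2 fun i => mem_image_of_mem _ hx
  have hc := card_le_card hsub
  rw [Fintype.card_piFinset] at hc
  calc (#(S.image (cellIdx σ)) : ℝ)
      ≤ ∏ i : Fin 3, (#(S.image fun x : Pt 3 => ⌊x i / σ⌋) : ℝ) := by exact_mod_cast hc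
    _ ≤ ∏ i : Fin 3, (ℓ / σ + 2) := by
        refine prod_le_prod (fun _ _ => by positivity) fun i _ => ?_
        exact card_image_floor_le S (fun x : Pt 3 => x i) hσ hℓ fun x hx y hy => hsp x hx y hy i
    _ = _ := by simp

lemma WellSeparated.card_le_of_coordSpread (h : WellSeparated b P) {S : Finset (Pt 3)}
    (hS : S ⊆ P) {ℓ : ℝ} (hℓ : 0 ≤ ℓ) (hsp : CoordSpread S ℓ) : (#S : ℝ) ≤ (ℓ + 2) ^ 3 * b := by
  have hb : 0 ≤ b := (Nat.cast_nonneg _).trans (h 0)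
  refine (card_le_card_image_mul S (cellIdx 1) b fun x _ => ?_).trans ?_
  · exact h.card_le ((filter_subset _ _).trans hS)
      (coordSpread_of_cellIdx_eq one_pos fun y hy => (mem_filter.1 hy).2)
  · have := card_image_cellIdx_le one_pos hℓ hsp
    rw [div_one] at this
    gcongr

lemma exists_coord_dominates (v : Fin 3 → ℝ) : ∃ i, ∀ j, |v j| ≤ |v i| := by
  obtain ⟨i, -, hi⟩ := (univ : Finset (Fin 3)).exists_max_image (fun j => |v j|) univ_nonempty
  exact ⟨i, fun j => hi j (mem_univ j)⟩

lemma exists_coord_of_mem_line {q r : Pt 3} : ∃ i, ∀ x ∈ line[ℝ, q, r], ∀ y ∈ line[ℝ, q, r], ∀ j,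
    |x j - y j| ≤ |x i - y i| := by
  obtain ⟨i, hi⟩ := exists_coord_dominates (fun j => (r - q) j)
  refine ⟨i, fun x hx y hy j => ?_⟩
  obtain ⟨s, rfl⟩ := mem_affineSpan_pair_iff_exists_lineMap_eq.1 hx
  obtain ⟨t, rfl⟩ := mem_affineSpan_pair_iff_exists_lineMap_eq.1 hy
  have key : ∀ k, (AffineMap.lineMap q r s : Pt 3) k - (AffineMap.lineMap q r t : Pt 3) k
      = (s - t) * (r - q) k := by
    intro k
    simp [AffineMap.lineMap_apply]
    ring
  rw [key, key, abs_mul, abs_mul]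
  exact mul_le_mul_of_nonneg_left (hi j) (abs_nonneg _)

lemma WellSeparated.card_le_of_subset_line (h : WellSeparated b P) {S : Finset (Pt 3)}
    (hS : S ⊆ P) {ℓ : ℝ} (hℓ : 0 ≤ ℓ) (hsp : CoordSpread S ℓ) {q r : Pt 3}
    (hline : ∀ x ∈ S, x ∈ line[ℝ, q, r]) : (#S : ℝ) ≤ (ℓ + 2) * b := by
  have hb : 0 ≤ b := (Nat.cast_nonneg _).trans (h 0)
  obtain ⟨i, hi⟩ := exists_coord_of_mem_line (q := q) (r := r)
  refine (card_le_card_image_mul S (fun x => ⌊x i / 1⌋) b fun x hx => ?_).trans ?_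
  · refine h.card_le ((filter_subset _ _).trans hS) fun y hy z hz j => ?_
    rw [mem_filter] at hy hz
    refine (le_abs_self _).trans ((hi y (hline y hy.1) z (hline z hz.1) j).trans ?_)
    exact abs_le.2 ⟨by linarith [sub_lt_of_floor_div_eq one_pos (hz.2.trans hy.2.symm)],
      (sub_lt_of_floor_div_eq one_pos (hy.2.trans hz.2.symm)).le⟩
  · have := card_image_floor_le S (fun x : Pt 3 => x i) one_pos hℓ fun x hx y hy => hsp x hx y hy i
    rw [div_one] at this
    gcongr

/-- Among the points of a line segment, few have no other point at coordinate distance `< δ`. -/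
lemma card_isolated_on_line_le {S : Finset (Pt 3)} {ℓ δ : ℝ} (hδ : 0 < δ) (hℓ : 0 ≤ ℓ)
    (hsp : CoordSpread S ℓ) {q r : Pt 3} (hline : ∀ x ∈ S, x ∈ line[ℝ, q, r]) :
    (#{x ∈ S | ¬ ∃ y ∈ S, y ≠ x ∧ ∀ j, |y j - x j| < δ} : ℝ) ≤ ℓ / δ + 2 := by
  obtain ⟨i, hi⟩ := exists_coord_of_mem_line (q := q) (r := r)
  refine le_trans ?_ (card_image_floor_le S (fun x : Pt 3 => x i) hδ hℓ
    fun x hx y hy => hsp x hx y hy i)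
  norm_cast
  refine card_le_card_of_injOn (fun x : Pt 3 => ⌊x i / δ⌋) (fun x hx => ?_) fun x hx y hy hxy => ?_
  · exact mem_image_of_mem _ (mem_filter.1 hx).1
  · rw [Finset.mem_coe, mem_filter] at hx hy
    by_contra hne
    refine hx.2 ⟨y, hy.1, Ne.symm hne, fun j => ?_⟩
    refine (hi y (hline y hy.1) x (hline x hx.1) j).trans_lt ?_
    exact abs_lt.2 ⟨by linarith [sub_lt_of_floor_div_eq hδ hxy],
      sub_lt_of_floor_div_eq hδ hxy.symm⟩

lemma IsKFlat.exists_normal {h : AffineSubspace ℝ (Pt 3)} (hh : IsKFlat 2 h) :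
    ∃ w : Pt 3, w ≠ 0 ∧ ∀ x ∈ h, ∀ y ∈ h, inner ℝ w (x - y) = 0 := by
  have hne : h.directionᗮ ≠ ⊥ := by
    intro h0
    have := h.direction.finrank_add_finrank_orthogonal
    rw [hh.2, h0] at this
    simp at this
  obtain ⟨w, hw, hw0⟩ := Submodule.exists_mem_ne_zero_of_ne_bot hne
  refine ⟨w, hw0, fun x hx y hy => ?_⟩
  exact (Submodule.mem_orthogonal' _ _).1 hw _ (h.vsub_mem_direction hx hy)

lemma IsKFlat.exists_dependent_coord {h : AffineSubspace ℝ (Pt 3)} (hh : IsKFlat 2 h) :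
    ∃ i, ∀ x ∈ h, ∀ y ∈ h,
      |x i - y i| ≤ |x (i + 1) - y (i + 1)| + |x (i + 2) - y (i + 2)| := by
  obtain ⟨w, hw0, hw⟩ := hh.exists_normal
  obtain ⟨i, hi⟩ := exists_coord_dominates (fun j => w j)
  refine ⟨i, fun x hx y hy => ?_⟩
  have hpos : 0 < |w i| := by
    rw [abs_pos]
    intro h0
    refine hw0 (PiLp.ext fun j => ?_)
    have := hi j
    simp only [h0, abs_zero] at this
    simpa using this
  have key : w i * (x i - y i) + w (i + 1) * (x (i + 1) - y (i + 1))
      + w (i + 2) * (x (i + 2) - y (i + 2)) = 0 := by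
    have := hw x hx y hy
    rw [PiLp.inner_apply, Fin.sum_univ_three] at this
    simp only [PiLp.sub_apply, RCLike.inner_apply, conj_trivial] at this
    fin_cases i <;> simp [Fin.isValue] at this ⊢ <;> linarith
  have h1 : |w i| * |x i - y i| ≤ |w i| * (|x (i + 1) - y (i + 1)| + |x (i + 2) - y (i + 2)|) := by
    rw [← abs_mul]
    have : w i * (x i - y i) =
        -(w (i + 1) * (x (i + 1) - y (i + 1)) + w (i + 2) * (x (i + 2) - y (i + 2))) := by linarith
    rw [this, abs_neg, mul_add]
    refine (abs_add_le _ _).trans ?_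
    rw [abs_mul, abs_mul]
    exact add_le_add (mul_le_mul_of_nonneg_right (hi _) (abs_nonneg _))
      (mul_le_mul_of_nonneg_right (hi _) (abs_nonneg _))
  exact le_of_mul_le_mul_left h1 hpos

lemma IsKFlat.card_image_cellIdx_le {h : AffineSubspace ℝ (Pt 3)} (hh : IsKFlat 2 h)
    {S : Finset (Pt 3)} (hS : ∀ x ∈ S, x ∈ h) {σ ℓ : ℝ} (hσ : 0 < σ) (hℓ : 0 ≤ ℓ)
    (hsp : CoordSpread S ℓ) : (#(S.image (cellIdx σ)) : ℝ) ≤ (ℓ / σ + 2) ^ 2 * 4 := by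
  obtain ⟨i, hi⟩ := hh.exists_dependent_coord
  let f : (Fin 3 → ℤ) → ℤ × ℤ := fun c => (c (i + 1), c (i + 2))
  have hfloor : ∀ j, (#(S.image fun x : Pt 3 => ⌊x j / σ⌋) : ℝ) ≤ ℓ / σ + 2 := fun j =>
    card_image_floor_le S (fun x : Pt 3 => x j) hσ hℓ fun x hx y hy => hsp x hx y hy j
  refine (card_le_card_image_mul (S.image (cellIdx σ)) f 4 fun c hc => ?_).trans ?_
  · obtain ⟨x₀, hx₀, rfl⟩ := mem_image.1 hc
    set T : Finset (Pt 3) := {x ∈ S | f (cellIdx σ x) = f (cellIdx σ x₀)} with hT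
    have h4 : (#(T.image fun x : Pt 3 => ⌊x i / σ⌋) : ℝ) ≤ 4 := by
      have := card_image_floor_le T (fun x : Pt 3 => x i) hσ (ℓ := 2 * σ) (by positivity) ?_
      · rw [mul_div_assoc, div_self hσ.ne'] at this
        linarith
      · intro x hx y hy
        rw [hT, mem_filter] at hx hy
        have hxy := hx.2.trans hy.2.symm
        have h1 : cellIdx σ x (i + 1) = cellIdx σ y (i + 1) := congrArg Prod.fst hxy
        have h2 : cellIdx σ x (i + 2) = cellIdx σ y (i + 2) := congrArg Prod.snd hxy
        have := hi x (hS x hx.1) y (hS y hy.1)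
        have a1 := sub_lt_of_floor_div_eq hσ h1
        have a2 := sub_lt_of_floor_div_eq hσ h2
        have a3 := sub_lt_of_floor_div_eq hσ h1.symm
        have a4 := sub_lt_of_floor_div_eq hσ h2.symm
        have b1 : |x (i + 1) - y (i + 1)| ≤ σ := abs_le.2 ⟨by linarith, a1.le⟩
        have b2 : |x (i + 2) - y (i + 2)| ≤ σ := abs_le.2 ⟨by linarith, a2.le⟩
        linarith [le_abs_self (x i - y i)]
    refine le_trans (Nat.cast_le.2 ?_) h4
    refine card_le_card_of_injOn (fun c => c i) (fun c hc => ?_) fun c hc d hd hcd => ?_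
    · rw [Finset.mem_coe, mem_filter] at hc
      obtain ⟨x, hx, rfl⟩ := mem_image.1 hc.1
      exact mem_image.2 ⟨x, mem_filter.2 ⟨hx, hc.2⟩, rfl⟩
    · rw [Finset.mem_coe, mem_filter] at hc hd
      have hf := hc.2.trans hd.2.symm
      have h1 : c (i + 1) = d (i + 1) := congrArg Prod.fst hf
      have h2 : c (i + 2) = d (i + 2) := congrArg Prod.snd hf
      funext j
      rcases (by decide : ∀ i j : Fin 3, j = i ∨ j = i + 1 ∨ j = i + 2) i j with rfl | rfl | rfl
      exacts [hcd, h1, h2]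
  · have hsub : (S.image (cellIdx σ)).image f ⊆
        (S.image fun x : Pt 3 => ⌊x (i + 1) / σ⌋) ×ˢ (S.image fun x : Pt 3 => ⌊x (i + 2) / σ⌋) := by
      intro z hz
      obtain ⟨c, hc, rfl⟩ := mem_image.1 hz
      obtain ⟨x, hx, rfl⟩ := mem_image.1 hc
      exact mem_product.2 ⟨mem_image_of_mem _ hx, mem_image_of_mem _ hx⟩
    have hc := card_le_card hsub
    rw [card_product] at hc
    have hc' : (#((S.image (cellIdx σ)).image f) : ℝ) ≤
        #(S.image fun x : Pt 3 => ⌊x (i + 1) / σ⌋) * #(S.image fun x : Pt 3 => ⌊x (i + 2) / σ⌋) := by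
      exact_mod_cast hc
    have : (#((S.image (cellIdx σ)).image f) : ℝ) ≤ (ℓ / σ + 2) ^ 2 := by
      rw [sq]
      refine hc'.trans (mul_le_mul (hfloor _) (hfloor _) (by positivity) (by positivity))
    linarith

lemma WellSeparated.card_le_of_subset_plane (hP : WellSeparated b P)
    {h : AffineSubspace ℝ (Pt 3)} (hh : IsKFlat 2 h) {S : Finset (Pt 3)} (hSP : S ⊆ P)
    (hS : ∀ x ∈ S, x ∈ h) {ℓ : ℝ} (hℓ : 0 ≤ ℓ) (hsp : CoordSpread S ℓ) :
    (#S : ℝ) ≤ (ℓ + 2) ^ 2 * 4 * b := by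
  have hb : 0 ≤ b := (Nat.cast_nonneg _).trans (hP 0)
  refine (card_le_card_image_mul S (cellIdx 1) b fun x _ => ?_).trans ?_
  · exact hP.card_le ((filter_subset _ _).trans hSP)
      (coordSpread_of_cellIdx_eq one_pos fun y hy => (mem_filter.1 hy).2)
  · have := hh.card_image_cellIdx_le hS one_pos hℓ hsp
    rw [div_one] at this
    gcongr

lemma IsKFlat.eq_of_mem {h h' : AffineSubspace ℝ (Pt 3)} (hh : IsKFlat 2 h) (hh' : IsKFlat 2 h')
    {q r s : Pt 3} (hqr : q ≠ r) (hs : s ∉ line[ℝ, q, r]) (hq : q ∈ h) (hr : r ∈ h) (hsh : s ∈ h)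
    (hq' : q ∈ h') (hr' : r ∈ h') (hsh' : s ∈ h') : h = h' := by
  have hind : AffineIndependent ℝ ![q, r, s] := by
    rw [affineIndependent_iff_not_collinear_set]
    intro hc
    exact hs (hc.mem_affineSpan_of_mem_of_ne (by simp) (by simp) (by simp) hqr)
  have key : ∀ k : AffineSubspace ℝ (Pt 3), IsKFlat 2 k → q ∈ k → r ∈ k → s ∈ k →
      affineSpan ℝ (Set.range ![q, r, s]) = k := by
    intro k hk h1 h2 h3
    refine hind.affineSpan_eq_of_le_of_card_eq_finrank_add_one (affineSpan_le.2 ?_) (by simp [hk.2])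
    rintro _ ⟨i, rfl⟩
    fin_cases i
    exacts [h1, h2, h3]
  rw [← key h hh hq hr hsh, ← key h' hh' hq' hr' hsh']

lemma isKFlat_two_mk' (p : Pt 3) {w : Pt 3} (hw : w ≠ 0) :
    IsKFlat 2 (AffineSubspace.mk' p (ℝ ∙ w)ᗮ) := by
  have : Fact (Module.finrank ℝ (Pt 3) = 2 + 1) := ⟨by simp⟩
  refine ⟨⟨p, self_mem_mk' _ _⟩, ?_⟩
  rw [direction_mk']
  exact Submodule.finrank_orthogonal_span_singleton hw

lemma isKFlat_two_perpBisector {q r : Pt 3} (h : q ≠ r) : IsKFlat 2 (perpBisector q r) := by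
  have : Fact (Module.finrank ℝ (Pt 3) = 2 + 1) := ⟨by simp⟩
  refine ⟨⟨_, midpoint_mem_perpBisector q r⟩, ?_⟩
  rw [direction_perpBisector]
  exact Submodule.finrank_orthogonal_span_singleton (vsub_ne_zero.2 h.symm)

lemma reflection_direction_perpBisector {p q r : Pt 3} (h : p ∈ perpBisector q r) :
    (perpBisector q r).direction.reflection (q - p) = r - p := by
  have hn : ‖r - p‖ = ‖q - p‖ := by
    rw [mem_perpBisector_iff_dist_eq] at h
    rw [← dist_eq_norm, ← dist_eq_norm, dist_comm r, dist_comm q, h]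
  have h1 := Submodule.reflection_sub hn
  rw [sub_sub_sub_cancel_right] at h1
  simp only [direction_perpBisector, vsub_eq_sub]
  rw [← h1, Submodule.reflection_reflection]

lemma det_reflection_direction {h : AffineSubspace ℝ (Pt 3)} (hh : IsKFlat 2 h) :
    LinearMap.det (h.direction.reflection.toLinearMap) = -1 := by
  rw [Submodule.det_reflection]
  have := h.direction.finrank_add_finrank_orthogonal
  rw [hh.2] at this
  have h1 : Module.finrank ℝ h.directionᗮ = 1 := by simp at this; omega
  rw [h1, pow_one]

/-- The composition of three reflections in planes through `p` reverses orientation, so its fixed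
points all lie in one plane. -/
lemma exists_plane_of_triangle (p : Pt 3) {h₁ h₂ h₃ : AffineSubspace ℝ (Pt 3)}
    (hh₁ : IsKFlat 2 h₁) (hh₂ : IsKFlat 2 h₂) (hh₃ : IsKFlat 2 h₃) :
    ∃ g : AffineSubspace ℝ (Pt 3), IsKFlat 2 g ∧ p ∈ g ∧ ∀ q r s : Pt 3,
      dist p q = dist p r → dist p r = dist p s →
      perpBisector q r = h₁ → perpBisector r s = h₂ → perpBisector s q = h₃ → q ∈ g := by
  set A : Pt 3 →ₗ[ℝ] Pt 3 := h₃.direction.reflection.toLinearMap ∘ₗ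
    (h₂.direction.reflection.toLinearMap ∘ₗ h₁.direction.reflection.toLinearMap) with hA
  have hdet : LinearMap.det A = -1 := by
    rw [hA, LinearMap.det_comp, LinearMap.det_comp, det_reflection_direction hh₁,
      det_reflection_direction hh₂, det_reflection_direction hh₃]
    norm_num
  have hne : (LinearMap.ker (A - LinearMap.id))ᗮ ≠ ⊥ := by
    intro h0
    rw [Submodule.orthogonal_eq_bot_iff, LinearMap.ker_eq_top, sub_eq_zero] at h0
    rw [h0, LinearMap.det_id] at hdet
    norm_num at hdet
  obtain ⟨w, hw, hw0⟩ := Submodule.exists_mem_ne_zero_of_ne_bot hne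
  refine ⟨AffineSubspace.mk' p (ℝ ∙ w)ᗮ, isKFlat_two_mk' p hw0, self_mem_mk' _ _, ?_⟩
  rintro q r s hqr hrs rfl rfl rfl
  have e1 := reflection_direction_perpBisector (mem_perpBisector_iff_dist_eq.2 hqr)
  have e2 := reflection_direction_perpBisector (mem_perpBisector_iff_dist_eq.2 hrs)
  have e3 := reflection_direction_perpBisector
    (mem_perpBisector_iff_dist_eq.2 (hqr.trans hrs).symm)
  have hfix : A (q - p) = q - p := by
    change (perpBisector s q).direction.reflection ((perpBisector r s).direction.reflection
      ((perpBisector q r).direction.reflection (q - p))) = _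
    rw [e1, e2, e3]
  rw [mem_mk', vsub_eq_sub, Submodule.mem_orthogonal_singleton_iff_inner_right]
  refine (Submodule.mem_orthogonal' _ _).1 hw _ ?_
  rw [LinearMap.mem_ker, LinearMap.sub_apply, hfix, LinearMap.id_apply, sub_self]

/-- The points of `S` in the same cell of the grid `σ ℤ³` as `q`. -/
def cellPart (σ : ℝ) (S : Finset (Pt 3)) (q : Pt 3) : Finset (Pt 3) :=
  {x ∈ S | cellIdx σ x = cellIdx σ q}

/-- The points of `S` on the flat `h`. -/
def flatPart (S : Finset (Pt 3)) (h : AffineSubspace ℝ (Pt 3)) : Finset (Pt 3) :=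
  {x ∈ S | x ∈ h}

lemma mem_cellPart {σ : ℝ} {S : Finset (Pt 3)} {q x : Pt 3} :
    x ∈ cellPart σ S q ↔ x ∈ S ∧ cellIdx σ x = cellIdx σ q := mem_filter

lemma mem_flatPart {S : Finset (Pt 3)} {h : AffineSubspace ℝ (Pt 3)} {x : Pt 3} :
    x ∈ flatPart S h ↔ x ∈ S ∧ x ∈ h := mem_filter

lemma coordSpread_cellPart {σ : ℝ} (hσ : 0 < σ) (S : Finset (Pt 3)) (q : Pt 3) :
    CoordSpread (cellPart σ S q) σ :=
  coordSpread_of_cellIdx_eq hσ fun _ hx => (mem_cellPart.1 hx).2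

lemma cellPart_congr {σ : ℝ} {S : Finset (Pt 3)} {q r : Pt 3} (h : cellIdx σ q = cellIdx σ r) :
    cellPart σ S q = cellPart σ S r := by
  simp only [cellPart, h]

lemma WellSeparated.card_cellPart_le (hP : WellSeparated b P) {σ : ℝ} (hσ : 0 < σ) (q : Pt 3) :
    (#(cellPart σ P q) : ℝ) ≤ (σ + 2) ^ 3 * b :=
  hP.card_le_of_coordSpread (filter_subset _ _) hσ.le (coordSpread_cellPart hσ P q)

/-- Few points of a plane lie in cells containing few points of that plane. -/
lemma IsKFlat.card_sparse_le {h : AffineSubspace ℝ (Pt 3)} (hh : IsKFlat 2 h)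
    {N σ w : ℝ} (hσ : 0 < σ) (hN : 0 ≤ N) (hw : 0 ≤ w) (hsp : CoordSpread P N) :
    (#{q ∈ flatPart P h | #(cellPart σ (flatPart P h) q) < w} : ℝ) ≤ (N / σ + 2) ^ 2 * 4 * w := by
  set T := {q ∈ flatPart P h | #(cellPart σ (flatPart P h) q) < w} with hT
  have hTs : T ⊆ flatPart P h := filter_subset _ _
  refine (card_le_card_image_mul T (cellIdx σ) w fun x hx => ?_).trans ?_
  · refine le_trans (Nat.cast_le.2 (card_le_card ?_)) (mem_filter.1 hx).2.le
    exact filter_subset_filter _ hTs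
  · refine mul_le_mul_of_nonneg_right ?_ hw
    exact hh.card_image_cellIdx_le (fun x hx => (mem_flatPart.1 (hTs hx)).2) hσ hN
      (hsp.mono (hTs.trans (filter_subset _ _)))

lemma card_mul_le_of_double_count {α β : Type*} (r : α → β → Prop)
    [∀ x y, Decidable (r x y)] (s : Finset α) (t : Finset β) {w k : ℝ} (hw : ∀ x ∈ s, w ≤ #{y ∈ t | r x y}) (hk : ∀ y ∈ t, (#{x ∈ s | r x y} : ℝ) ≤ k) :
    #s * w ≤ #t * k := by
  simpa using card_nsmul_le_card_nsmul r hw hk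

/-- The planes of `𝓗` in which `q` spans, with a nearby point, a line having many points of the
plane off it near `q`. -/
def offLinePlanes (P : Finset (Pt 3)) (𝓗 : Finset (AffineSubspace ℝ (Pt 3))) (s₀ σ₁ w₁ : ℝ)
    (q : Pt 3) : Finset (AffineSubspace ℝ (Pt 3)) :=
  {h ∈ 𝓗 | q ∈ h ∧ ∃ r ∈ cellPart s₀ P q, r ≠ q ∧ r ∈ h ∧
    w₁ / 2 ≤ #{x ∈ cellPart σ₁ (flatPart P h) q | x ∉ line[ℝ, q, r]}}

lemma card_offLinePlanes_le (hP : WellSeparated b P) {𝓗 : Finset (AffineSubspace ℝ (Pt 3))}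
    (h𝓗 : ∀ h ∈ 𝓗, IsKFlat 2 h) {s₀ σ₁ w₁ : ℝ} (hs₀ : 0 < s₀) (hσ₁ : 0 < σ₁) (hw₁ : 0 < w₁)
    (q : Pt 3) : (#(offLinePlanes P 𝓗 s₀ σ₁ w₁ q) : ℝ) ≤
      ((s₀ + 2) ^ 3 * b) * ((σ₁ + 2) ^ 3 * b) / (w₁ / 2) := by
  rw [le_div_iff₀ (by positivity)]
  have key := card_mul_le_of_double_count
    (fun (h : AffineSubspace ℝ (Pt 3)) (y : Pt 3 × Pt 3) =>
      y.1 ≠ q ∧ y.2 ∉ line[ℝ, q, y.1] ∧ q ∈ h ∧ y.1 ∈ h ∧ y.2 ∈ h)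
    (offLinePlanes P 𝓗 s₀ σ₁ w₁ q) (cellPart s₀ P q ×ˢ cellPart σ₁ P q) (w := w₁ / 2) (k := 1)
    ?_ ?_
  · refine key.trans ?_
    rw [mul_one, card_product]
    push_cast
    exact mul_le_mul (hP.card_cellPart_le hs₀ q) (hP.card_cellPart_le hσ₁ q) (by positivity)
      ((Nat.cast_nonneg _).trans (hP.card_cellPart_le hs₀ q))
  · intro h hh
    obtain ⟨-, hq, r, hr, hrq, hrh, hw⟩ := mem_filter.1 hh
    refine hw.trans (Nat.cast_le.2 (card_le_card_of_injOn (fun x => (r, x)) ?_ ?_))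
    · intro x hx
      rw [Finset.mem_coe, mem_filter, mem_cellPart, mem_flatPart] at hx
      simp only [Finset.mem_coe, mem_filter, mem_product, mem_cellPart]
      exact ⟨⟨mem_cellPart.1 hr, hx.1.1.1, hx.1.2⟩, hrq, hx.2, hq, hrh, hx.1.1.2⟩
    · intro x _ y _ hxy
      exact congrArg Prod.snd hxy
  · intro y _
    rw [← Nat.cast_one, Nat.cast_le, card_le_one]
    intro h hh h' hh'
    obtain ⟨h1, h2, h3, h4, h5, h6⟩ := mem_filter.1 hh
    obtain ⟨h1', -, -, h4', h5', h6'⟩ := mem_filter.1 hh'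
    exact (h𝓗 h (mem_filter.1 h1).1).eq_of_mem (h𝓗 h' (mem_filter.1 h1').1) h2.symm h3
      h4 h5 h6 h4' h5' h6'

/-- The planes of `𝓗` through two points of a line that contain many points near `q`. -/
lemma card_planes_through_line_le (hP : WellSeparated b P)
    {𝓗 : Finset (AffineSubspace ℝ (Pt 3))} (h𝓗 : ∀ h ∈ 𝓗, IsKFlat 2 h) {σ₂ w₂ : ℝ} (hσ₂ : 0 < σ₂)
    (hw₂ : 0 < w₂) (hline : (σ₂ + 2) * b ≤ w₂ / 2) {q r : Pt 3} (hrq : r ≠ q) :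
    (#{h ∈ 𝓗 | q ∈ h ∧ r ∈ h ∧ w₂ ≤ #(cellPart σ₂ (flatPart P h) q)} : ℝ) ≤
      (σ₂ + 2) ^ 3 * b / (w₂ / 2) := by
  rw [le_div_iff₀ (by positivity)]
  have key := card_mul_le_of_double_count
    (fun (h : AffineSubspace ℝ (Pt 3)) (x : Pt 3) => x ∉ line[ℝ, q, r] ∧ x ∈ h)
    {h ∈ 𝓗 | q ∈ h ∧ r ∈ h ∧ w₂ ≤ #(cellPart σ₂ (flatPart P h) q)} (cellPart σ₂ P q)
    (w := w₂ / 2) (k := 1) ?_ ?_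
  · refine key.trans ?_
    rw [mul_one]
    exact hP.card_cellPart_le hσ₂ q
  · intro h hh
    obtain ⟨-, hq, hr, hw⟩ := mem_filter.1 hh
    have hsub : {x ∈ cellPart σ₂ (flatPart P h) q | x ∉ line[ℝ, q, r]} ⊆
        {x ∈ cellPart σ₂ P q | x ∉ line[ℝ, q, r] ∧ x ∈ h} := by
      intro x hx
      rw [mem_filter, mem_cellPart, mem_flatPart] at hx
      rw [mem_filter, mem_cellPart]
      exact ⟨⟨hx.1.1.1, hx.1.2⟩, hx.2, hx.1.1.2⟩
    refine le_trans ?_ (Nat.cast_le.2 (card_le_card hsub))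
    have hsplit := card_filter_add_card_filter_not (s := cellPart σ₂ (flatPart P h) q)
      (fun x => x ∈ line[ℝ, q, r])
    have hon : (#{x ∈ cellPart σ₂ (flatPart P h) q | x ∈ line[ℝ, q, r]} : ℝ) ≤ (σ₂ + 2) * b :=
      hP.card_le_of_subset_line
        ((filter_subset _ _).trans ((filter_subset _ _).trans (filter_subset _ _))) hσ₂.le
        ((coordSpread_cellPart hσ₂ _ q).mono (filter_subset _ _))
        fun x hx => (mem_filter.1 hx).2
    have : (#{x ∈ cellPart σ₂ (flatPart P h) q | x ∈ line[ℝ, q, r]} : ℝ) +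
      #{x ∈ cellPart σ₂ (flatPart P h) q | x ∉ line[ℝ, q, r]} =
        #(cellPart σ₂ (flatPart P h) q) := by exact_mod_cast hsplit
    linarith
  · intro y _
    rw [← Nat.cast_one, Nat.cast_le, card_le_one]
    intro h hh h' hh'
    obtain ⟨h1, h2, h3⟩ := mem_filter.1 hh
    obtain ⟨h1', -, h3'⟩ := mem_filter.1 hh'
    rw [mem_filter] at h1 h1'
    exact (h𝓗 h h1.1).eq_of_mem (h𝓗 h' h1'.1) hrq.symm h2 h1.2.1 h1.2.2.1 h3
      h1'.2.1 h1'.2.2.1 h3'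

/-- Pairs of a point of `P` and a line through it spanned by `P` having many points of `P` near
that point. -/
def richLinePairs (P : Finset (Pt 3)) (σ₁ w₁ : ℝ) : Finset (Pt 3 × AffineSubspace ℝ (Pt 3)) :=
  {x ∈ P ×ˢ P.offDiag.image fun y => line[ℝ, y.1, y.2] |
    x.1 ∈ x.2 ∧ w₁ / 2 ≤ #(flatPart (cellPart σ₁ P x.1) x.2)}

lemma card_richLinePairs_le (hP : WellSeparated b P) {σ₁ w₁ δ : ℝ} (hσ₁ : 0 < σ₁) (hδ : 0 < δ)
    (hw₁ : σ₁ / δ + 2 ≤ w₁ / 4) :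
    (#(richLinePairs P σ₁ w₁) : ℝ) ≤ 2 * (#P * ((2 * δ + 2) ^ 3 * b)) := by
  have hb : 0 ≤ b := (Nat.cast_nonneg _).trans (hP 0)
  set R := richLinePairs P σ₁ w₁ with hR
  let near : Pt 3 × AffineSubspace ℝ (Pt 3) → Prop :=
    fun x => ∃ z ∈ P, z ≠ x.1 ∧ z ∈ x.2 ∧ ∀ j, |z j - x.1 j| < δ
  let f : Pt 3 × AffineSubspace ℝ (Pt 3) → (Fin 3 → ℤ) × AffineSubspace ℝ (Pt 3) :=
    fun x => (cellIdx σ₁ x.1, x.2)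
  have hmem : ∀ {x}, x ∈ R ↔ x.1 ∈ P ∧ (∃ y z, y ∈ P ∧ z ∈ P ∧ y ≠ z ∧ line[ℝ, y, z] = x.2) ∧
      x.1 ∈ x.2 ∧ w₁ / 2 ≤ #(flatPart (cellPart σ₁ P x.1) x.2) := by
    intro x
    simp only [hR, richLinePairs, mem_filter, mem_product, mem_image, mem_offDiag, Prod.exists,
      and_assoc]
  have hfar : (#{x ∈ R | ¬ near x} : ℝ) ≤ #(R.image f) * (w₁ / 4) := by
    have h1 : (#{x ∈ R | ¬ near x} : ℝ) ≤ #({x ∈ R | ¬ near x}.image f) * (w₁ / 4) := by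
      refine card_le_card_image_mul _ f _ fun x hx => le_trans ?_ hw₁
      obtain ⟨hx, -⟩ := mem_filter.1 hx
      obtain ⟨hxP, ⟨y, z, hy, hz, hyz, hl⟩, hxl, hw⟩ := hmem.1 hx
      refine le_trans (Nat.cast_le.2 (card_le_card_of_injOn Prod.fst (fun u hu => ?_)
        fun u hu v hv huv => ?_)) (card_isolated_on_line_le (S := flatPart (cellPart σ₁ P x.1) x.2)
          hδ hσ₁.le ((coordSpread_cellPart hσ₁ _ _).mono (filter_subset _ _)) (q := y) (r := z)
          fun u hu => ?_)
      · rw [Finset.mem_coe, mem_filter, mem_filter] at hu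
        obtain ⟨⟨hu1, hu2⟩, hu3⟩ := hu
        have hu4 : cellIdx σ₁ u.1 = cellIdx σ₁ x.1 := congrArg Prod.fst hu3
        have hu5 : u.2 = x.2 := (Prod.ext_iff.1 hu3).2
        obtain ⟨huP, -, hul, -⟩ := hmem.1 hu1
        rw [Finset.mem_coe, mem_filter, mem_flatPart, mem_cellPart]
        refine ⟨⟨⟨huP, hu4⟩, hu5 ▸ hul⟩, fun ⟨v, hv, hvu, hd⟩ => hu2 ⟨v, ?_, hvu, ?_, hd⟩⟩
        · exact (mem_cellPart.1 (mem_flatPart.1 hv).1).1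
        · rw [hu5]
          exact (mem_flatPart.1 hv).2
      · rw [Finset.mem_coe, mem_filter] at hu hv
        exact Prod.ext huv ((congrArg Prod.snd hu.2).trans (congrArg Prod.snd hv.2).symm)
      · rw [hl]
        exact (mem_flatPart.1 hu).2
    refine h1.trans (mul_le_mul_of_nonneg_right ?_ ?_)
    · exact Nat.cast_le.2 (card_le_card (image_subset_image (filter_subset _ _)))
    · exact le_trans (by positivity) hw₁
  have hall : #(R.image f) * (w₁ / 2) ≤ (#R : ℝ) * 1 := by
    refine card_mul_le_of_double_count (fun y x => f x = y) _ _ (fun y hy => ?_) fun x _ => ?_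
    · obtain ⟨x, hx, rfl⟩ := mem_image.1 hy
      obtain ⟨hxP, hline, hxl, hw⟩ := hmem.1 hx
      refine hw.trans (Nat.cast_le.2 (card_le_card_of_injOn (fun u => (u, x.2)) (fun u hu => ?_)
        fun u _ v _ huv => congrArg Prod.fst huv))
      rw [Finset.mem_coe, mem_flatPart, mem_cellPart] at hu
      rw [Finset.mem_coe, mem_filter, hmem]
      refine ⟨⟨hu.1.1, hline, hu.2, ?_⟩, Prod.ext hu.1.2 rfl⟩
      rw [cellPart_congr hu.1.2]
      exact hw
    · rw [← Nat.cast_one, Nat.cast_le, card_le_one]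
      intro y hy z hz
      exact (mem_filter.1 hy).2.symm.trans (mem_filter.1 hz).2
  have hnear : (#{x ∈ R | near x} : ℝ) ≤ #P * ((2 * δ + 2) ^ 3 * b) := by
    have h1 : (#{x ∈ R | near x} : ℝ) ≤
        #({x ∈ R | near x}.image Prod.fst) * ((2 * δ + 2) ^ 3 * b) := by
      refine card_le_card_image_mul _ _ _ fun x hx => ?_
      refine le_trans (Nat.cast_le.2 ?_) (hP.card_le_of_coordSpread
        (S := {z ∈ P | ∀ j, |z j - x.1 j| < δ}) (filter_subset _ _) (by positivity) ?_)
      · refine (card_le_card fun u hu => ?_).trans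
          (card_image_le (f := fun z => (x.1, line[ℝ, x.1, z])))
        rw [mem_filter, mem_filter] at hu
        obtain ⟨⟨hu, z, hz, hzu, hzl, hd⟩, hux⟩ := hu
        obtain ⟨-, ⟨y, z', -, -, -, hl⟩, hul, -⟩ := hmem.1 hu
        rw [hux] at hzu hd
        refine mem_image.2 ⟨z, mem_filter.2 ⟨hz, hd⟩, Prod.ext hux.symm ?_⟩
        rw [← hl] at hzl hul ⊢
        exact affineSpan_pair_eq_of_mem_of_mem_of_ne (hux ▸ hul) hzl hzu.symm
      · intro y hy z hz j
        have h1 := abs_lt.1 ((mem_filter.1 hy).2 j)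
        have h2 := abs_lt.1 ((mem_filter.1 hz).2 j)
        linarith [h1.2, h2.1]
    refine h1.trans (mul_le_mul_of_nonneg_right (Nat.cast_le.2 (card_le_card ?_)) (by positivity))
    intro q hq
    obtain ⟨x, hx, rfl⟩ := mem_image.1 hq
    exact (hmem.1 (mem_filter.1 hx).1).1
  have hsplit : (#{x ∈ R | near x} : ℝ) + #{x ∈ R | ¬ near x} = #R := by
    exact_mod_cast card_filter_add_card_filter_not (s := R) near
  linarith

/-- If every plane of `𝓗` contains many points of `P`, then there are few incidences. -/
lemma sum_card_flatPart_le (hP : WellSeparated b P) {𝓗 : Finset (AffineSubspace ℝ (Pt 3))}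
    (h𝓗 : ∀ h ∈ 𝓗, IsKFlat 2 h) {N m s₀ σ₁ σ₂ w₁ w₂ δ : ℝ} (hN : 0 ≤ N) (hsp : CoordSpread P N)
    (hm : ∀ h ∈ 𝓗, m ≤ #(flatPart P h)) (hs₀ : 0 < s₀) (hσ₁ : 0 < σ₁) (hσ₂ : 0 < σ₂) (hδ : 0 < δ)
    (hw₁ : 0 < w₁) (hw₂ : 0 < w₂) (hm₀ : (N / s₀ + 2) ^ 2 * 4 * 2 ≤ m / 6)
    (hm₁ : (N / σ₁ + 2) ^ 2 * 4 * w₁ ≤ m / 6) (hm₂ : (N / σ₂ + 2) ^ 2 * 4 * w₂ ≤ m / 6)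
    (hline₁ : σ₁ / δ + 2 ≤ w₁ / 4) (hline₂ : (σ₂ + 2) * b ≤ w₂ / 2) :
    (∑ h ∈ 𝓗, #(flatPart P h) : ℝ) ≤
      2 * (#P * (((s₀ + 2) ^ 3 * b) * ((σ₁ + 2) ^ 3 * b) / (w₁ / 2)) +
        2 * (#P * ((2 * δ + 2) ^ 3 * b)) * ((σ₂ + 2) ^ 3 * b / (w₂ / 2))) := by
  let good : AffineSubspace ℝ (Pt 3) → Pt 3 → Prop := fun h q => q ∈ h ∧
    2 ≤ (#(cellPart s₀ (flatPart P h) q) : ℝ) ∧ w₁ ≤ #(cellPart σ₁ (flatPart P h) q) ∧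
      w₂ ≤ #(cellPart σ₂ (flatPart P h) q)
  have hgood : ∀ h ∈ 𝓗, (#(flatPart P h) : ℝ) ≤ 2 * #{q ∈ P | good h q} := by
    intro h hh
    have hsub : flatPart P h ⊆ {q ∈ P | good h q} ∪
        ({q ∈ flatPart P h | (#(cellPart s₀ (flatPart P h) q) : ℝ) < 2} ∪
          ({q ∈ flatPart P h | (#(cellPart σ₁ (flatPart P h) q) : ℝ) < w₁} ∪
            {q ∈ flatPart P h | (#(cellPart σ₂ (flatPart P h) q) : ℝ) < w₂})) := by
      intro q hq
      obtain ⟨hqP, hqh⟩ := mem_flatPart.1 hq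
      simp only [mem_union, mem_filter, hq, hqP, true_and, good, hqh]
      by_contra! hcon
      linarith [hcon.1 hcon.2.1 hcon.2.2.1]
    have h1 := (h𝓗 h hh).card_sparse_le hs₀ hN zero_le_two hsp
    have h2 := (h𝓗 h hh).card_sparse_le hσ₁ hN hw₁.le hsp
    have h3 := (h𝓗 h hh).card_sparse_le hσ₂ hN hw₂.le hsp
    have h4 := (card_le_card hsub).trans ((card_union_le _ _).trans (add_le_add_right
      ((card_union_le _ _).trans (add_le_add_right (card_union_le _ _) _)) _))
    have h5 := (Nat.cast_le (α := ℝ)).2 h4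
    push_cast at h5
    linarith [hm h hh]
  have hX₂ : 0 ≤ (σ₂ + 2) ^ 3 * b / (w₂ / 2) := by
    have hb : 0 ≤ b := (Nat.cast_nonneg _).trans (hP 0)
    positivity
  have hpt : ∀ q ∈ P, (#{h ∈ 𝓗 | good h q} : ℝ) ≤
      ((s₀ + 2) ^ 3 * b) * ((σ₁ + 2) ^ 3 * b) / (w₁ / 2) +
        #{x ∈ richLinePairs P σ₁ w₁ | x.1 = q} * ((σ₂ + 2) ^ 3 * b / (w₂ / 2)) := by
    intro q hq
    let F : Pt 3 × AffineSubspace ℝ (Pt 3) → Finset (AffineSubspace ℝ (Pt 3)) := fun x =>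
      {h ∈ 𝓗 | q ∈ h ∧ x.2 ≤ h ∧ w₂ ≤ #(cellPart σ₂ (flatPart P h) q)}
    have hsub : {h ∈ 𝓗 | good h q} ⊆ offLinePlanes P 𝓗 s₀ σ₁ w₁ q ∪
        {x ∈ richLinePairs P σ₁ w₁ | x.1 = q}.biUnion F := by
      intro h hh
      obtain ⟨hh, hqh, hg0, hg1, hg2⟩ := mem_filter.1 hh
      have : 1 < #(cellPart s₀ (flatPart P h) q) := by exact_mod_cast hg0
      obtain ⟨r, hr, hrq⟩ := exists_mem_ne this q
      rw [mem_cellPart, mem_flatPart] at hr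
      have hsplit : (#{x ∈ cellPart σ₁ (flatPart P h) q | x ∈ line[ℝ, q, r]} : ℝ) +
          #{x ∈ cellPart σ₁ (flatPart P h) q | x ∉ line[ℝ, q, r]} =
          #(cellPart σ₁ (flatPart P h) q) := by
        exact_mod_cast card_filter_add_card_filter_not _
      rw [mem_union]
      by_cases hoff : w₁ / 2 ≤ #{x ∈ cellPart σ₁ (flatPart P h) q | x ∉ line[ℝ, q, r]}
      · left
        exact mem_filter.2 ⟨hh, hqh, r, mem_cellPart.2 ⟨hr.1.1, hr.2⟩, hrq, hr.1.2, hoff⟩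
      · right
        refine mem_biUnion.2 ⟨(q, line[ℝ, q, r]), mem_filter.2 ⟨mem_filter.2 ⟨mem_product.2
          ⟨hq, mem_image.2 ⟨(q, r), mem_offDiag.2 ⟨hq, hr.1.1, hrq.symm⟩, rfl⟩⟩,
          left_mem_affineSpan_pair ℝ q r, ?_⟩, rfl⟩, mem_filter.2 ⟨hh, hqh,
          affineSpan_pair_le_of_mem_of_mem hqh hr.1.2, hg2⟩⟩
        have : w₁ / 2 ≤ #{x ∈ cellPart σ₁ (flatPart P h) q | x ∈ line[ℝ, q, r]} := by linarith
        refine this.trans (Nat.cast_le.2 (card_le_card fun x hx => ?_))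
        rw [mem_filter, mem_cellPart, mem_flatPart] at hx
        exact mem_flatPart.2 ⟨mem_cellPart.2 ⟨hx.1.1.1, hx.1.2⟩, hx.2⟩
    have h1 := (Nat.cast_le (α := ℝ)).2 ((card_le_card hsub).trans (card_union_le _ _))
    have h2 := (Nat.cast_le (α := ℝ)).2
      (card_biUnion_le (s := {x ∈ richLinePairs P σ₁ w₁ | x.1 = q}) (t := F))
    have h3 : (∑ x ∈ {x ∈ richLinePairs P σ₁ w₁ | x.1 = q}, (#(F x) : ℝ)) ≤
        #{x ∈ richLinePairs P σ₁ w₁ | x.1 = q} * ((σ₂ + 2) ^ 3 * b / (w₂ / 2)) := by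
      rw [← nsmul_eq_mul]
      refine sum_le_card_nsmul _ _ _ fun x hx => ?_
      obtain ⟨hxR, rfl⟩ := mem_filter.1 hx
      rw [richLinePairs, mem_filter, mem_product] at hxR
      obtain ⟨y, hy, hl⟩ := mem_image.1 hxR.1.2
      obtain ⟨r, hr, hrx⟩ : ∃ r ∈ x.2, r ≠ x.1 := by
        by_cases h : y.1 = x.1
        · refine ⟨y.2, hl ▸ right_mem_affineSpan_pair ℝ _ _, ?_⟩
          rw [← h]
          exact (mem_offDiag.1 hy).2.2.symm
        · exact ⟨y.1, hl ▸ left_mem_affineSpan_pair ℝ _ _, h⟩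
      refine le_trans (Nat.cast_le.2 (card_le_card fun h hh => ?_))
        (card_planes_through_line_le hP h𝓗 hσ₂ hw₂ hline₂ hrx)
      obtain ⟨hh, hqh, hle, hw⟩ := mem_filter.1 hh
      exact mem_filter.2 ⟨hh, hqh, hle hr, hw⟩
    have h4 := card_offLinePlanes_le hP h𝓗 hs₀ hσ₁ hw₁ q
    push_cast at h1 h2
    linarith
  have hfib : ∑ q ∈ P, (#{x ∈ richLinePairs P σ₁ w₁ | x.1 = q} : ℝ) = #(richLinePairs P σ₁ w₁) := by
    rw [card_eq_sum_card_fiberwise (f := Prod.fst) (t := P)]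
    · push_cast
      rfl
    · intro x hx
      rw [Finset.mem_coe, richLinePairs, mem_filter, mem_product] at hx
      exact hx.1.1
  have hswap : ∑ h ∈ 𝓗, (#{q ∈ P | good h q} : ℝ) = ∑ q ∈ P, (#{h ∈ 𝓗 | good h q} : ℝ) := by
    exact_mod_cast sum_card_bipartiteAbove_eq_sum_card_bipartiteBelow good
  calc (∑ h ∈ 𝓗, #(flatPart P h) : ℝ) ≤ ∑ h ∈ 𝓗, 2 * (#{q ∈ P | good h q} : ℝ) := sum_le_sum hgood
    _ = 2 * ∑ q ∈ P, (#{h ∈ 𝓗 | good h q} : ℝ) := by rw [← mul_sum, hswap]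
    _ ≤ 2 * ∑ q ∈ P, (((s₀ + 2) ^ 3 * b) * ((σ₁ + 2) ^ 3 * b) / (w₁ / 2) +
        #{x ∈ richLinePairs P σ₁ w₁ | x.1 = q} * ((σ₂ + 2) ^ 3 * b / (w₂ / 2))) := by
      gcongr with q hq
      exact hpt q hq
    _ ≤ _ := by
      rw [sum_add_distrib, sum_const, nsmul_eq_mul, ← sum_mul, hfib]
      gcongr
      exact card_richLinePairs_le hP hσ₁ hδ hline₁

lemma dist_lt_dist_of_coord {p q r : Pt 3} (h : ∀ i, |p i - r i| < |p i - q i|) :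
    dist p r < dist p q := by
  rw [EuclideanSpace.dist_eq, EuclideanSpace.dist_eq]
  refine Real.sqrt_lt_sqrt (sum_nonneg fun _ _ => by positivity) ?_
  refine sum_lt_sum_of_nonempty univ_nonempty fun i _ => ?_
  rw [Real.dist_eq, Real.dist_eq, sq_lt_sq, abs_abs, abs_abs]
  exact h i

lemma dist_lt_of_abs_cellIdx_lt {L : ℝ} (hL : 0 < L) {p q r : Pt 3}
    (hs : ∀ i, p i ≤ q i ↔ p i ≤ r i)
    (hu : ∀ i, |cellIdx L r i - cellIdx L p i| < |cellIdx L q i - cellIdx L p i|) :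
    dist p r < dist p q := by
  refine dist_lt_dist_of_coord fun i => ?_
  have hmono : ∀ {u v : ℝ}, u ≤ v → ⌊u / L⌋ ≤ ⌊v / L⌋ := fun huv =>
    Int.floor_mono (div_le_div_of_nonneg_right huv hL.le)
  have h := hu i
  simp only [cellIdx] at h
  by_cases hq : p i ≤ q i
  · have hr := (hs i).1 hq
    have : r i < q i := by
      by_contra! hcon
      rw [abs_of_nonneg (sub_nonneg.2 (hmono hr)), abs_of_nonneg (sub_nonneg.2 (hmono hq))] at h
      have := hmono hcon
      omega
    rw [abs_sub_comm, abs_sub_comm (p i), abs_of_nonneg (sub_nonneg.2 hr),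
      abs_of_nonneg (sub_nonneg.2 hq)]
    linarith
  · have hr : r i < p i := not_le.1 fun h => hq ((hs i).2 h)
    push Not at hq
    have : q i < r i := by
      by_contra! hcon
      rw [abs_of_nonpos (sub_nonpos.2 (hmono hr.le)),
        abs_of_nonpos (sub_nonpos.2 (hmono hq.le))] at h
      have := hmono hcon
      omega
    rw [abs_of_nonneg (sub_nonneg.2 hr.le), abs_of_nonneg (sub_nonneg.2 hq.le)]
    linarith

/-- Data on `q` which, among points at a given distance from `p`, determine the cell of `q`. -/
def cellKey (L : ℝ) (p q : Pt 3) : ℝ × (Fin 3 → Bool) × ℤ × ℤ :=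
  (dist p q, fun i => decide (p i ≤ q i),
    |cellIdx L q 0 - cellIdx L p 0| - |cellIdx L q 2 - cellIdx L p 2|,
    |cellIdx L q 1 - cellIdx L p 1| - |cellIdx L q 2 - cellIdx L p 2|)

lemma cellIdx_eq_of_cellKey_eq {L : ℝ} (hL : 0 < L) {p q r : Pt 3}
    (h : cellKey L p q = cellKey L p r) : dist p q = dist p r ∧ cellIdx L q = cellIdx L r := by
  simp only [cellKey, Prod.mk.injEq, funext_iff, decide_eq_decide] at h
  obtain ⟨hd, hs, h0, h1⟩ := h
  refine ⟨hd, ?_⟩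
  rcases lt_trichotomy |cellIdx L q 2 - cellIdx L p 2| |cellIdx L r 2 - cellIdx L p 2| with h2 | h2 | h2
  · refine absurd (dist_lt_of_abs_cellIdx_lt hL (fun i => (hs i).symm) fun i => ?_) hd.not_lt
    fin_cases i <;> simp <;> omega
  · have habs : ∀ i, |cellIdx L q i - cellIdx L p i| = |cellIdx L r i - cellIdx L p i| := by
      intro i
      fin_cases i <;> simp <;> omega
    have hmono : ∀ {u v : ℝ}, u ≤ v → ⌊u / L⌋ ≤ ⌊v / L⌋ := fun huv =>
      Int.floor_mono (div_le_div_of_nonneg_right huv hL.le)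
    funext i
    have h := habs i
    simp only [cellIdx] at h ⊢
    by_cases hq : p i ≤ q i
    · have hr := (hs i).1 hq
      rw [abs_of_nonneg (sub_nonneg.2 (hmono hr)), abs_of_nonneg (sub_nonneg.2 (hmono hq))] at h
      omega
    · have hr : r i < p i := not_le.1 fun h => hq ((hs i).2 h)
      push Not at hq
      rw [abs_of_nonpos (sub_nonpos.2 (hmono hr.le)),
        abs_of_nonpos (sub_nonpos.2 (hmono hq.le))] at h
      omega
  · refine absurd (dist_lt_of_abs_cellIdx_lt hL hs fun i => ?_) hd.symm.not_lt
    fin_cases i <;> simp <;> omega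

lemma abs_floor_sub_floor_le {u v L N : ℝ} (hL : 0 < L) (h₁ : u - v ≤ N) (h₂ : v - u ≤ N) :
    |⌊u / L⌋ - ⌊v / L⌋| ≤ ⌊N / L⌋ + 1 := by
  have h : ∀ {x y : ℝ}, x - y ≤ N → ⌊x / L⌋ - ⌊y / L⌋ ≤ ⌊N / L⌋ + 1 := by
    intro x y hxy
    have h1 : x / L ≤ y / L + N / L := by
      rw [← add_div]
      exact div_le_div_of_nonneg_right (by linarith) hL.le
    have h2 := Int.lt_floor_add_one (y / L)
    have h3 := Int.lt_floor_add_one (N / L)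
    have h4 := Int.floor_le (x / L)
    have : (⌊x / L⌋ : ℝ) < ((⌊y / L⌋ + ⌊N / L⌋ + 2 : ℤ) : ℝ) := by push_cast; linarith
    have := Int.cast_lt.1 this
    omega
  rw [abs_le]
  constructor <;> linarith [h h₁, h h₂]

lemma card_image_cellKey_le {L N : ℝ} (hL : 0 < L) (hN : 0 ≤ N) {S : Finset (Pt 3)} {p : Pt 3} (hp : ∀ q ∈ S, ∀ i, q i - p i ≤ N ∧ p i - q i ≤ N) :
    (#(S.image (cellKey L p)) : ℝ) ≤ #(S.image (dist p)) * (8 * (2 * (N / L) + 3) ^ 2) := by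
  set I := Icc (-(⌊N / L⌋ + 1)) (⌊N / L⌋ + 1) with hI
  have h0 : 0 ≤ ⌊N / L⌋ := Int.floor_nonneg.2 (by positivity)
  have hIc : (#I : ℝ) ≤ 2 * (N / L) + 3 := by
    have h1 : (#I : ℤ) = 2 * ⌊N / L⌋ + 3 := by
      rw [hI, Int.card_Icc]
      omega
    have h2 : (#I : ℝ) = 2 * ⌊N / L⌋ + 3 := by exact_mod_cast h1
    linarith [Int.floor_le (N / L)]
  have hsub : S.image (cellKey L p) ⊆
      S.image (dist p) ×ˢ (univ : Finset (Fin 3 → Bool)) ×ˢ I ×ˢ I := by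
    intro z hz
    obtain ⟨q, hq, rfl⟩ := mem_image.1 hz
    have hb : ∀ i, |cellIdx L q i - cellIdx L p i| ≤ ⌊N / L⌋ + 1 := fun i =>
      abs_floor_sub_floor_le hL (hp q hq i).1 (hp q hq i).2
    have hn : ∀ i, 0 ≤ |cellIdx L q i - cellIdx L p i| := fun i => abs_nonneg _
    simp only [cellKey, mem_product, mem_univ, true_and, hI, mem_Icc]
    exact ⟨mem_image_of_mem _ hq, by constructor <;> linarith [hb 0, hb 2, hn 0, hn 2],
      by constructor <;> linarith [hb 1, hb 2, hn 1, hn 2]⟩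
  have hc := card_le_card hsub
  rw [card_product, card_product, card_product] at hc
  have hc' : (#(S.image (cellKey L p)) : ℝ) ≤ #(S.image (dist p)) * (8 * (#I * #I)) := by
    have : #(univ : Finset (Fin 3 → Bool)) = 8 := by simp
    rw [this] at hc
    exact_mod_cast hc
  refine hc'.trans ?_
  rw [sq]
  gcongr

/-- Pairs of points of `P` in a common cell, equidistant from `p`, whose bisector contains few
points of `P`. -/
def poorPairs (P : Finset (Pt 3)) (L m : ℝ) (p : Pt 3) : Finset (Pt 3 × Pt 3) :=
  {x ∈ P ×ˢ P | cellIdx L x.2 = cellIdx L x.1 ∧ (#(flatPart P (perpBisector x.1 x.2)) : ℝ) ≤ m ∧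
    dist p x.1 = dist p x.2}

lemma sum_card_poorPairs_le (hP : WellSeparated b P) {L m : ℝ} (hL : 0 < L) (hm : 0 ≤ m) :
    (∑ p ∈ P, #(poorPairs P L m p) : ℝ) ≤ #P * ((L + 2) ^ 3 * b) * m := by
  set X : Finset (Pt 3 × Pt 3) := {x ∈ P ×ˢ P | cellIdx L x.2 = cellIdx L x.1 ∧
    (#(flatPart P (perpBisector x.1 x.2)) : ℝ) ≤ m} with hX
  have hb : 0 ≤ b := (Nat.cast_nonneg _).trans (hP 0)
  have hXc : (#X : ℝ) ≤ #P * ((L + 2) ^ 3 * b) := by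
    refine (card_le_card_image_mul X Prod.fst _ fun x hx => ?_).trans
      (mul_le_mul_of_nonneg_right (Nat.cast_le.2 (card_le_card fun q hq => ?_)) (by positivity))
    · refine le_trans (Nat.cast_le.2 (card_le_card_of_injOn Prod.snd (fun y hy => ?_)
        fun y hy z hz hyz => ?_)) (hP.card_cellPart_le hL x.1)
      · rw [Finset.mem_coe, mem_filter, hX, mem_filter, mem_product] at hy
        rw [Finset.mem_coe, mem_cellPart, ← hy.2]
        exact ⟨hy.1.1.2, hy.1.2.1⟩
      · rw [Finset.mem_coe, mem_filter] at hy hz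
        exact Prod.ext (hy.2.trans hz.2.symm) hyz
    · obtain ⟨x, hx, rfl⟩ := mem_image.1 hq
      exact (mem_product.1 (mem_filter.1 hx).1).1
  have hswap : ∑ p ∈ P, #(poorPairs P L m p) = ∑ x ∈ X, #{p ∈ P | dist p x.1 = dist p x.2} := by
    refine Eq.trans ?_ (sum_card_bipartiteAbove_eq_sum_card_bipartiteBelow
      (fun (p : Pt 3) (x : Pt 3 × Pt 3) => dist p x.1 = dist p x.2))
    refine sum_congr rfl fun p _ => congrArg card ?_
    ext x
    simp only [poorPairs, bipartiteAbove, hX, mem_filter, and_assoc]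
  have hswap' : (∑ p ∈ P, #(poorPairs P L m p) : ℝ) =
      ∑ x ∈ X, (#{p ∈ P | dist p x.1 = dist p x.2} : ℝ) := by exact_mod_cast hswap
  rw [hswap']
  refine (sum_le_card_nsmul _ _ m fun x hx => ?_).trans ?_
  · refine le_trans (Nat.cast_le.2 (card_le_card fun p hp => ?_)) (mem_filter.1 hx).2.2
    rw [mem_filter] at hp
    exact mem_flatPart.2 ⟨hp.1, mem_perpBisector_iff_dist_eq.2 hp.2⟩
  · rw [nsmul_eq_mul]
    gcongr

/-- Points `q` of `P` on a plane through `p` spanned by points of `P` near `q`. -/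
def spanPts (P : Finset (Pt 3)) (σ : ℝ) (p : Pt 3) : Finset (Pt 3) :=
  {q ∈ P | ∃ g : AffineSubspace ℝ (Pt 3), IsKFlat 2 g ∧ p ∈ g ∧ q ∈ g ∧
    ∃ r ∈ cellPart σ P q, ∃ s ∈ cellPart σ P q, r ∈ g ∧ s ∈ g ∧ q ≠ r ∧ s ∉ line[ℝ, q, r]}

lemma sum_card_spanPts_le (hP : WellSeparated b P) {σ N : ℝ} (hσ : 0 < σ) (hN : 0 ≤ N)
    (hsp : CoordSpread P N) :
    (∑ p ∈ P, #(spanPts P σ p) : ℝ) ≤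
      #P * (((σ + 2) ^ 3 * b) ^ 2 * ((N + 2) ^ 2 * 4 * b)) := by
  have hb : 0 ≤ b := (Nat.cast_nonneg _).trans (hP 0)
  have hswap : (∑ p ∈ P, #(spanPts P σ p) : ℝ) = ∑ q ∈ P, (#{p ∈ P | q ∈ spanPts P σ p} : ℝ) := by
    have := sum_card_bipartiteAbove_eq_sum_card_bipartiteBelow (s := P) (t := P)
      (fun p q => q ∈ spanPts P σ p)
    have h' : ∀ p, bipartiteAbove (fun p q => q ∈ spanPts P σ p) P p = spanPts P σ p := by
      intro p
      ext q
      simp only [bipartiteAbove, mem_filter, and_iff_right_iff_imp]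
      exact fun h => (mem_filter.1 h).1
    simp only [h'] at this
    exact_mod_cast this
  rw [hswap, ← nsmul_eq_mul]
  refine sum_le_card_nsmul _ _ _ fun q hq => ?_
  let F : Pt 3 × Pt 3 → Finset (Pt 3) := fun y => {p ∈ P | q ≠ y.1 ∧ y.2 ∉ line[ℝ, q, y.1] ∧
    ∃ g : AffineSubspace ℝ (Pt 3), IsKFlat 2 g ∧ p ∈ g ∧ q ∈ g ∧ y.1 ∈ g ∧ y.2 ∈ g}
  have hsub : {p ∈ P | q ∈ spanPts P σ p} ⊆ (cellPart σ P q ×ˢ cellPart σ P q).biUnion F := by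
    intro p hp
    obtain ⟨hpP, hp⟩ := mem_filter.1 hp
    obtain ⟨-, g, hg, hpg, hqg, r, hr, s, hs, hrg, hsg, hqr, hline⟩ := mem_filter.1 hp
    exact mem_biUnion.2 ⟨(r, s), mem_product.2 ⟨hr, hs⟩,
      mem_filter.2 ⟨hpP, hqr, hline, g, hg, hpg, hqg, hrg, hsg⟩⟩
  have hF : ∀ y, (#(F y) : ℝ) ≤ (N + 2) ^ 2 * 4 * b := by
    intro y
    rcases (F y).eq_empty_or_nonempty with h0 | ⟨p₀, hp₀⟩
    · rw [h0, card_empty, Nat.cast_zero]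
      positivity
    obtain ⟨-, hqy, hline, g, hg, -, hqg, hrg, hsg⟩ := mem_filter.1 hp₀
    refine hP.card_le_of_subset_plane hg (filter_subset _ _) (fun p hp => ?_) hN
      (hsp.mono (filter_subset _ _))
    obtain ⟨-, -, -, g', hg', hpg', hqg', hrg', hsg'⟩ := mem_filter.1 hp
    rwa [hg.eq_of_mem hg' hqy hline hqg hrg hsg hqg' hrg' hsg']
  have h1 := (Nat.cast_le (α := ℝ)).2 ((card_le_card hsub).trans card_biUnion_le)
  push_cast at h1
  refine h1.trans ((sum_le_card_nsmul _ _ _ fun y _ => hF y).trans ?_)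
  rw [nsmul_eq_mul, card_product]
  push_cast
  rw [← sq]
  have := hP.card_cellPart_le hσ q
  gcongr

/-- The bisectors of pairs of points of `P` containing more than `m` points of `P`. -/
def richBisectors (P : Finset (Pt 3)) (m : ℝ) : Finset (AffineSubspace ℝ (Pt 3)) :=
  {h ∈ P.offDiag.image fun x => perpBisector x.1 x.2 | m < #(flatPart P h)}

lemma isKFlat_of_mem_richBisectors {m : ℝ} {h : AffineSubspace ℝ (Pt 3)}
    (hh : h ∈ richBisectors P m) : IsKFlat 2 h := by
  obtain ⟨x, hx, rfl⟩ := mem_image.1 (mem_filter.1 hh).1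
  exact isKFlat_two_perpBisector (mem_offDiag.1 hx).2.2

/-- Points of `P` that are not involved in a degenerate configuration seen from `p`. -/
def genericPts (P : Finset (Pt 3)) (L m σ : ℝ) (p : Pt 3) : Finset (Pt 3) :=
  {q ∈ P | q ≠ p ∧ q ∉ spanPts P σ p ∧ ∀ r ∈ P, (q, r) ∉ poorPairs P L m p}

lemma card_le_card_genericPts_add (L m σ : ℝ) (p : Pt 3) :
    #P ≤ #(genericPts P L m σ p) + (1 + (#(spanPts P σ p) + #(poorPairs P L m p))) := by
  have hsub : P ⊆ genericPts P L m σ p ∪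
      ({p} ∪ (spanPts P σ p ∪ (poorPairs P L m p).image Prod.fst)) := by
    intro q hq
    simp only [genericPts, mem_union, mem_filter, mem_singleton, hq, true_and, mem_image]
    by_contra! hcon
    obtain ⟨h1, h2, h3, h4⟩ := hcon
    obtain ⟨r, -, hr⟩ := h1 h2 h3
    exact h4 _ hr rfl
  refine (card_le_card hsub).trans ((card_union_le _ _).trans (Nat.add_le_add_left ?_ _))
  refine (card_union_le _ _).trans (Nat.add_le_add (card_singleton p).le ?_)
  exact (card_union_le _ _).trans (Nat.add_le_add_left card_image_le _)

/-- Points of `G` forming with two further points of `G` in the same cell a triple of points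
equidistant from `p`. -/
def triplePts (G : Finset (Pt 3)) (L : ℝ) (p : Pt 3) : Finset (Pt 3) :=
  {q ∈ G | ∃ r ∈ G, ∃ s ∈ G, q ≠ r ∧ r ≠ s ∧ s ≠ q ∧ cellIdx L q = cellIdx L r ∧
    cellIdx L r = cellIdx L s ∧ dist p q = dist p r ∧ dist p r = dist p s}

lemma card_le_card_triplePts_add {L : ℝ} (hL : 0 < L) (G : Finset (Pt 3)) (p : Pt 3) :
    (#G : ℝ) ≤ #(triplePts G L p) + #(G.image (cellKey L p)) * 2 := by
  set T := {q ∈ G | q ∉ triplePts G L p} with hT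
  have h1 : (#T : ℝ) ≤ #(T.image (cellKey L p)) * 2 := by
    refine card_le_card_image_mul T _ 2 fun q hq => ?_
    by_contra! hcon
    have hcon' : 2 < #{y ∈ T | cellKey L p y = cellKey L p q} := by exact_mod_cast hcon
    have hmem : q ∈ ({y ∈ T | cellKey L p y = cellKey L p q} : Finset (Pt 3)) :=
      mem_filter.2 ⟨hq, rfl⟩
    have herase : 1 < #(({y ∈ T | cellKey L p y = cellKey L p q} : Finset (Pt 3)).erase q) := by
      rw [card_erase_of_mem hmem]
      omega
    obtain ⟨r, hr, s, hs, hrs⟩ := one_lt_card.1 herase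
    rw [mem_erase, mem_filter] at hr hs
    obtain ⟨hrd, hrc⟩ := cellIdx_eq_of_cellKey_eq hL hr.2.2
    obtain ⟨hsd, hsc⟩ := cellIdx_eq_of_cellKey_eq hL hs.2.2
    rw [hT, mem_filter] at hq hr hs
    exact hq.2 (mem_filter.2 ⟨hq.1, r, hr.2.1.1, s, hs.2.1.1, hr.1.symm, hrs, hs.1, hrc.symm,
      hrc.trans hsc.symm, hrd.symm, hrd.trans hsd.symm⟩)
  have h2 : (#(T.image (cellKey L p)) : ℝ) ≤ #(G.image (cellKey L p)) :=
    Nat.cast_le.2 (card_le_card (image_subset_image (filter_subset _ _)))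
  have h3 : (#{q ∈ G | q ∈ triplePts G L p} : ℝ) + #T = #G := by
    exact_mod_cast card_filter_add_card_filter_not _
  have h4 : (#{q ∈ G | q ∈ triplePts G L p} : ℝ) ≤ #(triplePts G L p) :=
    Nat.cast_le.2 (card_le_card fun q hq => (mem_filter.1 hq).2)
  linarith

lemma cellIdx_midpoint {L : ℝ} {q r : Pt 3} (h : cellIdx L q = cellIdx L r) :
    cellIdx L (midpoint ℝ q r) = cellIdx L q := by
  funext i
  have hi : ⌊q i / L⌋ = ⌊r i / L⌋ := congrFun h i
  have hm : (midpoint ℝ q r : Pt 3) i / L = (q i / L + r i / L) / 2 := by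
    rw [midpoint_eq_smul_add]
    simp
    ring
  change ⌊(midpoint ℝ q r : Pt 3) i / L⌋ = ⌊q i / L⌋
  rw [hm, Int.floor_eq_iff]
  have h1 := Int.floor_le (q i / L)
  have h2 := Int.lt_floor_add_one (q i / L)
  have h3 := Int.floor_le (r i / L)
  have h4 := Int.lt_floor_add_one (r i / L)
  rw [← hi] at h3 h4
  constructor <;> linarith

lemma card_le_of_disjoint_spanPts (hP : WellSeparated b P) {σ L : ℝ} (hσ : 0 < σ) (hL : 0 ≤ L)
    {p : Pt 3} {g : AffineSubspace ℝ (Pt 3)} (hg : IsKFlat 2 g) (hpg : p ∈ g) {S : Finset (Pt 3)}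
    (hSP : S ⊆ P) (hSg : ∀ x ∈ S, x ∈ g) (hsp : CoordSpread S L)
    (hspan : ∀ x ∈ S, x ∉ spanPts P σ p) :
    (#S : ℝ) ≤ (L / σ + 2) ^ 2 * 4 * ((σ + 2) * b) := by
  have hb : 0 ≤ b := (Nat.cast_nonneg _).trans (hP 0)
  refine (card_le_card_image_mul S (cellIdx σ) ((σ + 2) * b) fun x hx => ?_).trans
    (mul_le_mul_of_nonneg_right (hg.card_image_cellIdx_le hSg hσ hL hsp) (by positivity))
  have hspread : CoordSpread {y ∈ S | cellIdx σ y = cellIdx σ x} σ :=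
    coordSpread_of_cellIdx_eq hσ fun y hy => (mem_filter.1 hy).2
  have hpart : ∀ y ∈ ({y ∈ S | cellIdx σ y = cellIdx σ x} : Finset (Pt 3)),
      y ∈ cellPart σ P x := fun y hy =>
    mem_cellPart.2 ⟨hSP (mem_filter.1 hy).1, (mem_filter.1 hy).2⟩
  obtain ⟨r, hr⟩ : ∃ r, ∀ y ∈ ({y ∈ S | cellIdx σ y = cellIdx σ x} : Finset (Pt 3)),
      y ∈ line[ℝ, x, r] := by
    by_cases h : ∃ r ∈ ({y ∈ S | cellIdx σ y = cellIdx σ x} : Finset (Pt 3)), x ≠ r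
    · obtain ⟨r, hr, hxr⟩ := h
      refine ⟨r, fun y hy => ?_⟩
      by_contra hline
      exact hspan x hx (mem_filter.2 ⟨hSP hx, g, hg, hpg, hSg x hx, r, hpart r hr, y, hpart y hy,
        hSg r (mem_filter.1 hr).1, hSg y (mem_filter.1 hy).1, hxr, hline⟩)
    · push Not at h
      refine ⟨x, fun y hy => ?_⟩
      rw [← h y hy]
      exact left_mem_affineSpan_pair ℝ _ _
  exact hP.card_le_of_subset_line ((filter_subset _ _).trans hSP) hσ.le hspread hr

/-- The planes of `𝓗` meeting the cell `c`. -/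
def cellPlanes (𝓗 : Finset (AffineSubspace ℝ (Pt 3))) (L : ℝ) (c : Fin 3 → ℤ) :
    Finset (AffineSubspace ℝ (Pt 3)) :=
  {h ∈ 𝓗 | ∃ x ∈ h, cellIdx L x = c}

lemma perpBisector_mem_cellPlanes {L m σ : ℝ} {p q r : Pt 3}
    (hq : q ∈ genericPts P L m σ p) (hr : r ∈ genericPts P L m σ p) (hqr : q ≠ r)
    (hc : cellIdx L q = cellIdx L r) (hd : dist p q = dist p r) :
    perpBisector q r ∈ cellPlanes {h ∈ richBisectors P m | p ∈ h} L (cellIdx L q) := by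
  obtain ⟨hqP, -, -, hpoor⟩ := mem_filter.1 hq
  have hrP := (mem_filter.1 hr).1
  refine mem_filter.2 ⟨mem_filter.2 ⟨mem_filter.2 ⟨mem_image.2
    ⟨(q, r), mem_offDiag.2 ⟨hqP, hrP, hqr⟩, rfl⟩, ?_⟩, mem_perpBisector_iff_dist_eq.2 hd⟩,
    midpoint ℝ q r, midpoint_mem_perpBisector q r, cellIdx_midpoint hc⟩
  by_contra! hcon
  exact hpoor r hrP (mem_filter.2 ⟨mem_product.2 ⟨hqP, hrP⟩, hc.symm, hcon, hd⟩)

lemma card_cell_triplePts_le (hP : WellSeparated b P) {L m σ : ℝ} (hL : 0 < L) (hσ : 0 < σ)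
    (p : Pt 3) (c : Fin 3 → ℤ) :
    (#{q ∈ triplePts (genericPts P L m σ p) L p | cellIdx L q = c} : ℝ) ≤
      (#(cellPlanes {h ∈ richBisectors P m | p ∈ h} L c) : ℝ) ^ 3 *
        ((L / σ + 2) ^ 2 * 4 * ((σ + 2) * b)) := by
  set K := cellPlanes {h ∈ richBisectors P m | p ∈ h} L c with hK
  set T := {q ∈ triplePts (genericPts P L m σ p) L p | cellIdx L q = c} with hT
  have hTP : T ⊆ P := (filter_subset _ _).trans ((filter_subset _ _).trans (filter_subset _ _))
  have hb : 0 ≤ b := (Nat.cast_nonneg _).trans (hP 0)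
  have hKflat : ∀ h ∈ K, IsKFlat 2 h := fun h hh =>
    isKFlat_of_mem_richBisectors (mem_filter.1 (mem_filter.1 hh).1).1
  have hex : ∀ q : Pt 3, ∃ y : Pt 3 × Pt 3, q ∈ T → dist p q = dist p y.1 ∧
      dist p y.1 = dist p y.2 ∧ perpBisector q y.1 ∈ K ∧ perpBisector y.1 y.2 ∈ K ∧
        perpBisector y.2 q ∈ K := by
    intro q
    by_cases hq : q ∈ T
    · obtain ⟨hq1, rfl⟩ := mem_filter.1 hq
      obtain ⟨hqG, r, hr, s, hs, hqr, hrs, hsq, hc1, hc2, hd1, hd2⟩ := mem_filter.1 hq1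
      refine ⟨(r, s), fun _ => ⟨hd1, hd2, perpBisector_mem_cellPlanes hqG hr hqr hc1 hd1, ?_, ?_⟩⟩
      · rw [hK, hc1]
        exact perpBisector_mem_cellPlanes hr hs hrs hc2 hd2
      · rw [hK, hc1, hc2]
        exact perpBisector_mem_cellPlanes hs hqG hsq (hc1.trans hc2).symm (hd1.trans hd2).symm
    · exact ⟨(q, q), fun h => absurd h hq⟩
  choose y hy using hex
  let f : Pt 3 → AffineSubspace ℝ (Pt 3) × AffineSubspace ℝ (Pt 3) × AffineSubspace ℝ (Pt 3) :=
    fun q => (perpBisector q (y q).1, perpBisector (y q).1 (y q).2, perpBisector (y q).2 q)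
  refine (card_le_card_image_mul T f _ fun q hq => ?_).trans
    (mul_le_mul_of_nonneg_right (b := (#(T.image f) : ℝ)) ?_ (by positivity))
  · obtain ⟨-, -, h1, h2, h3⟩ := hy q hq
    obtain ⟨g, hg, hpg, hgm⟩ := exists_plane_of_triangle p (hKflat _ h1) (hKflat _ h2) (hKflat _ h3)
    refine card_le_of_disjoint_spanPts hP hσ hL.le hg hpg ((filter_subset _ _).trans hTP)
      (fun x hx => ?_) ?_ fun x hx => ?_
    · obtain ⟨hxT, hxf⟩ := mem_filter.1 hx
      simp only [f, Prod.mk.injEq] at hxf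
      obtain ⟨hd1, hd2, -⟩ := hy x hxT
      exact hgm x (y x).1 (y x).2 hd1 hd2 hxf.1 hxf.2.1 hxf.2.2
    · exact coordSpread_of_cellIdx_eq hL fun x hx => (mem_filter.1 (mem_filter.1 hx).1).2
    · exact (mem_filter.1 (mem_filter.1 (mem_filter.1 (mem_filter.1 hx).1).1).1).2.2.1
  · have hsub : T.image f ⊆ K ×ˢ K ×ˢ K := by
      intro z hz
      obtain ⟨q, hq, rfl⟩ := mem_image.1 hz
      obtain ⟨-, -, h1, h2, h3⟩ := hy q hq
      exact mem_product.2 ⟨h1, mem_product.2 ⟨h2, h3⟩⟩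
    have := card_le_card hsub
    rw [card_product, card_product] at this
    calc (#(T.image f) : ℝ) ≤ #K * (#K * #K) := by exact_mod_cast this
      _ = _ := by ring

lemma IsKFlat.card_visited_cells_le {h : AffineSubspace ℝ (Pt 3)} (hh : IsKFlat 2 h) {L N : ℝ}
    (hL : 0 < L) (hN : 0 ≤ N) {S : Finset (Pt 3)} (hsp : CoordSpread S N) :
    (#{c ∈ S.image (cellIdx L) | ∃ x ∈ h, cellIdx L x = c} : ℝ) ≤
      ((N + 2 * L) / L + 2) ^ 2 * 4 := by
  set C := {c ∈ S.image (cellIdx L) | ∃ x ∈ h, cellIdx L x = c} with hC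
  have hex : ∀ c : Fin 3 → ℤ, ∃ x : Pt 3, c ∈ C → x ∈ h ∧ cellIdx L x = c := by
    intro c
    by_cases hc : c ∈ C
    · obtain ⟨x, hx⟩ := (mem_filter.1 hc).2
      exact ⟨x, fun _ => hx⟩
    · exact ⟨0, fun h => absurd h hc⟩
  choose x hx using hex
  have himg : (C.image x).image (cellIdx L) = C := by
    rw [image_image]
    refine (image_congr fun c hc => ?_).trans image_id
    exact (hx c hc).2
  rw [← himg]
  refine hh.card_image_cellIdx_le (fun y hy => ?_) hL (by positivity) fun y hy z hz i => ?_
  · obtain ⟨c, hc, rfl⟩ := mem_image.1 hy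
    exact (hx c hc).1
  · obtain ⟨c, hc, rfl⟩ := mem_image.1 hy
    obtain ⟨d, hd, rfl⟩ := mem_image.1 hz
    obtain ⟨q, hq, hqc⟩ := mem_image.1 (mem_filter.1 hc).1
    obtain ⟨r, hr, hrd⟩ := mem_image.1 (mem_filter.1 hd).1
    have h1 := sub_lt_of_cellIdx_eq hL ((hx c hc).2.trans hqc.symm) i
    have h2 := sub_lt_of_cellIdx_eq hL (hrd.trans (hx d hd).2.symm) i
    linarith [hsp q hq r hr i]

lemma card_triplePts_le (hP : WellSeparated b P) {L m σ N E : ℝ} (hL : 0 < L) (hσ : 0 < σ)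
    (hN : 0 ≤ N) (hE : 0 ≤ E) (hsp : CoordSpread P N) (p : Pt 3)
    (hE3 : ((L + 2) ^ 3 * b) ^ 2 * ((L / σ + 2) ^ 2 * 4 * ((σ + 2) * b)) ≤ E ^ 3) :
    (#(triplePts (genericPts P L m σ p) L p) : ℝ) ≤
      E * (#{h ∈ richBisectors P m | p ∈ h} * (((N + 2 * L) / L + 2) ^ 2 * 4)) := by
  set 𝓗 := {h ∈ richBisectors P m | p ∈ h} with h𝓗
  set T := triplePts (genericPts P L m σ p) L p with hT
  have hTP : T ⊆ P := (filter_subset _ _).trans (filter_subset _ _)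
  have hcell : ∀ c, (#{q ∈ T | cellIdx L q = c} : ℝ) ≤ E * #(cellPlanes 𝓗 L c) := by
    intro c
    have h1 := card_cell_triplePts_le hP (m := m) hL hσ p c
    have h2 : (#{q ∈ T | cellIdx L q = c} : ℝ) ≤ (L + 2) ^ 3 * b :=
      hP.card_le_of_coordSpread ((filter_subset _ _).trans hTP) hL.le
        (coordSpread_of_cellIdx_eq hL fun x hx => (mem_filter.1 hx).2)
    refine le_of_pow_le_pow_left₀ three_ne_zero (by positivity) ?_
    calc (#{q ∈ T | cellIdx L q = c} : ℝ) ^ 3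
        = (#{q ∈ T | cellIdx L q = c} : ℝ) ^ 2 * #{q ∈ T | cellIdx L q = c} := by ring
      _ ≤ ((L + 2) ^ 3 * b) ^ 2 * ((#(cellPlanes 𝓗 L c) : ℝ) ^ 3 *
          ((L / σ + 2) ^ 2 * 4 * ((σ + 2) * b))) := by gcongr
      _ = ((L + 2) ^ 3 * b) ^ 2 * ((L / σ + 2) ^ 2 * 4 * ((σ + 2) * b)) *
          (#(cellPlanes 𝓗 L c) : ℝ) ^ 3 := by ring
      _ ≤ E ^ 3 * (#(cellPlanes 𝓗 L c) : ℝ) ^ 3 := by gcongr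
      _ = _ := by ring
  have hswap : (∑ c ∈ T.image (cellIdx L), #(cellPlanes 𝓗 L c) : ℝ) ≤
      #𝓗 * (((N + 2 * L) / L + 2) ^ 2 * 4) := by
    have := sum_card_bipartiteAbove_eq_sum_card_bipartiteBelow (s := T.image (cellIdx L)) (t := 𝓗)
      (fun c h => ∃ x ∈ h, cellIdx L x = c)
    have h1 : (∑ c ∈ T.image (cellIdx L), #(cellPlanes 𝓗 L c) : ℝ) =
        ∑ h ∈ 𝓗, (#{c ∈ T.image (cellIdx L) | ∃ x ∈ h, cellIdx L x = c} : ℝ) := by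
      exact_mod_cast this
    rw [h1, ← nsmul_eq_mul]
    refine sum_le_card_nsmul _ _ _ fun h hh => ?_
    exact (isKFlat_of_mem_richBisectors (mem_filter.1 hh).1).card_visited_cells_le hL hN
      (hsp.mono hTP)
  rw [card_eq_sum_card_image (cellIdx L) T]
  push_cast
  calc (∑ c ∈ T.image (cellIdx L), (#{q ∈ T | cellIdx L q = c} : ℝ))
      ≤ ∑ c ∈ T.image (cellIdx L), E * (#(cellPlanes 𝓗 L c) : ℝ) := sum_le_sum fun c _ => hcell c
    _ ≤ _ := by
      rw [← mul_sum]
      gcongr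

lemma exists_le_of_three_averages {α : Type*} {S : Finset α} (hS : S.Nonempty) {f g h : α → ℝ}
    (hf : ∀ x ∈ S, 0 ≤ f x) (hg : ∀ x ∈ S, 0 ≤ g x) (hh : ∀ x ∈ S, 0 ≤ h x) {A B C : ℝ}
    (hA : 0 < A) (hB : 0 < B) (hC : 0 < C) (hfA : ∑ x ∈ S, f x ≤ #S * A)
    (hgB : ∑ x ∈ S, g x ≤ #S * B) (hhC : ∑ x ∈ S, h x ≤ #S * C) :
    ∃ x ∈ S, f x ≤ 3 * A ∧ g x ≤ 3 * B ∧ h x ≤ 3 * C := by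
  have hsum : ∑ x ∈ S, (f x / A + g x / B + h x / C) ≤ ∑ _x ∈ S, 3 := by
    rw [sum_add_distrib, sum_add_distrib, ← sum_div, ← sum_div, ← sum_div, sum_const, nsmul_eq_mul]
    have h1 := (div_le_iff₀ hA).2 hfA
    have h2 := (div_le_iff₀ hB).2 hgB
    have h3 := (div_le_iff₀ hC).2 hhC
    linarith
  obtain ⟨x, hx, hle⟩ := exists_le_of_sum_le hS hsum
  have h1 := div_nonneg (hf x hx) hA.le
  have h2 := div_nonneg (hg x hx) hB.le
  have h3 := div_nonneg (hh x hx) hC.le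
  exact ⟨x, hx, (div_le_iff₀ hA).1 (by linarith), (div_le_iff₀ hB).1 (by linarith),
    (div_le_iff₀ hC).1 (by linarith)⟩

lemma card_le_of_few_distances (hP : WellSeparated b P) (hne : P.Nonempty)
    {N L m σ s₀ σ₁ σ₂ w₁ w₂ δ E t X : ℝ} (hN : 0 ≤ N) (hsp : CoordSpread P N) (hL : 0 < L)
    (hm : 0 < m) (hσ : 0 < σ) (hE : 0 ≤ E) (hs₀ : 0 < s₀) (hσ₁ : 0 < σ₁) (hσ₂ : 0 < σ₂)
    (hδ : 0 < δ) (hw₁ : 0 < w₁) (hw₂ : 0 < w₂) (hb : 0 < b) (hX₀ : 0 < X)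
    (hm₀ : (N / s₀ + 2) ^ 2 * 4 * 2 ≤ m / 6) (hm₁ : (N / σ₁ + 2) ^ 2 * 4 * w₁ ≤ m / 6)
    (hm₂ : (N / σ₂ + 2) ^ 2 * 4 * w₂ ≤ m / 6)
    (hline₁ : σ₁ / δ + 2 ≤ w₁ / 4) (hline₂ : (σ₂ + 2) * b ≤ w₂ / 2)
    (hX : 2 * (((s₀ + 2) ^ 3 * b) * ((σ₁ + 2) ^ 3 * b) / (w₁ / 2) +
        2 * ((2 * δ + 2) ^ 3 * b) * ((σ₂ + 2) ^ 3 * b / (w₂ / 2))) ≤ X)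
    (hE3 : ((L + 2) ^ 3 * b) ^ 2 * ((L / σ + 2) ^ 2 * 4 * ((σ + 2) * b)) ≤ E ^ 3)
    (ht : ∀ p ∈ P, (#((P.erase p).image (dist p)) : ℝ) ≤ t) :
    (#P : ℝ) ≤ 1 + 3 * (((σ + 2) ^ 3 * b) ^ 2 * ((N + 2) ^ 2 * 4 * b)) +
      3 * ((L + 2) ^ 3 * b * m) + t * (8 * (2 * (N / L) + 3) ^ 2) * 2 +
      E * (3 * X * (((N + 2 * L) / L + 2) ^ 2 * 4)) := by
  have hincid : ∑ p ∈ P, (#{h ∈ richBisectors P m | p ∈ h} : ℝ) ≤ #P * X := by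
    have h1 : ∑ p ∈ P, (#{h ∈ richBisectors P m | p ∈ h} : ℝ) =
        ∑ h ∈ richBisectors P m, (#(flatPart P h) : ℝ) := by
      exact_mod_cast sum_card_bipartiteAbove_eq_sum_card_bipartiteBelow (s := P)
        (t := richBisectors P m) (fun (p : Pt 3) (h : AffineSubspace ℝ (Pt 3)) => p ∈ h)
    rw [h1]
    refine (sum_card_flatPart_le hP (fun h => isKFlat_of_mem_richBisectors) hN hsp
      (fun h hh => (mem_filter.1 hh).2.le) hs₀ hσ₁ hσ₂ hδ hw₁ hw₂ hm₀ hm₁ hm₂ hline₁ hline₂).trans ?_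
    refine le_trans (le_of_eq ?_) (mul_le_mul_of_nonneg_left hX (Nat.cast_nonneg _))
    ring
  have hpoor := sum_card_poorPairs_le hP hL hm.le
  rw [mul_assoc] at hpoor
  obtain ⟨p, hp, hp1, hp2, hp3⟩ := exists_le_of_three_averages hne
    (fun _ _ => Nat.cast_nonneg _) (fun _ _ => Nat.cast_nonneg _) (fun _ _ => Nat.cast_nonneg _)
    (by positivity) (by positivity) hX₀ (sum_card_spanPts_le hP hσ hN hsp) hpoor hincid
  set G := genericPts P L m σ p with hG
  have h1 : (#P : ℝ) ≤ #G + (1 + (#(spanPts P σ p) + #(poorPairs P L m p))) := by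
    exact_mod_cast card_le_card_genericPts_add L m σ p
  have h2 := card_le_card_triplePts_add hL G p
  have hGP : G ⊆ P.erase p := fun q hq =>
    mem_erase.2 ⟨(mem_filter.1 hq).2.1, (mem_filter.1 hq).1⟩
  have h3 : (#(G.image (cellKey L p)) : ℝ) ≤ t * (8 * (2 * (N / L) + 3) ^ 2) := by
    refine (card_image_cellKey_le hL hN fun q hq i => ?_).trans
      (mul_le_mul_of_nonneg_right ?_ (by positivity))
    · have hqP := (mem_filter.1 hq).1
      exact ⟨hsp q hqP p hp i, hsp p hp q hqP i⟩
    · exact le_trans (Nat.cast_le.2 (card_le_card (image_subset_image hGP))) (ht p hp)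
  have h4 := card_triplePts_le hP (m := m) hL hσ hN hE hsp p hE3
  have h5 : E * (#{h ∈ richBisectors P m | p ∈ h} * (((N + 2 * L) / L + 2) ^ 2 * 4)) ≤
      E * (3 * X * (((N + 2 * L) / L + 2) ^ 2 * 4)) := by gcongr
  linarith

lemma sq_pow_div_add_two_le {Y c : ℝ} {k : ℕ} (hY : 1 ≤ Y) (hc : 0 < c) (hcY : 2 * c ≤ Y)
    (hk : k ≠ 0) : (Y ^ k / c + 2) ^ 2 ≤ 4 * Y ^ (2 * k) / c ^ 2 := by
  have h2 : 2 ≤ Y ^ k / c := by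
    rw [le_div_iff₀ hc]
    exact hcY.trans (le_self_pow₀ hY hk)
  have hY0 : 0 < Y := by linarith
  calc (Y ^ k / c + 2) ^ 2 ≤ (Y ^ k / c + Y ^ k / c) ^ 2 := by gcongr
    _ = 4 * Y ^ (2 * k) / c ^ 2 := by
      rw [pow_mul']
      ring

lemma cells_mul_two_le {Y c μ : ℝ} (hY : 1 ≤ Y) (hc1 : 1 ≤ c) (hcμ : c * μ = 200)
    (hcY : 2 * c ≤ Y) :
    (Y ^ 58 / (c * Y ^ 7) + 2) ^ 2 * 4 * 2 ≤ μ * Y ^ 102 / 6 := by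
  have hc : 0 < c := by linarith
  have hY0 : 0 < Y := by linarith
  have hcc : 1 ≤ c * (c * μ) / 192 := by rw [hcμ]; linarith
  have e : Y ^ 58 / (c * Y ^ 7) = Y ^ 51 / c := by field_simp
  rw [e]
  calc (Y ^ 51 / c + 2) ^ 2 * 4 * 2 ≤ 4 * Y ^ (2 * 51) / c ^ 2 * 4 * 2 := by
        gcongr
        exact sq_pow_div_add_two_le hY hc hcY (by norm_num)
    _ = 32 * Y ^ 102 / c ^ 2 := by ring
    _ ≤ μ * Y ^ 102 / 6 := by
        rw [div_le_iff₀ (by positivity)]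
        calc 32 * Y ^ 102 ≤ 32 * Y ^ 102 * (c * (c * μ) / 192) :=
              le_mul_of_one_le_right (by positivity) hcc
          _ = μ * Y ^ 102 / 6 * c ^ 2 := by ring

lemma cells_mul_pow_four_le {Y c μ : ℝ} (hY : 1 ≤ Y) (hc1 : 1 ≤ c) (hcμ : c * μ = 200)
    (hcY : 2 * c ≤ Y) :
    (Y ^ 58 / (c * Y ^ 9) + 2) ^ 2 * 4 * Y ^ 4 ≤ μ * Y ^ 102 / 6 := by
  have hc : 0 < c := by linarith
  have hY0 : 0 < Y := by linarith
  have hcc : 1 ≤ c * (c * μ) / 96 := by rw [hcμ]; linarith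
  have e : Y ^ 58 / (c * Y ^ 9) = Y ^ 49 / c := by field_simp
  rw [e]
  calc (Y ^ 49 / c + 2) ^ 2 * 4 * Y ^ 4 ≤ 4 * Y ^ (2 * 49) / c ^ 2 * 4 * Y ^ 4 := by
        gcongr
        exact sq_pow_div_add_two_le hY hc hcY (by norm_num)
    _ = 16 * Y ^ 102 / c ^ 2 := by ring
    _ ≤ μ * Y ^ 102 / 6 := by
        rw [div_le_iff₀ (by positivity)]
        calc 16 * Y ^ 102 ≤ 16 * Y ^ 102 * (c * (c * μ) / 96) :=
              le_mul_of_one_le_right (by positivity) hcc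
          _ = μ * Y ^ 102 / 6 * c ^ 2 := by ring

lemma cells_mul_pow_fourteen_le {Y c μ : ℝ} (hb : 0 < b) (hY : 1 ≤ Y) (hc : 0 < c) (hcμ : c * μ = 400 * b)
    (hcY : 2 * c ≤ Y) :
    (Y ^ 58 / (c * Y ^ 14) + 2) ^ 2 * 4 * (4 * b * c * Y ^ 14) ≤ μ * Y ^ 102 / 6 := by
  have hY0 : 0 < Y := by linarith
  have e : Y ^ 58 / (c * Y ^ 14) = Y ^ 44 / c := by field_simp
  rw [e]
  calc (Y ^ 44 / c + 2) ^ 2 * 4 * (4 * b * c * Y ^ 14)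
      ≤ 4 * Y ^ (2 * 44) / c ^ 2 * 4 * (4 * b * c * Y ^ 14) := by
        gcongr
        exact sq_pow_div_add_two_le hY hc hcY (by norm_num)
    _ = 64 * b * Y ^ 102 / c := by field_simp; ring
    _ ≤ 400 * b * Y ^ 102 / 6 / c := by
        gcongr
        linarith [show 0 < b * Y ^ 102 by positivity]
    _ = μ * Y ^ 102 / 6 := by
        rw [← hcμ]
        field_simp

lemma cell_energy_le {Y c₀ c₂ : ℝ} (hb : 1 ≤ b) (hY1 : 1 ≤ Y) (hc₀1 : 1 ≤ c₀) (hc₂1 : 1 ≤ c₂) :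
    2 * (((c₀ * Y ^ 7 + 2) ^ 3 * b) * ((c₀ * Y ^ 9 + 2) ^ 3 * b) / (Y ^ 4 / 2) +
      2 * ((2 * (8 * c₀ * Y ^ 5) + 2) ^ 3 * b) *
        ((c₂ * Y ^ 14 + 2) ^ 3 * b / (4 * b * c₂ * Y ^ 14 / 2))) ≤
      2 * (1458 * c₀ ^ 6 * b ^ 2 + 2 * (5832 * 54 * c₀ ^ 3 * c₂ ^ 3 * b ^ 2)) * Y ^ 44 := by
  have hY0 : 0 < Y := by linarith
  have hb0 : 0 < b := by linarith
  have hone : ∀ {c : ℝ} {k : ℕ}, 1 ≤ c → k ≠ 0 → 1 ≤ c * Y ^ k := by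
    intro c k hc hk
    exact one_le_mul_of_one_le_of_one_le hc (one_le_pow₀ hY1)
  have h1 : c₀ * Y ^ 7 + 2 ≤ 3 * c₀ * Y ^ 7 := by linarith [hone (k := 7) hc₀1 (by norm_num)]
  have h2 : c₀ * Y ^ 9 + 2 ≤ 3 * c₀ * Y ^ 9 := by linarith [hone (k := 9) hc₀1 (by norm_num)]
  have h3 : 2 * (8 * c₀ * Y ^ 5) + 2 ≤ 18 * c₀ * Y ^ 5 := by
    linarith [hone (k := 5) hc₀1 (by norm_num)]
  have h4 : c₂ * Y ^ 14 + 2 ≤ 3 * c₂ * Y ^ 14 := by linarith [hone (k := 14) hc₂1 (by norm_num)]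
  have h5 : Y ^ 14 ≤ 4 * b * c₂ * Y ^ 14 / 2 := by
    have : 1 ≤ b * c₂ := one_le_mul_of_one_le_of_one_le hb hc₂1
    calc Y ^ 14 ≤ b * c₂ * Y ^ 14 := le_mul_of_one_le_left (by positivity) this
      _ ≤ 4 * b * c₂ * Y ^ 14 / 2 := by linarith [show 0 < b * c₂ * Y ^ 14 by positivity]
  calc 2 * (((c₀ * Y ^ 7 + 2) ^ 3 * b) * ((c₀ * Y ^ 9 + 2) ^ 3 * b) / (Y ^ 4 / 2) +
      2 * ((2 * (8 * c₀ * Y ^ 5) + 2) ^ 3 * b) *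
        ((c₂ * Y ^ 14 + 2) ^ 3 * b / (4 * b * c₂ * Y ^ 14 / 2)))
      ≤ 2 * (((3 * c₀ * Y ^ 7) ^ 3 * b) * ((3 * c₀ * Y ^ 9) ^ 3 * b) / (Y ^ 4 / 2) +
        2 * ((18 * c₀ * Y ^ 5) ^ 3 * b) * ((3 * c₂ * Y ^ 14) ^ 3 * b / Y ^ 14)) := by gcongr
    _ = 2 * (1458 * c₀ ^ 6 * b ^ 2 * Y ^ 44 +
        5832 * 54 * c₀ ^ 3 * c₂ ^ 3 * b ^ 2 * Y ^ 43) := by field_simp; ring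
    _ ≤ 2 * (1458 * c₀ ^ 6 * b ^ 2 * Y ^ 44 +
        2 * (5832 * 54 * c₀ ^ 3 * c₂ ^ 3 * b ^ 2 * Y ^ 44)) := by
      have h6 : Y ^ 43 ≤ Y ^ 44 := pow_le_pow_right₀ hY1 (by norm_num)
      have h7 : 5832 * 54 * c₀ ^ 3 * c₂ ^ 3 * b ^ 2 * Y ^ 43 ≤
        5832 * 54 * c₀ ^ 3 * c₂ ^ 3 * b ^ 2 * Y ^ 44 := by gcongr
      have h8 : 0 ≤ 5832 * 54 * c₀ ^ 3 * c₂ ^ 3 * b ^ 2 * Y ^ 44 := by positivity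
      linarith
    _ = 2 * (1458 * c₀ ^ 6 * b ^ 2 + 2 * (5832 * 54 * c₀ ^ 3 * c₂ ^ 3 * b ^ 2)) * Y ^ 44 := by ring

lemma exists_point_many_distances (hb : 1 ≤ b) : ∃ Y₀ : ℝ, 1 ≤ Y₀ ∧ ∀ Y, Y₀ ≤ Y →
    ∀ P : Finset (Pt 3), WellSeparated b P → (#P : ℝ) = Y ^ 174 → CoordSpread P (Y ^ 58) →
      ∃ p ∈ P, Y ^ 106 ≤ (#((P.erase p).image (dist p)) : ℝ) := by
  have hb0 : 0 < b := by linarith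
  obtain ⟨μ, hμ⟩ : ∃ μ : ℝ, μ = 1 / (48 * 61 ^ 3 * b) := ⟨_, rfl⟩
  have hμ0 : 0 < μ := by rw [hμ]; positivity
  have hμb : 48 * 61 ^ 3 * b * μ = 1 := by rw [hμ]; field_simp
  have hμ1 : μ ≤ 1 := by nlinarith
  obtain ⟨c₀, hc₀⟩ : ∃ c₀ : ℝ, c₀ = 200 / μ := ⟨_, rfl⟩
  have hc₀μ : c₀ * μ = 200 := by rw [hc₀]; field_simp
  have hc₀1 : 1 ≤ c₀ := by nlinarith
  obtain ⟨c₂, hc₂⟩ : ∃ c₂ : ℝ, c₂ = 400 * b / μ := ⟨_, rfl⟩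
  have hc₂μ : c₂ * μ = 400 * b := by rw [hc₂]; field_simp
  have hc₂1 : 1 ≤ c₂ := by nlinarith
  obtain ⟨χ, hχ⟩ : ∃ χ : ℝ, χ = 2 * (1458 * c₀ ^ 6 * b ^ 2 +
    2 * (5832 * 54 * c₀ ^ 3 * c₂ ^ 3 * b ^ 2)) := ⟨_, rfl⟩
  have hχ0 : 0 < χ := by rw [hχ]; positivity
  refine ⟨2000 + 2 * c₀ + 2 * c₂ + 16 * 78732 * b ^ 3 + 24 * (10 ^ 6 * b) * χ, ?_, ?_⟩
  · have : 0 ≤ 2 * c₀ + 2 * c₂ + 16 * 78732 * b ^ 3 + 24 * (10 ^ 6 * b) * χ := by positivity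
    linarith
  intro Y hY P hP hcard hsp
  have t1 : 0 < 16 * 78732 * b ^ 3 := by positivity
  have t2 : 0 < 24 * (10 ^ 6 * b) * χ := by positivity
  have hY2000 : 2000 ≤ Y := by linarith
  have hYc₀ : 2 * c₀ ≤ Y := by linarith
  have hYc₂ : 2 * c₂ ≤ Y := by linarith
  have hYb : 16 * 78732 * b ^ 3 ≤ Y := by linarith
  have hYχ : 24 * (10 ^ 6 * b) * χ ≤ Y := by linarith
  clear hY t1 t2
  have hY1 : 1 ≤ Y := by linarith
  have hY0 : 0 < Y := by linarith
  have hpow : ∀ k : ℕ, k ≠ 0 → Y ≤ Y ^ k := fun k hk => le_self_pow₀ hY1 hk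
  by_contra! hfew
  have hne : P.Nonempty := by
    rw [← card_pos]
    have : (0 : ℝ) < #P := by rw [hcard]; positivity
    exact_mod_cast this
  have hm₀ := cells_mul_two_le hY1 hc₀1 hc₀μ hYc₀
  have hm₁ := cells_mul_pow_four_le hY1 hc₀1 hc₀μ hYc₀
  have hm₂ := cells_mul_pow_fourteen_le hb0 hY1 (by linarith) hc₂μ hYc₂
  have hline₁ : c₀ * Y ^ 9 / (8 * c₀ * Y ^ 5) + 2 ≤ Y ^ 4 / 4 := by
    have e : c₀ * Y ^ 9 / (8 * c₀ * Y ^ 5) = Y ^ 4 / 8 := by field_simp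
    rw [e]
    linarith [hpow 4 (by norm_num)]
  have hline₂ : (c₂ * Y ^ 14 + 2) * b ≤ 4 * b * c₂ * Y ^ 14 / 2 := by
    have h1 : Y ^ 14 ≤ c₂ * Y ^ 14 := le_mul_of_one_le_left (by positivity) hc₂1
    have h2 : 2 ≤ c₂ * Y ^ 14 := by linarith [hpow 14 (by norm_num)]
    calc (c₂ * Y ^ 14 + 2) * b ≤ (c₂ * Y ^ 14 + c₂ * Y ^ 14) * b := by gcongr
      _ = 4 * b * c₂ * Y ^ 14 / 2 := by ring
  have hX := cell_energy_le hb hY1 hc₀1 hc₂1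
  rw [← hχ] at hX
  have hY24 : 60 * Y ^ 24 + 2 ≤ 61 * Y ^ 24 := by linarith [hpow 24 (by norm_num)]
  have hY9 : Y ^ 9 + 2 ≤ 3 * Y ^ 9 := by linarith [hpow 9 (by norm_num)]
  have hE3 : ((60 * Y ^ 24 + 2) ^ 3 * b) ^ 2 *
      ((60 * Y ^ 24 / Y ^ 9 + 2) ^ 2 * 4 * ((Y ^ 9 + 2) * b)) ≤ (10 ^ 6 * b * Y ^ 61) ^ 3 := by
    have e : 60 * Y ^ 24 / Y ^ 9 = 60 * Y ^ 15 := by field_simp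
    have h1 : 60 * Y ^ 15 + 2 ≤ 61 * Y ^ 15 := by linarith [hpow 15 (by norm_num)]
    rw [e]
    calc ((60 * Y ^ 24 + 2) ^ 3 * b) ^ 2 * ((60 * Y ^ 15 + 2) ^ 2 * 4 * ((Y ^ 9 + 2) * b))
        ≤ ((61 * Y ^ 24) ^ 3 * b) ^ 2 * ((61 * Y ^ 15) ^ 2 * 4 * ((3 * Y ^ 9) * b)) := by gcongr
      _ = 61 ^ 8 * 12 * (b ^ 3 * Y ^ 183) := by ring
      _ ≤ 10 ^ 18 * (b ^ 3 * Y ^ 183) := by gcongr; norm_num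
      _ = _ := by ring
  have hmain := card_le_of_few_distances hP hne (N := Y ^ 58) (L := 60 * Y ^ 24) (m := μ * Y ^ 102)
    (σ := Y ^ 9) (s₀ := c₀ * Y ^ 7) (σ₁ := c₀ * Y ^ 9) (σ₂ := c₂ * Y ^ 14) (w₁ := Y ^ 4)
    (w₂ := 4 * b * c₂ * Y ^ 14) (δ := 8 * c₀ * Y ^ 5) (E := 10 ^ 6 * b * Y ^ 61) (t := Y ^ 106)
    (X := χ * Y ^ 44) (by positivity) hsp (by positivity) (by positivity) (by positivity)
    (by positivity) (by positivity) (by positivity) (by positivity) (by positivity)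
    (by positivity) (by positivity) hb0 (by positivity) hm₀ hm₁ hm₂ hline₁ hline₂ hX hE3
    fun p hp => (hfew p hp).le
  have b1 : 3 * (((Y ^ 9 + 2) ^ 3 * b) ^ 2 * ((Y ^ 58 + 2) ^ 2 * 4 * b)) ≤ Y ^ 174 / 16 := by
    have h1 : Y ^ 58 + 2 ≤ 3 * Y ^ 58 := by linarith [hpow 58 (by norm_num)]
    calc 3 * (((Y ^ 9 + 2) ^ 3 * b) ^ 2 * ((Y ^ 58 + 2) ^ 2 * 4 * b))
        ≤ 3 * (((3 * Y ^ 9) ^ 3 * b) ^ 2 * ((3 * Y ^ 58) ^ 2 * 4 * b)) := by gcongr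
      _ = (16 * 78732 * b ^ 3) * Y ^ 170 / 16 := by ring
      _ ≤ Y * Y ^ 170 / 16 := by gcongr
      _ = Y ^ 171 / 16 := by ring
      _ ≤ Y ^ 174 / 16 := by
        gcongr 1
        exact pow_le_pow_right₀ hY1 (by norm_num)
  have b2 : 3 * ((60 * Y ^ 24 + 2) ^ 3 * b * (μ * Y ^ 102)) ≤ Y ^ 174 / 16 := by
    calc 3 * ((60 * Y ^ 24 + 2) ^ 3 * b * (μ * Y ^ 102))
        ≤ 3 * ((61 * Y ^ 24) ^ 3 * b * (μ * Y ^ 102)) := by gcongr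
      _ = 48 * 61 ^ 3 * b * μ * Y ^ 174 / 16 := by ring
      _ = Y ^ 174 / 16 := by rw [hμb, one_mul]
  have e34 : Y ^ 58 / (60 * Y ^ 24) = Y ^ 34 / 60 := by field_simp
  have hY34 := hpow 34 (by norm_num)
  have b3 : Y ^ 106 * (8 * (2 * (Y ^ 58 / (60 * Y ^ 24)) + 3) ^ 2) * 2 ≤ Y ^ 174 / 25 := by
    have h1 : 2 * (Y ^ 34 / 60) + 3 ≤ Y ^ 34 / 20 := by linarith
    rw [e34]
    calc Y ^ 106 * (8 * (2 * (Y ^ 34 / 60) + 3) ^ 2) * 2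
        ≤ Y ^ 106 * (8 * (Y ^ 34 / 20) ^ 2) * 2 := by gcongr
      _ = Y ^ 174 / 25 := by ring
  have b4 : 10 ^ 6 * b * Y ^ 61 * (3 * (χ * Y ^ 44) *
      (((Y ^ 58 + 2 * (60 * Y ^ 24)) / (60 * Y ^ 24) + 2) ^ 2 * 4)) ≤ Y ^ 174 / 2 := by
    have e : (Y ^ 58 + 2 * (60 * Y ^ 24)) / (60 * Y ^ 24) = Y ^ 34 / 60 + 2 := by field_simp
    have h1 : Y ^ 34 / 60 + 2 + 2 ≤ Y ^ 34 := by linarith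
    rw [e]
    calc 10 ^ 6 * b * Y ^ 61 * (3 * (χ * Y ^ 44) * ((Y ^ 34 / 60 + 2 + 2) ^ 2 * 4))
        ≤ 10 ^ 6 * b * Y ^ 61 * (3 * (χ * Y ^ 44) * ((Y ^ 34) ^ 2 * 4)) := by gcongr
      _ = 24 * (10 ^ 6 * b) * χ * Y ^ 173 / 2 := by ring
      _ ≤ Y * Y ^ 173 / 2 := by gcongr
      _ = Y ^ 174 / 2 := by ring
  have hY174 := hpow 174 (by norm_num)
  rw [hcard] at hmain
  linarith

lemma distinctDists_eq_card (P : Finset (Pt 3)) (p : Pt 3) :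
    distinctDists P p = #((P.erase p).image (dist p)) := by
  rw [distinctDists, ← Set.ncard_coe_finset]
  congr 1
  ext r
  simp only [Set.mem_ofPred_eq, coe_image, Set.mem_image, Finset.mem_coe, mem_erase]
  constructor
  · rintro ⟨q, hq, hqp, hd⟩
    exact ⟨q, ⟨hqp, hq⟩, hd⟩
  · rintro ⟨q, ⟨hqp, hq⟩, hd⟩
    exact ⟨q, hq, hqp, hd⟩

lemma one_le_distinctDists (h : 2 ≤ #P) (p : Pt 3) : 1 ≤ distinctDists P p := by
  rw [distinctDists_eq_card, Nat.one_le_iff_ne_zero, ← Nat.pos_iff_ne_zero, card_pos, image_nonempty]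
  obtain ⟨q, hq, hqp⟩ := exists_mem_ne (by omega : 1 < #P) p
  exact ⟨q, mem_erase.2 ⟨hqp, hq⟩⟩

lemma IsHomogeneous.coordSpread (h : IsHomogeneous b P) :
    CoordSpread P ((#P : ℝ) ^ (1 / 3 : ℝ)) := by
  obtain ⟨a, ha⟩ := h.1
  intro x hx y hy i
  have h1 := (ha hx i).2
  have h2 := (ha hy i).1
  push_cast at h1
  linarith

lemma WellSeparated.one_le (h : WellSeparated b P) (hne : P.Nonempty) : 1 ≤ b := by
  obtain ⟨p, hp⟩ := hne
  have := h.card_le (S := {p}) (singleton_subset_iff.2 hp) fun x hx y hy i => by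
    rw [mem_singleton.1 hx, mem_singleton.1 hy, sub_self]
    exact zero_le_one
  simpa using this

end HomogeneousDistances

/-- Every `b`-homogeneous set of `n ≥ 2` points in `ℝ³` has a point from which
there are at least `c · n^(53/87)` distinct distances. -/
theorem distinct_distances_homogeneous_3D (b : ℝ) (hb : 0 < b) :
    ∃ c : ℝ, 0 < c ∧
      ∀ P : Finset (Pt 3), IsHomogeneous b P → 2 ≤ P.card →
        ∃ p ∈ P, c * (P.card : ℝ) ^ ((53 : ℝ) / 87) ≤ (distinctDists P p : ℝ) := by
  rcases lt_or_ge b 1 with hb1 | hb1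
  · refine ⟨1, one_pos, fun P hP h2 => ?_⟩
    exact absurd (hP.2.one_le (Finset.card_pos.1 (by omega))) (not_le.2 hb1)
  obtain ⟨Y₀, hY₀, hmain⟩ := exists_point_many_distances hb1
  have hY₀pos : 0 < Y₀ := one_pos.trans_le hY₀
  refine ⟨(Y₀ ^ 106)⁻¹, by positivity, fun P hP h2 => ?_⟩
  set Y : ℝ := (P.card : ℝ) ^ (1 / 174 : ℝ) with hY
  have hn : (0 : ℝ) ≤ P.card := Nat.cast_nonneg _
  have hpow : ∀ k : ℕ, Y ^ k = (P.card : ℝ) ^ ((k : ℝ) / 174) := by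
    intro k
    rw [hY, ← Real.rpow_natCast, ← Real.rpow_mul hn]
    congr 1
    ring
  have h106 : (P.card : ℝ) ^ ((53 : ℝ) / 87) = Y ^ 106 := by
    rw [hpow]
    norm_num
  have hY0 : 0 ≤ Y := Real.rpow_nonneg hn _
  rw [h106]
  rcases le_total Y₀ Y with hle | hle
  · obtain ⟨p, hp, hd⟩ := hmain Y hle P hP.2 (by rw [hpow]; norm_num)
      (by rw [hpow]; convert hP.coordSpread using 2; norm_num)
    refine ⟨p, hp, ?_⟩
    rw [distinctDists_eq_card]
    refine le_trans (mul_le_of_le_one_left (by positivity) ?_) hd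
    exact inv_le_one_of_one_le₀ (one_le_pow₀ hY₀)
  · obtain ⟨p, hp⟩ : P.Nonempty := Finset.card_pos.1 (by omega)
    refine ⟨p, hp, le_trans ?_ (Nat.one_le_cast.2 (one_le_distinctDists h2 p))⟩
    rw [inv_mul_le_one₀ (by positivity)]
    gcongr
end
end
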